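/- Talenti bubble estimates for the critical Choquard problem: Let n ≥ 3 and 0 < μ < n, set 2_μ^* = (2n − μ)/(n − 2), and let S_{H,L} be the best Hardy–Littlewood–Sobolev–Sobolev constant, S_{H,L} = inf over nonzero u ∈ C_c^∞(ℝ^n) of ( ∫ ‖∇u‖² dx ) / ( ∫∫ |u(x)|^{2_μ^*} |u(y)|^{2_μ^*} / ‖x − y‖^μ dx dy )^{(n−2)/(2n−μ)}. Let ψ ∈ C_c^∞(ℝ^n) satisfy 0 ≤ ψ ≤ 1, ψ ≡ 1 on the ball B_r(0) and ψ ≡ 0 outside B_{2r}(0), for some r > 0. Then there exist a normalizing constant c_{n,μ} > 0 and constants C > 0, ε₀ ∈ (0, 1) such that, setting V_ε(x) = c_{n,μ} ( ε / (ε² + ‖x‖²) )^{(n−2)/2} and w_ε = ψ V_ε, for all ε ∈ (0, ε₀): (i) ∫_{ℝ^n} ‖∇w_ε‖² dx ≤ S_{H,L}^{(2n−μ)/(n−μ+2)} + C ε^{n−2}; (ii) ∫∫ |w_ε(x)|^{2_μ^*} |w_ε(y)|^{2_μ^*} / ‖x − y‖^μ dx dy ≤ S_{H,L}^{(2n−μ)/(n−μ+2)}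 + C ε^n; and (iii) ∫∫ |w_ε(x)|^{2_μ^*} |w_ε(y)|^{2_μ^*} / ‖x − y‖^μ dx dy ≥ S_{H,L}^{(2n−μ)/(n−μ+2)} − C ε^n. -/

import Mathlib

open MeasureTheory ENNReal

/-- The best constant `S_{H,L}` for the critical Choquard (Hardy–Littlewood–Sobolev)
quotient:
`S_{H,L} = inf { ∫‖∇u‖² / (∫∫ |u(x)|^{2_μ^*}|u(y)|^{2_μ^*}/‖x-y‖^μ)^{(n-2)/(2n-μ)} }`
over nonzero `u ∈ C_c^∞(ℝ^n)`. -/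
noncomputable def SHL (n : ℕ) (μ : ℝ) : ℝ :=
  sInf {t : ℝ | ∃ u : EuclideanSpace ℝ (Fin n) → ℝ,
    ContDiff ℝ (⊤ : ℕ∞) u ∧ HasCompactSupport u ∧ u ≠ 0 ∧
    t = (∫ x, ‖fderiv ℝ u x‖ ^ 2) /
        (∫ x, ∫ y, |u x| ^ ((2 * (n : ℝ) - μ) / ((n : ℝ) - 2)) *
            |u y| ^ ((2 * (n : ℝ) - μ) / ((n : ℝ) - 2)) / ‖x - y‖ ^ μ) ^
          (((n : ℝ) - 2) / (2 * (n : ℝ) - μ))}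

/-- coefficients of (1-x)^{-b} -/
noncomputable def dc (b : ℝ) : ℕ → ℝ
  | 0 => 1
  | (j+1) => dc b j * (b + j) / (j + 1)

lemma dc_pos {b : ℝ} (hb : 0 < b) (j : ℕ) : 0 < dc b j := by
  induction j with
  | zero => simp [dc]
  | succ j ih => rw [dc]; positivity

lemma dc_succ (b : ℝ) (j : ℕ) : dc b (j+1) * (j+1) = dc b j * (b + j) := by
  rw [dc]; field_simp

lemma dc_eq_choose (b : ℝ) (j : ℕ) : dc b j = Ring.choose (b + j - 1) j := by
  rw [Ring.choose_eq_smul]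
  rw [Polynomial.descPochhammer_smeval_eq_ascPochhammer, Polynomial.ascPochhammer_smeval_cast,
    Polynomial.ascPochhammer_smeval_eq_eval, show b + j - 1 - j + 1 = b by ring]
  induction j with
  | zero => simp [dc]
  | succ j ih =>
    rw [dc, ih, ascPochhammer_succ_eval, Nat.factorial_succ]
    have := Nat.factorial_ne_zero j
    simp only [smul_eq_mul]
    push_cast
    field_simp

lemma hasSum_dc (b : ℝ) {x : ℝ} (hx : |x| < 1) :
    HasSum (fun j => dc b j * x ^ j) ((1 - x) ^ (-b)) := by
  have h := (Real.one_div_one_sub_rpow_hasFPowerSeriesOnBall_zero b).hasSum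
    (y := x) (by simpa [Metric.mem_eball, edist_dist, Real.dist_eq] using hx)
  have hx' : 0 ≤ 1 - x := by linarith [(abs_lt.mp hx).2]
  rw [Real.rpow_neg hx', ← one_div]
  simp only [zero_add] at h
  have e : (fun j => dc b j * x ^ j) = fun j => ((FormalMultilinearSeries.ofScalars ℝ fun n ↦
      Ring.choose (b + n - 1) n) j) fun _ => x := by
    funext j
    simp [FormalMultilinearSeries.ofScalars, dc_eq_choose]
  rw [e]; exact h

lemma exists_W {n b : ℝ} (hb : 0 < b) (h2b : 2 * b < n) (m : ℕ) : ∀ M : ℕ, 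
    (∃ W : ℕ → ℝ, ∃ C : ℝ, 0 < C ∧ ∀ i, M ≤ i → dc b (i+1) ≤ W i * (i + n) - W (i+2) * (i+2) ∧
      0 ≤ W i ∧ W i ≤ C * dc b i) →
    (∃ W : ℕ → ℝ, ∃ C : ℝ, 0 < C ∧ ∀ i, dc b (i+1) ≤ W i * (i + n) - W (i+2) * (i+2) ∧
      0 ≤ W i ∧ W i ≤ C * dc b i) := by
  intro M
  induction M with
  | zero => intro ⟨W, C, hC, h⟩; exact ⟨W, C, hC, fun i => h i (Nat.zero_le _)⟩
  | succ M ih =>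
    rintro ⟨W, C, hC, h⟩
    apply ih
    set v := (dc b (M+1) + W (M+2) * (M+2)) / (M+n) with hv
    have hMn : 0 < (M:ℝ) + n := by have : (0:ℝ) ≤ M := Nat.cast_nonneg M; linarith
    have hv0 : 0 ≤ v := by
      have := (h (M+2) (by omega)).2.1
      have := dc_pos hb (M+1)
      positivity
    have hd := dc_pos hb M
    refine ⟨fun i => if i = M then v else W i, C + v / dc b M, by positivity, ?_⟩
    intro i hi
    rcases eq_or_lt_of_le hi with rfl | hi
    · simp only [if_true]
      rw [if_neg (by omega)]
      refine ⟨?_, hv0, ?_⟩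
      · rw [hv]; field_simp; linarith
      · have : v = v / dc b M * dc b M := by field_simp
        nlinarith [mul_pos hC hd]
    · simp only [if_neg (show i ≠ M by omega), if_neg (show i + 2 ≠ M by omega)]
      obtain ⟨h1, h2, h3⟩ := h i (by omega)
      refine ⟨h1, h2, h3.trans ?_⟩
      have := dc_pos hb i
      gcongr
      have : 0 ≤ v / dc b M := by positivity
      linarith

lemma exists_W' {n b : ℝ} (hb : 0 < b) (h2b : 2 * b < n) :
    (∃ W : ℕ → ℝ, ∃ C : ℝ, 0 < C ∧ ∀ i, dc b (i+1) ≤ W i * (i + n) - W (i+2) * (i+2) ∧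
      0 ≤ W i ∧ W i ≤ C * dc b i) := by
  set K := 2 / (n - 2 * b) with hK
  have hnb : 0 < n - 2 * b := by linarith
  have hK0 : 0 < K := by positivity
  have hK1 : K * (n - 2 * b) = 2 := by rw [hK]; field_simp
  obtain ⟨M, hM⟩ := exists_nat_gt ((K * b + 1) * (b - 1))
  apply exists_W hb h2b 0 M
  refine ⟨fun i => K * dc b i, K, hK0, ?_⟩
  intro i hi
  have hdi := dc_pos hb i
  refine ⟨?_, by positivity, le_refl _⟩
  have e1 := dc_succ b i
  have e2 := dc_succ b (i+1)
  push_cast at e2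
  have hi' : (M:ℝ) ≤ i := by exact_mod_cast hi
  have hi0 : (0:ℝ) ≤ i := Nat.cast_nonneg i
  have key : (K * b + 1) * (b + i) ≤ K * (n - b) * (i + 1) := by nlinarith
  have key2 : (K * b + 1) * dc b (i+1) ≤ K * (n - b) * dc b i := by
    have : (K * b + 1) * dc b (i+1) * (i+1) ≤ K * (n - b) * dc b i * (i+1) := by
      calc (K * b + 1) * dc b (i+1) * (i+1) = ((K * b + 1) * (b + i)) * dc b i := by
            rw [mul_assoc, e1]; ring
        _ ≤ (K * (n - b) * (i + 1)) * dc b i := by gcongr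
        _ = _ := by ring
    exact le_of_mul_le_mul_right this (by positivity)
  have e3 : dc b (i + 1 + 1) * (i + 2) = dc b (i+1) * (b + i + 1) := by linarith
  have : K * dc b i * (↑i + n) - K * dc b (i + 2) * (↑i + 2)
    = K * ((n - b) * dc b i - b * dc b (i+1)) := by
    have : K * dc b (i+2) * (i+2) = K * (dc b (i+1) * (b + i + 1)) := by rw [← e3]; ring
    rw [this]
    have : dc b i * i = dc b (i+1) * (i+1) - dc b i * b := by rw [e1]; ring
    linear_combination K * this
  simp only
  rw [this]; linarith

lemma frequently_small {v : ℕ → ℝ} (hv : ∀ j, 0 ≤ v j) (hs : Summable v) {b ε : ℝ} (hb : 0 < b)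
    (hε : 0 < ε) : ∃ᶠ N : ℕ in Filter.atTop, (b + N + 1) * v N < ε := by
  intro h
  simp only [not_lt] at h
  have h1 : ∀ᶠ N : ℕ in Filter.atTop, ‖(1 / (N:ℝ))‖ ≤ ((b + 2) / ε) * v N := by
    filter_upwards [h, Filter.eventually_ge_atTop 1] with N hN hN1
    have hN1' : (1:ℝ) ≤ N := by exact_mod_cast hN1
    have h0 := hv N
    rw [Real.norm_of_nonneg (by positivity)]
    rw [div_mul_eq_mul_div, div_le_div_iff₀ (by positivity) hε]
    nlinarith [mul_nonneg h0 (by linarith : 0 ≤ (N:ℝ) - 1), mul_nonneg hb.le (mul_nonneg h0 (by linarith : 0 ≤ (N:ℝ) - 1))]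
  have := Summable.of_norm_bounded_eventually_nat (hs.mul_left ((b+2)/ε)) h1
  exact Real.not_summable_one_div_natCast this

lemma coercive_seq {n b : ℝ} (hb : 0 < b) (h2b : 2 * b < n) : ∃ C : ℝ, 0 < C ∧
    ∀ q : ℕ → ℝ, (∀ j, 0 ≤ q j) → q 0 = 0 →
    (∀ j : ℕ, (j + 1) * q j ≤ (n + j + 1) * q (j + 2)) →
    ∀ A B : ℝ, HasSum (fun j => dc b j * q j) A → HasSum (fun j => dc b j * q (j+1)) B →
    A ≤ C * (B - b / (n - b) * A) := by
  obtain ⟨W, C, hC, hW⟩ := exists_W' hb h2b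
  have hnb : 0 < n - b := by linarith
  refine ⟨C * (n - b), by positivity, ?_⟩
  intro q hq hq0 hrec A B hA hB
  have hA' : HasSum (fun j => dc b (j+1) * q (j+1)) A := by
    have := (hasSum_nat_add_iff' 1).mpr hA
    simpa [hq0] using this
  set L : ℕ → ℝ := fun i => C * dc b i - W i with hL
  have hL0 : ∀ i, 0 ≤ L i := fun i => by have := (hW i).2.2; simp only [hL]; linarith
  have hLC : ∀ i, L i ≤ C * dc b i := fun i => by have := (hW i).2.1; simp only [hL]; linarith
  have hLi : ∀ i : ℕ, L i * (i + n) - L (i+2) * (i+2) ≤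
      C * ((n - b) * dc b i - b * dc b (i+1)) - dc b (i+1) := by
    intro i
    have h1 := (hW i).1
    have e1 := dc_succ b i
    have e2 := dc_succ b (i+1)
    push_cast at e2
    have : C * dc b i * (i + n) - C * dc b (i+2) * (i+2) = C * ((n - b) * dc b i - b * dc b (i+1)) := by
      linear_combination C * (-e2 - e1)
    simp only [hL]
    nlinarith
  have hind : ∀ N : ℕ, 0 ≤ (∑ i ∈ Finset.range (N+1), q (i+1) * (L i * (i + n) - L (i+2) * (i+2)))
      + L (N+1) * (N+1) * q N + L (N+2) * (N+2) * q (N+1) := by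
    intro N
    induction N with
    | zero =>
      simp only [zero_add, Finset.range_one, Finset.sum_singleton, Nat.cast_zero, hq0]
      have := mul_nonneg (mul_nonneg (hq 1) (hL0 0)) (by linarith : 0 ≤ n)
      linarith
    | succ N ih =>
      rw [Finset.sum_range_succ]
      push_cast
      have h1 := hrec N
      have h2 : L (N+1) * ((N+1) * q N) ≤ L (N+1) * ((n + N + 1) * q (N+2)) :=
        mul_le_mul_of_nonneg_left h1 (hL0 _)
      have e : N + 1 + 1 = N + 2 := rfl
      have e' : N + 1 + 2 = N + 3 := rfl
      rw [e, e']
      nlinarith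
  have hsum : HasSum (fun i => q (i+1) * (C * ((n - b) * dc b i - b * dc b (i+1)) - dc b (i+1)))
      (C * ((n-b) * B - b * A) - A) := by
    have h := (((hB.mul_left (n-b)).sub (hA'.mul_left b)).mul_left C).sub hA'
    refine HasSum.congr_fun h ?_
    intro i; ring
  have hlim := (Filter.tendsto_add_atTop_iff_nat 1).mpr hsum.tendsto_sum_nat
  have hmain : 0 ≤ C * ((n-b) * B - b * A) - A := by
    apply _root_.le_of_forall_pos_le_add
    intro ε hε
    have hfreq := frequently_small (v := fun N => dc b N * q N + dc b (N+1) * q (N+1))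
      (fun j => by
        have := dc_pos hb j; have := dc_pos hb (j+1); have := hq j; have := hq (j+1); positivity)
      (hA.summable.add hA'.summable) hb (ε := ε / C) (by positivity)
    have hlt : ∃ᶠ N : ℕ in Filter.atTop, -ε ≤ ∑ i ∈ Finset.range (N+1),
        q (i+1) * (C * ((n - b) * dc b i - b * dc b (i+1)) - dc b (i+1)) := by
      refine hfreq.mono ?_
      intro N hN
      have h1 := hind N
      have h2 : ∑ i ∈ Finset.range (N+1), q (i+1) * (L i * (i + n) - L (i+2) * (i+2)) ≤
         ∑ i ∈ Finset.range (N+1),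
          q (i+1) * (C * ((n - b) * dc b i - b * dc b (i+1)) - dc b (i+1)) :=
        Finset.sum_le_sum fun i _ => mul_le_mul_of_nonneg_left (hLi i) (hq _)
      have e1 := dc_succ b N
      have e2 := dc_succ b (N+1)
      push_cast at e2
      have a1 : L (N+1) * (N+1) * q N ≤ C * (b + N) * (dc b N * q N) := by
        calc L (N+1) * (N+1) * q N ≤ (C * dc b (N+1)) * (N+1) * q N := by
              have := hq N; have := hLC (N+1); gcongr
          _ = C * (b + N) * (dc b N * q N) := by rw [mul_assoc C, e1]; ring
      have a2 : L (N+2) * (N+2) * q (N+1) ≤ C * (b + N + 1) * (dc b (N+1) * q (N+1)) := by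
        calc L (N+2) * (N+2) * q (N+1) ≤ (C * dc b (N+2)) * (N+2) * q (N+1) := by
              have := hq (N+1); have := hLC (N+2); gcongr
          _ = C * (b + N + 1) * (dc b (N+1) * q (N+1)) := by 
              linear_combination C * q (N+1) * e2
      have a3 : C * ((b + N + 1) * (dc b N * q N + dc b (N+1) * q (N+1))) < ε := by
        have := mul_lt_mul_of_pos_left hN hC
        rwa [mul_div_cancel₀ _ hC.ne'] at this
      have a4 : 0 ≤ C * (dc b N * q N) := by
        have := dc_pos hb N; have := hq N; positivity
      nlinarith
    have : -ε ≤ C * ((n-b) * B - b * A) - A := by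
      by_contra hcon
      push Not at hcon
      exact hlt (((hlim.eventually (gt_mem_nhds hcon))).mono fun N hN => not_le.mpr hN)
    linarith
  have : C * (n - b) * (B - b / (n - b) * A) = C * ((n-b) * B - b * A) := by field_simp
  rw [this]; linarith

/-- bounded measurable functions -/
structure BM {X : Type*} [MeasurableSpace X] (g : X → ℝ) : Prop where
  meas : Measurable g
  bdd : ∃ M : ℝ, ∀ x, |g x| ≤ M

namespace BM
variable {X : Type*} [MeasurableSpace X] {f g : X → ℝ}

lemma const (c : ℝ) : BM (fun _ : X => c) := ⟨measurable_const, |c|, fun _ => le_rfl⟩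

lemma add (hf : BM f) (hg : BM g) : BM (fun x => f x + g x) := by
  obtain ⟨F, hF⟩ := hf.bdd
  obtain ⟨G, hG⟩ := hg.bdd
  exact ⟨hf.meas.add hg.meas, F + G, fun x => (abs_add_le _ _).trans (add_le_add (hF x) (hG x))⟩

lemma mul (hf : BM f) (hg : BM g) : BM (fun x => f x * g x) := by
  obtain ⟨F, hF⟩ := hf.bdd
  obtain ⟨G, hG⟩ := hg.bdd
  refine ⟨hf.meas.mul hg.meas, F * G, fun x => ?_⟩
  rw [abs_mul]
  exact mul_le_mul (hF x) (hG x) (abs_nonneg _) ((abs_nonneg _).trans (hF x))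

lemma const_mul (c : ℝ) (hg : BM g) : BM (fun x => c * g x) := (BM.const c).mul hg

lemma neg (hg : BM g) : BM (fun x => - g x) := by simpa using hg.const_mul (-1)

lemma sub (hf : BM f) (hg : BM g) : BM (fun x => f x - g x) := by
  simpa [sub_eq_add_neg] using hf.add hg.neg

lemma pow (hf : BM f) (j : ℕ) : BM (fun x => f x ^ j) := by
  induction j with
  | zero => simpa using BM.const (X := X) 1
  | succ j ih => simpa [pow_succ] using ih.mul hf

lemma sum {ι : Type*} (s : Finset ι) {f : ι → X → ℝ} (hf : ∀ i, BM (f i)) :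
    BM (fun x => ∑ i ∈ s, f i x) := by
  classical
  induction s using Finset.induction_on with
  | empty => simpa using BM.const (X := X) 0
  | insert a s ha ih => simpa [Finset.sum_insert ha] using (hf a).add ih

lemma prod {ι : Type*} (s : Finset ι) {f : ι → X → ℝ} (hf : ∀ i, BM (f i)) :
    BM (fun x => ∏ i ∈ s, f i x) := by
  classical
  induction s using Finset.induction_on with
  | empty => simpa using BM.const (X := X) 1
  | insert a s ha ih => simpa [Finset.prod_insert ha] using (hf a).mul ih

lemma comp {Y : Type*} [MeasurableSpace Y] (hf : BM f) {φ : Y → X} (hφ : Measurable φ) :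
    BM (fun y => f (φ y)) := by
  obtain ⟨F, hF⟩ := hf.bdd
  exact ⟨hf.meas.comp hφ, F, fun y => hF _⟩

lemma fst (hf : BM f) : BM (fun z : X × X => f z.1) := hf.comp measurable_fst
lemma snd (hf : BM f) : BM (fun z : X × X => f z.2) := hf.comp measurable_snd

lemma integrable (hf : BM f) (P : Measure X) [IsFiniteMeasure P] : Integrable f P := by
  obtain ⟨F, hF⟩ := hf.bdd
  exact Integrable.of_bound hf.meas.aestronglyMeasurable F (Filter.Eventually.of_forall hF)

lemma mul_integrable {P : Measure X} (hf : BM f) (hg : Integrable g P) :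
    Integrable (fun x => f x * g x) P := by
  obtain ⟨F, hF⟩ := hf.bdd
  exact hg.bdd_mul hf.meas.aestronglyMeasurable (Filter.Eventually.of_forall hF)
end BM

lemma taylor3 (m : ℕ) : ∃ C : ℝ, 0 ≤ C ∧ ∀ t x : ℝ, |t| ≤ 1 → |x| ≤ 1 → ∃ R : ℝ, |R| ≤ C ∧
    (t + x)^(m+2) = t^(m+2) + (m+2) * t^(m+1) * x + (m+2)*(m+1)/2 * t^m * x^2 + x^3 * R := by
  induction m with
  | zero => exact ⟨0, le_rfl, fun t x _ _ => ⟨0, by simp, by push_cast; ring⟩⟩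
  | succ m ih =>
    obtain ⟨C, hC0, h⟩ := ih
    refine ⟨(m+2)*(m+1)/2 + 2 * C, by positivity, fun t x ht hx => ?_⟩
    obtain ⟨R, hR, e⟩ := h t x ht hx
    refine ⟨(m+2)*(m+1)/2 * t^m + (t+x) * R, ?_, ?_⟩
    · refine (abs_add_le _ _).trans (add_le_add ?_ ?_)
      · rw [abs_mul, abs_of_nonneg (by positivity : (0:ℝ) ≤ (m+2)*(m+1)/2), abs_pow]
        exact mul_le_of_le_one_right (by positivity) (pow_le_one₀ (abs_nonneg _) ht)
      · rw [abs_mul]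
        exact mul_le_mul ((abs_add_le _ _).trans (by linarith)) hR (abs_nonneg _) (by norm_num)
    · rw [show m + 1 + 2 = (m+2)+1 from rfl, pow_succ, e]; push_cast; ring

section
variable {X : Type*} [MeasurableSpace X] {P : Measure X} [IsProbabilityMeasure P]
  {ι : Type*} [Fintype ι] {ξ ζ : ι → X → ℝ} {g : X → ℝ}

/-- inner product kernel -/
def tk (ξ ζ : ι → X → ℝ) (z : X × X) : ℝ := ∑ a, ξ a z.1 * ζ a z.2

lemma tk_BM (hξ : ∀ a, BM (ξ a)) (hζ : ∀ a, BM (ζ a)) : BM (tk ξ ζ) :=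
  BM.sum _ fun a => (hξ a).fst.mul (hζ a).snd

lemma psd_gen (hg : BM g) (hξ : ∀ a, BM (ξ a)) (hζ : ∀ a, BM (ζ a)) (j : ℕ) :
    0 ≤ ∫ z, g z.1 * g z.2 * (tk ξ ξ z ^ j - tk ξ ζ z ^ j - tk ζ ξ z ^ j + tk ζ ζ z ^ j)
      ∂(P.prod P) := by
  have e : ∀ z : X × X, g z.1 * g z.2 * (tk ξ ξ z ^ j - tk ξ ζ z ^ j - tk ζ ξ z ^ j + tk ζ ζ z ^ j)
     = ∑ p : Fin j → ι, (g z.1 * (∏ i, ξ (p i) z.1 - ∏ i, ζ (p i) z.1)) *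
        (g z.2 * (∏ i, ξ (p i) z.2 - ∏ i, ζ (p i) z.2)) := by
    intro z
    simp only [tk, Fintype.sum_pow, Finset.prod_mul_distrib]
    rw [← Finset.sum_sub_distrib, ← Finset.sum_sub_distrib, ← Finset.sum_add_distrib,
      Finset.mul_sum]
    refine Finset.sum_congr rfl fun p _ => by ring
  simp_rw [e]
  have hm : ∀ p : Fin j → ι, BM fun x => g x * (∏ i, ξ (p i) x - ∏ i, ζ (p i) x) := fun p =>
    hg.mul ((BM.prod _ fun i => hξ (p i)).sub (BM.prod _ fun i => hζ (p i)))
  rw [integral_finsetSum _ fun p _ => ((hm p).fst.mul (hm p).snd).integrable _]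
  refine Finset.sum_nonneg fun p _ => ?_
  rw [integral_prod_mul (fun x => g x * (∏ i, ξ (p i) x - ∏ i, ζ (p i) x))
    (fun x => g x * (∏ i, ξ (p i) x - ∏ i, ζ (p i) x))]
  exact mul_self_nonneg _

/-- quadratic form with kernel κ -/
noncomputable def Qf (P : Measure X) (κ : X × X → ℝ) (g : X → ℝ) : ℝ :=
  ∫ z, g z.1 * g z.2 * κ z ∂(P.prod P)

lemma Qpow_nonneg (hg : BM g) (hξ : ∀ a, BM (ξ a)) (j : ℕ) :
    0 ≤ Qf P (fun z => tk ξ ξ z ^ j) g := by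
  rcases Nat.eq_zero_or_pos j with rfl | hj
  · simp only [Qf, pow_zero, mul_one]
    rw [integral_prod_mul g g]; exact mul_self_nonneg _
  · have := psd_gen (P := P) hg hξ (ζ := fun _ _ => 0) (fun _ => BM.const 0) j
    simpa [tk, Qf, hj.ne'] using this

lemma tk_abs_le (h1 : ∀ x, ∑ a, ξ a x ^ 2 = 1) (z : X × X) : |tk ξ ξ z| ≤ 1 := by
  have := Finset.sum_mul_sq_le_sq_mul_sq Finset.univ (fun a => ξ a z.1) (fun a => ξ a z.2)
  rw [h1, h1] at this
  rw [← sq_le_one_iff_abs_le_one]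
  simpa [tk] using this

lemma abs_le_one_of (h1 : ∀ x, ∑ a, ξ a x ^ 2 = 1) (a : ι) (x : X) : |ξ a x| ≤ 1 := by
  rw [← sq_le_one_iff_abs_le_one, ← h1 x]
  exact Finset.single_le_sum (f := fun a => ξ a x ^ 2) (fun _ _ => sq_nonneg _) (Finset.mem_univ a)

lemma pair_ineq (hg : BM g) (hξ : ∀ a, BM (ξ a)) (h1 : ∀ x, ∑ a, ξ a x ^ 2 = 1) (m : ℕ)
    {a b : ι} (hab : a ≠ b) :
    0 ≤ ∫ z, g z.1 * g z.2 * ((m+2) * tk ξ ξ z ^ (m+1) * (ξ a z.1 * ξ a z.2 + ξ b z.1 * ξ b z.2)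
      - (m+2) * (m+1) * tk ξ ξ z ^ m * (ξ a z.1 * ξ b z.2 - ξ b z.1 * ξ a z.2)^2) ∂(P.prod P) := by
  classical
  obtain ⟨C, hC0, hC⟩ := taylor3 m
  obtain ⟨G, hG⟩ := hg.bdd
  set u : X × X → ℝ := fun z => ξ a z.1 * ξ b z.2 - ξ b z.1 * ξ a z.2 with hu
  set v : X × X → ℝ := fun z => ξ a z.1 * ξ a z.2 + ξ b z.1 * ξ b z.2 with hv
  have habs : ∀ (c d : ι) (z : X × X), |ξ c z.1 * ξ d z.2| ≤ 1 := fun c d z => by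
    rw [abs_mul]; exact mul_le_one₀ (abs_le_one_of h1 _ _) (abs_nonneg _) (abs_le_one_of h1 _ _)
  have hu2 : ∀ z, |u z| ≤ 2 := fun z => (abs_sub _ _).trans (by linarith [habs a b z, habs b a z])
  have hv2 : ∀ z, |v z| ≤ 2 := fun z => (abs_add_le _ _).trans (by linarith [habs a a z, habs b b z])
  have hBu : BM u := ((hξ a).fst.mul (hξ b).snd).sub ((hξ b).fst.mul (hξ a).snd)
  have hBv : BM v := ((hξ a).fst.mul (hξ a).snd).add ((hξ b).fst.mul (hξ b).snd)
  have ht := tk_BM hξ hξ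
  have hK : BM fun z => g z.1 * g z.2 * ((m+2) * tk ξ ξ z ^ (m+1) * v z
      - (m+2) * (m+1) * tk ξ ξ z ^ m * u z ^2) :=
    (hg.fst.mul hg.snd).mul ((((ht.pow _).const_mul _).mul hBv).sub (((ht.pow _).const_mul _).mul (hBu.pow 2)))
  set K : X × X → ℝ := fun z => (m+2) * tk ξ ξ z ^ (m+1) * v z
      - (m+2) * (m+1) * tk ξ ξ z ^ m * u z ^2 with hKdef
  set D : ℝ := 4 * ((m+2)*(m+1)/2) + 8 * C + 16 * C with hD
  have hmain : ∀ θ : ℝ, 0 < θ → θ ≤ 1/2 → 0 ≤ (∫ z, g z.1 * g z.2 * K z ∂(P.prod P)) + θ * (G * G * D) := by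
    intro θ h0 hθ
    set ζ : ι → X → ℝ := fun c => if c = a then (fun x => ξ a x + θ * ξ b x) else
      if c = b then (fun x => ξ b x - θ * ξ a x) else ξ c with hζ
    have hζB : ∀ c, BM (ζ c) := by
      intro c
      simp only [hζ]
      split_ifs
      · exact (hξ a).add ((hξ b).const_mul θ)
      · exact (hξ b).sub ((hξ a).const_mul θ)
      · exact hξ c
    have hpsd := psd_gen (P := P) hg hξ hζB (m+2)
    have hζa : ζ a = fun x => ξ a x + θ * ξ b x := by simp [hζ]
    have hζb : ζ b = fun x => ξ b x - θ * ξ a x := by simp [hζ, hab.symm]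
    have split : ∀ (f h : ι → X → ℝ) z, tk f h z = f a z.1 * h a z.2 + (f b z.1 * h b z.2 +
        ∑ c ∈ (Finset.univ.erase a).erase b, f c z.1 * h c z.2) := by
      intro f h z
      rw [tk, ← Finset.add_sum_erase _ _ (Finset.mem_univ a),
        ← Finset.add_sum_erase _ _ (Finset.mem_erase.mpr ⟨hab.symm, Finset.mem_univ b⟩)]
    have hrest : ∀ c ∈ (Finset.univ.erase a).erase b, ζ c = ξ c := by
      intro c hc
      simp only [Finset.mem_erase] at hc
      simp [hζ, hc.1, hc.2.1]
    have e1 : ∀ z, tk ξ ζ z = tk ξ ξ z + θ * u z := by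
      intro z
      rw [split ξ ζ, split ξ ξ, hζa, hζb,
        Finset.sum_congr rfl (fun c hc => by rw [hrest c hc])]
      simp only [hu]; ring
    have e2 : ∀ z, tk ζ ξ z = tk ξ ξ z + - (θ * u z) := by
      intro z
      rw [split ζ ξ, split ξ ξ, hζa, hζb,
        Finset.sum_congr rfl (fun c hc => by rw [hrest c hc])]
      simp only [hu]; ring
    have e3 : ∀ z, tk ζ ζ z = tk ξ ξ z + θ^2 * v z := by
      intro z
      rw [split ζ ζ, split ξ ξ, hζa, hζb,
        Finset.sum_congr rfl (fun c hc => by rw [hrest c hc])]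
      simp only [hv]; ring
    have hptw : ∀ z, g z.1 * g z.2 * (tk ξ ξ z ^ (m+2) - tk ξ ζ z ^ (m+2) - tk ζ ξ z ^ (m+2)
        + tk ζ ζ z ^ (m+2)) ≤ θ^2 * (g z.1 * g z.2 * K z) + θ^3 * (G * G * D) := by
      intro z
      have hu' := hu2 z
      have hv' := hv2 z
      have ht1 := tk_abs_le h1 z
      have hx1 : |θ * u z| ≤ 1 := by rw [abs_mul, abs_of_pos h0]; nlinarith [abs_nonneg (u z)]
      have hx2 : |θ^2 * v z| ≤ 1 := by
        rw [abs_mul, abs_of_pos (by positivity)]; nlinarith [abs_nonneg (v z)]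
      obtain ⟨R1, hR1, f1⟩ := hC (tk ξ ξ z) (θ * u z) ht1 hx1
      obtain ⟨R2, hR2, f2⟩ := hC (tk ξ ξ z) (-(θ * u z)) ht1 (by rwa [abs_neg])
      obtain ⟨R3, hR3, f3⟩ := hC (tk ξ ξ z) (θ^2 * v z) ht1 hx2
      rw [e1, e2, e3, f1, f2, f3]
      set t := tk ξ ξ z
      set E : ℝ := (m+2)*(m+1)/2 * t^m * (θ * v z ^2) + (θ^3 * v z ^3 * R3) - u z^3 * R1 + u z^3 * R2
        with hE
      have hu3 : |u z|^3 ≤ 8 := by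
        have := pow_le_pow_left₀ (abs_nonneg _) hu' 3; norm_num at this ⊢; exact this
      have hv3 : |v z|^3 ≤ 8 := by
        have := pow_le_pow_left₀ (abs_nonneg _) hv' 3; norm_num at this ⊢; exact this
      have hv22 : |v z|^2 ≤ 4 := by
        have := pow_le_pow_left₀ (abs_nonneg _) hv' 2; norm_num at this ⊢; exact this
      have hθ1 : θ ≤ 1 := by linarith
      have hED : |E| ≤ D := by
        have a1 : |((m:ℝ)+2)*(m+1)/2 * t^m * (θ * v z ^2)| ≤ 4 * (((m:ℝ)+2)*(m+1)/2) := by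
          rw [abs_mul, abs_mul, abs_mul, abs_pow, abs_pow, abs_of_nonneg (by positivity : (0:ℝ) ≤ (m+2)*(m+1)/2), abs_of_pos h0]
          have : |t|^m ≤ 1 := pow_le_one₀ (abs_nonneg _) ht1
          calc _ ≤ ((m:ℝ)+2)*(m+1)/2 * 1 * (1 * 4) := by gcongr
            _ = _ := by ring
        have a2 : |θ^3 * v z ^3 * R3| ≤ 8 * C := by
          rw [abs_mul, abs_mul, abs_pow, abs_pow, abs_of_pos h0]
          calc _ ≤ 1 * 8 * C := by
                have : θ^3 ≤ 1 := pow_le_one₀ h0.le hθ1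
                gcongr
            _ = _ := by ring
        have a3 : ∀ R, |R| ≤ C → |u z^3 * R| ≤ 8 * C := by
          intro R hR
          rw [abs_mul, abs_pow]; gcongr
        have b1 := a3 R1 hR1
        have b2 := a3 R2 hR2
        rw [abs_le] at a1 a2 b1 b2 ⊢
        constructor <;> simp only [hE, hD] <;> linarith
      have hgg : |g z.1 * g z.2| ≤ G * G := by
        rw [abs_mul]; exact mul_le_mul (hG _) (hG _) (abs_nonneg _) ((abs_nonneg _).trans (hG z.1))
      have hgE : g z.1 * g z.2 * E ≤ G * G * D := by
        refine (le_abs_self _).trans ?_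
        rw [abs_mul]
        exact mul_le_mul hgg hED (abs_nonneg _) ((abs_nonneg _).trans hgg)
      have := mul_le_mul_of_nonneg_left hgE (by positivity : 0 ≤ θ^3)
      refine le_trans (le_of_eq ?_) (add_le_add_right this (θ^2 * (g z.1 * g z.2 * K z)))
      simp only [hKdef, hE]; ring
    have hint : Integrable (fun z => g z.1 * g z.2 * (tk ξ ξ z ^ (m+2) - tk ξ ζ z ^ (m+2) - tk ζ ξ z ^ (m+2)
        + tk ζ ζ z ^ (m+2))) (P.prod P) :=
      ((hg.fst.mul hg.snd).mul (((((tk_BM hξ hξ).pow _).sub ((tk_BM hξ hζB).pow _)).sub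
        ((tk_BM hζB hξ).pow _)).add ((tk_BM hζB hζB).pow _))).integrable _
    have hle := integral_mono hint (((hK.integrable (P.prod P)).const_mul (θ^2)).add
      (integrable_const (θ^3 * (G * G * D)))) hptw
    have h3 := hpsd.trans hle
    simp only [Pi.add_apply] at h3
    rw [integral_add ((hK.integrable (P.prod P)).const_mul (θ^2)) (integrable_const _),
      integral_const_mul, integral_const] at h3
    simp only [probReal_univ, smul_eq_mul, one_mul] at h3
    have : 0 ≤ θ^2 * ((∫ z, g z.1 * g z.2 * K z ∂(P.prod P)) + θ * (G * G * D)) := by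
      refine h3.trans (le_of_eq ?_); ring
    exact nonneg_of_mul_nonneg_right this (by positivity)
  have hlim : Filter.Tendsto (fun θ : ℝ => (∫ z, g z.1 * g z.2 * K z ∂(P.prod P)) + θ * (G * G * D))
      (nhdsWithin 0 (Set.Ioi 0)) (nhds ((∫ z, g z.1 * g z.2 * K z ∂(P.prod P)) + 0 * (G * G * D))) := by
    apply Filter.Tendsto.mono_left _ nhdsWithin_le_nhds
    exact (Continuous.tendsto (by fun_prop) 0)
  rw [zero_mul, add_zero] at hlim
  refine ge_of_tendsto hlim ?_
  filter_upwards [Ioc_mem_nhdsGT (show (0:ℝ) < 1/2 by norm_num)] with θ hθ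
  exact hmain θ hθ.1 hθ.2

lemma Q_rec (hg : BM g) (hξ : ∀ a, BM (ξ a)) (h1 : ∀ x, ∑ a, ξ a x ^ 2 = 1) (m : ℕ) :
    ((m:ℝ)+1) * Qf P (fun z => tk ξ ξ z ^ m) g ≤
      ((Fintype.card ι : ℝ) + m) * Qf P (fun z => tk ξ ξ z ^ (m+2)) g := by
  classical
  have ht := tk_BM hξ hξ
  have h := Finset.sum_nonneg (s := (Finset.univ : Finset (ι × ι)).filter (fun p => p.1 ≠ p.2))
    (fun p hp => pair_ineq (P := P) hg hξ h1 m (Finset.mem_filter.mp hp).2)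
  rw [← integral_finsetSum] at h
  swap
  · intro p _
    exact ((hg.fst.mul hg.snd).mul ((((ht.pow _).const_mul _).mul (((hξ _).fst.mul (hξ _).snd).add ((hξ _).fst.mul (hξ _).snd))).sub
      (((ht.pow _).const_mul _).mul ((((hξ _).fst.mul (hξ _).snd).sub ((hξ _).fst.mul (hξ _).snd)).pow 2)))).integrable _
  have hQ : ∀ j, Integrable (fun z : X × X => g z.1 * g z.2 * tk ξ ξ z ^ j) (P.prod P) := fun j =>
    ((hg.fst.mul hg.snd).mul (ht.pow j)).integrable _
  have e : ∀ z : X × X, ∑ p ∈ (Finset.univ : Finset (ι × ι)).filter (fun p => p.1 ≠ p.2),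
      (g z.1 * g z.2 * ((m+2) * tk ξ ξ z ^ (m+1) * (ξ p.1 z.1 * ξ p.1 z.2 + ξ p.2 z.1 * ξ p.2 z.2)
      - (m+2) * (m+1) * tk ξ ξ z ^ m * (ξ p.1 z.1 * ξ p.2 z.2 - ξ p.2 z.1 * ξ p.1 z.2)^2)) =
      2 * (m+2) * ((Fintype.card ι + m) * (g z.1 * g z.2 * tk ξ ξ z ^ (m+2)) -
        (m+1) * (g z.1 * g z.2 * tk ξ ξ z ^ m)) := by
    intro z
    set t := tk ξ ξ z with htd
    have s1 : ∑ p ∈ (Finset.univ : Finset (ι × ι)).filter (fun p => p.1 ≠ p.2),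
       (ξ p.1 z.1 * ξ p.1 z.2 + ξ p.2 z.1 * ξ p.2 z.2) = 2 * (Fintype.card ι - 1) * t := by
      rw [Finset.sum_filter]
      have : ∀ p : ι × ι, (if p.1 ≠ p.2 then (ξ p.1 z.1 * ξ p.1 z.2 + ξ p.2 z.1 * ξ p.2 z.2) else 0) =
        (ξ p.1 z.1 * ξ p.1 z.2 + ξ p.2 z.1 * ξ p.2 z.2) - if p.1 = p.2 then 2 * (ξ p.1 z.1 * ξ p.1 z.2) else 0 := by
        intro p
        by_cases hp : p.1 = p.2
        · simp [hp]; ring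
        · simp [hp]
      simp_rw [this]
      rw [Finset.sum_sub_distrib, Fintype.sum_prod_type, Fintype.sum_prod_type]
      simp only [Finset.sum_add_distrib, Finset.sum_const, Finset.card_univ, nsmul_eq_mul,
        Finset.sum_ite_eq, Finset.mem_univ, if_true, ← Finset.mul_sum]
      simp only [htd, tk]; ring
    have s2 : ∑ p ∈ (Finset.univ : Finset (ι × ι)).filter (fun p => p.1 ≠ p.2),
       (ξ p.1 z.1 * ξ p.2 z.2 - ξ p.2 z.1 * ξ p.1 z.2)^2 = 2 * (1 - t^2) := by
      rw [Finset.sum_filter_of_ne]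
      · rw [Fintype.sum_prod_type]
        have : ∀ a b, (ξ a z.1 * ξ b z.2 - ξ b z.1 * ξ a z.2)^2 =
          ξ a z.1^2 * ξ b z.2^2 + ξ a z.2 ^2 * ξ b z.1^2 - 2 * (ξ a z.1 * ξ a z.2) * (ξ b z.1 * ξ b z.2) := by
          intro a b; ring
        simp_rw [this]
        simp only [Finset.sum_sub_distrib, Finset.sum_add_distrib, ← Finset.mul_sum, ← Finset.sum_mul, h1]
        simp only [htd, tk]; ring
      · intro p _ hp hpe
        apply hp; rw [hpe]; ring
    have : ∀ p : ι × ι, (g z.1 * g z.2 * ((m+2) * t ^ (m+1) * (ξ p.1 z.1 * ξ p.1 z.2 + ξ p.2 z.1 * ξ p.2 z.2)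
      - (m+2) * (m+1) * t ^ m * (ξ p.1 z.1 * ξ p.2 z.2 - ξ p.2 z.1 * ξ p.1 z.2)^2)) =
      (g z.1 * g z.2 * ((m+2) * t ^ (m+1))) * (ξ p.1 z.1 * ξ p.1 z.2 + ξ p.2 z.1 * ξ p.2 z.2)
      - (g z.1 * g z.2 * ((m+2) * (m+1) * t ^ m)) * (ξ p.1 z.1 * ξ p.2 z.2 - ξ p.2 z.1 * ξ p.1 z.2)^2 := by
      intro p; ring
    simp_rw [this]
    rw [Finset.sum_sub_distrib, ← Finset.mul_sum, ← Finset.mul_sum, s1, s2]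
    ring
  simp_rw [e] at h
  rw [integral_const_mul, integral_sub ((hQ _).const_mul _) ((hQ _).const_mul _),
    integral_const_mul, integral_const_mul] at h
  have := nonneg_of_mul_nonneg_right h (by positivity : (0:ℝ) < 2 * (m+2))
  simp only [Qf]
  linarith

end

lemma abel_lim {a : ℕ → ℝ} (ha : ∀ j, 0 ≤ a j) {F : ℝ → ℝ} {L : ℝ}
    (hF : ∀ r ∈ Set.Ioo (0:ℝ) 1, HasSum (fun j => a j * r^j) (F r))
    (hL : Filter.Tendsto F (nhdsWithin 1 (Set.Iio 1)) (nhds L)) : HasSum a L := by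
  have hmem : ∀ᶠ r : ℝ in nhdsWithin 1 (Set.Iio 1), r ∈ Set.Ioo (0:ℝ) 1 :=
    Ioo_mem_nhdsLT (by norm_num)
  have h1 : ∀ J, ∑ j ∈ Finset.range J, a j ≤ L := by
    intro J
    have : Filter.Tendsto (fun r : ℝ => ∑ j ∈ Finset.range J, a j * r^j) (nhdsWithin 1 (Set.Iio 1))
        (nhds (∑ j ∈ Finset.range J, a j * 1^j)) :=
      ((Continuous.tendsto (by fun_prop) 1)).mono_left nhdsWithin_le_nhds
    simp only [one_pow, mul_one] at this
    refine le_of_tendsto_of_tendsto this hL ?_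
    filter_upwards [hmem] with r hr
    exact sum_le_hasSum _ (fun j _ => mul_nonneg (ha j) (pow_nonneg hr.1.le j)) (hF r hr)
  have hs : Summable a := summable_of_sum_range_le ha h1
  have h2 : ∑' j, a j ≤ L := Real.tsum_le_of_sum_range_le ha h1
  have h3 : L ≤ ∑' j, a j := by
    refine le_of_tendsto hL ?_
    filter_upwards [hmem] with r hr
    refine hasSum_le (fun j => ?_) (hF r hr) hs.hasSum
    exact mul_le_of_le_one_right (ha j) (pow_le_one₀ hr.1.le hr.2.le)
  rw [le_antisymm h3 h2]; exact hs.hasSum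

section
variable {X : Type*} [MeasurableSpace X] {P : Measure X} [IsProbabilityMeasure P]
  {ι : Type*} [Fintype ι] {ξ ζ : ι → X → ℝ} {g : X → ℝ} {b : ℝ}

/-- the kernel (1-t)^{-b} -/
noncomputable def kk (ξ : ι → X → ℝ) (b : ℝ) (z : X × X) : ℝ := (1 - tk ξ ξ z) ^ (-b)

lemma hasSum_Q (hb : 0 < b) (hg : BM g) (hξ : ∀ a, BM (ξ a)) (h1 : ∀ x, ∑ a, ξ a x ^ 2 = 1)
    (hlt : ∀ᵐ z ∂(P.prod P), tk ξ ξ z < 1) (hk : Integrable (kk ξ b) (P.prod P)) (i : ℕ) :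
    HasSum (fun j => dc b j * Qf P (fun z => tk ξ ξ z ^ (j+i)) g)
      (Qf P (fun z => tk ξ ξ z ^ i * kk ξ b z) g) := by
  have ht := tk_BM hξ hξ
  have hgt : ∀ j, BM fun z : X × X => g z.1 * g z.2 * tk ξ ξ z ^ j := fun j =>
    (hg.fst.mul hg.snd).mul (ht.pow j)
  refine abel_lim (F := fun r => ∫ z, g z.1 * g z.2 * (tk ξ ξ z ^ i * (1 - r * tk ξ ξ z)^(-b)) ∂(P.prod P))
    (fun j => mul_nonneg (dc_pos hb j).le (Qpow_nonneg hg hξ _)) ?_ ?_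
  · intro r hr
    have hrt : ∀ z, |r * tk ξ ξ z| < 1 := by
      intro z
      rw [abs_mul, abs_of_pos hr.1]
      have := tk_abs_le h1 z
      nlinarith [hr.1, hr.2]
    obtain ⟨G, hG⟩ := hg.bdd
    have hgg : ∀ z : X × X, |g z.1 * g z.2| ≤ G * G := fun z => by
      rw [abs_mul]; exact mul_le_mul (hG _) (hG _) (abs_nonneg _) ((abs_nonneg _).trans (hG z.1))
    have hBj : ∀ j, BM (fun z : X × X => (dc b j * r^j) * (g z.1 * g z.2 * tk ξ ξ z ^ (j+i))) := fun j =>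
      (hgt _).const_mul _
    have hGG : 0 ≤ G * G := mul_self_nonneg G
    have hsumm : Summable (fun j => ∫ z, ‖(dc b j * r^j) * (g z.1 * g z.2 * tk ξ ξ z ^ (j+i))‖ ∂(P.prod P)) := by
      refine Summable.of_nonneg_of_le (fun j => integral_nonneg fun z => norm_nonneg _) (fun j => ?_)
        ((hasSum_dc b (x := r) (by rw [abs_of_pos hr.1]; exact hr.2)).summable.mul_right (G*G))
      calc _ ≤ ∫ z : X × X, (dc b j * r^j) * (G*G) ∂(P.prod P) := by
            refine integral_mono (hBj j |>.integrable _).norm (integrable_const _) fun z => ?_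
            simp only
            have hd : 0 ≤ dc b j * r^j := mul_nonneg (dc_pos hb j).le (pow_nonneg hr.1.le j)
            rw [norm_mul, Real.norm_of_nonneg hd, Real.norm_eq_abs, abs_mul, abs_pow]
            refine mul_le_mul_of_nonneg_left ?_ hd
            rw [← mul_one (G * G)]
            exact mul_le_mul (hgg z) (pow_le_one₀ (abs_nonneg _) (tk_abs_le h1 z)) (by positivity) hGG
        _ = _ := by simp
    have := hasSum_integral_of_summable_integral_norm (fun j => (hBj j).integrable (P.prod P)) hsumm
    have e1 : ∀ z : X × X, ∑' j, (dc b j * r^j) * (g z.1 * g z.2 * tk ξ ξ z ^ (j+i)) =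
       g z.1 * g z.2 * (tk ξ ξ z ^ i * (1 - r * tk ξ ξ z)^(-b)) := by
      intro z
      have h := (hasSum_dc b (hrt z)).mul_left (g z.1 * g z.2 * tk ξ ξ z ^ i)
      rw [← mul_assoc, ← h.tsum_eq]
      refine tsum_congr fun j => ?_
      rw [mul_pow, pow_add]; ring
    simp_rw [e1] at this
    refine HasSum.congr_fun this fun j => ?_
    rw [integral_const_mul, Qf]; ring
  · refine tendsto_integral_filter_of_dominated_convergence
      (bound := fun z => |g z.1 * g z.2 * tk ξ ξ z ^ i| * (2^b * kk ξ b z)) ?_ ?_ ?_ ?_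
    · refine Filter.Eventually.of_forall fun r => ?_
      have := hg.meas
      have h2 : Measurable (tk ξ ξ) := ht.meas
      exact Measurable.aestronglyMeasurable (by fun_prop)
    · filter_upwards [Ioo_mem_nhdsLT (show (0:ℝ) < 1 by norm_num)] with r hr
      filter_upwards [hlt] with z hz
      rw [← mul_assoc, norm_mul, Real.norm_eq_abs]
      have htz := abs_le.mp (tk_abs_le h1 z)
      have hpos : 0 < (1 - tk ξ ξ z)/2 := by linarith
      have hle : (1 - tk ξ ξ z)/2 ≤ 1 - r * tk ξ ξ z := by
        rcases le_total 0 (tk ξ ξ z) with h | h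
        · nlinarith [hr.1, hr.2]
        · nlinarith [hr.1, hr.2]
      gcongr
      rw [Real.norm_of_nonneg (Real.rpow_nonneg (by linarith) _)]
      refine (Real.rpow_le_rpow_of_nonpos hpos hle (by linarith)).trans (le_of_eq ?_)
      rw [kk, Real.div_rpow (by linarith) (by norm_num), Real.rpow_neg (by norm_num : (0:ℝ) ≤ 2)]
      field_simp
    · have hB := hgt i
      obtain ⟨G, hG⟩ := hB.bdd
      refine (hk.const_mul (2^b)).bdd_mul (c := G) ?_ ?_
      · exact (continuous_abs.measurable.comp hB.meas).aestronglyMeasurable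
      · exact Filter.Eventually.of_forall fun z => by simpa using hG z
    · filter_upwards [hlt] with z hz
      have hc : ContinuousAt (fun r : ℝ => g z.1 * g z.2 * (tk ξ ξ z ^ i * (1 - r * tk ξ ξ z)^(-b))) 1 := by
        refine continuousAt_const.mul (continuousAt_const.mul (ContinuousAt.rpow_const (by fun_prop) (Or.inl ?_)))
        rw [one_mul]; linarith
      have := hc.tendsto.mono_left (nhdsWithin_le_nhds (s := Set.Iio 1))
      simpa [kk] using this

lemma Qk_nonneg (hb : 0 < b) (hg : BM g) (hξ : ∀ a, BM (ξ a)) (h1 : ∀ x, ∑ a, ξ a x ^ 2 = 1)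
    (hlt : ∀ᵐ z ∂(P.prod P), tk ξ ξ z < 1) (hk : Integrable (kk ξ b) (P.prod P)) :
    0 ≤ Qf P (kk ξ b) g := by
  have := hasSum_Q hb hg hξ h1 hlt hk 0
  simp only [pow_zero, one_mul] at this
  exact this.nonneg fun j => mul_nonneg (dc_pos hb j).le (Qpow_nonneg hg hξ _)

/-- coercivity for mean-zero g -/
lemma coercive_Q {n : ℝ} (hb : 0 < b) (h2b : 2 * b < n) (hξ : ∀ a, BM (ξ a)) 
    (h1 : ∀ x, ∑ a, ξ a x ^ 2 = 1) (hcard : (Fintype.card ι : ℝ) = n + 1)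
    (hlt : ∀ᵐ z ∂(P.prod P), tk ξ ξ z < 1) (hk : Integrable (kk ξ b) (P.prod P)) :
    ∃ C : ℝ, 0 < C ∧ ∀ g : X → ℝ, BM g → ∫ x, g x ∂P = 0 → 
      Qf P (kk ξ b) g ≤ C * (Qf P (fun z => tk ξ ξ z * kk ξ b z) g - b / (n - b) * Qf P (kk ξ b) g) := by
  obtain ⟨C, hC, h⟩ := coercive_seq hb h2b
  refine ⟨C, hC, fun g hg hg0 => ?_⟩
  have hA := hasSum_Q hb hg hξ h1 hlt hk 0
  have hB := hasSum_Q hb hg hξ h1 hlt hk 1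
  simp only [pow_zero, one_mul, add_zero, pow_one] at hA hB
  refine h (fun j => Qf P (fun z => tk ξ ξ z ^ j) g) (fun j => Qpow_nonneg hg hξ j) ?_ (fun j => ?_) _ _ hA hB
  · simp only [Qf, pow_zero, mul_one]
    rw [integral_prod_mul g g, hg0, zero_mul]
  · have := Q_rec (P := P) hg hξ h1 j
    rw [hcard] at this
    convert this using 2; ring
end

/-- abstract spherical data -/
structure Sph {X : Type*} [MeasurableSpace X] (P : Measure X) {ι : Type*} [Fintype ι]
    (ξ : ι → X → ℝ) (n : ℝ) (γ : ℝ → ℝ) : Prop where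
  hξ : ∀ a, BM (ξ a)
  h1 : ∀ x, ∑ a, ξ a x ^ 2 = 1
  hcard : (Fintype.card ι : ℝ) = n + 1
  hlt : ∀ᵐ z ∂(P.prod P), tk ξ ξ z < 1
  hγ : ∀ b : ℝ, 0 < b → 2 * b < n → ∀ x, Integrable (fun y => kk ξ b (x, y)) P ∧
    ∫ y, kk ξ b (x, y) ∂P = γ b
  hγt : ∀ b : ℝ, 0 < b → 2 * b < n → ∀ x, ∫ y, tk ξ ξ (x, y) * kk ξ b (x, y) ∂P = b / (n - b) * γ b
  conf : ∀ b : ℝ, 0 < b → 2 * b < n → ∀ p : ℝ, n / (n - b) < p → (n - b) * p - n ≤ 1 →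
    ∀ a, ∀ v : ℝ, |v| ≤ 1/2 → ∀ h : X → ℝ, BM h → (∀ x, 0 ≤ h x) →
    ∃ h' : X → ℝ, BM h' ∧ (∀ x, 0 ≤ h' x) ∧ Qf P (kk ξ b) h' = Qf P (kk ξ b) h ∧
      ∫ x, h' x ^ p ∂P ≤ ∫ x, h x ^ p * (1 + ((n - b) * p - n) * (v * ξ a x + 2 * v^2)) ∂P

lemma BM.rpow {X : Type*} [MeasurableSpace X] {f : X → ℝ} (hf : BM f) (h0 : ∀ x, 0 ≤ f x) {p : ℝ}
    (hp : 0 ≤ p) : BM (fun x => f x ^ p) := by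
  obtain ⟨F, hF⟩ := hf.bdd
  refine ⟨hf.meas.pow_const p, F^p, fun x => ?_⟩
  rw [abs_of_nonneg (Real.rpow_nonneg (h0 x) _)]
  exact Real.rpow_le_rpow (h0 x) ((le_abs_self _).trans (hF x)) hp

namespace Sph
variable {X : Type*} [MeasurableSpace X] {P : Measure X} [IsProbabilityMeasure P]
  {ι : Type*} [Fintype ι] {ξ : ι → X → ℝ} {n : ℝ} {γ : ℝ → ℝ} {g h f : X → ℝ} {b p : ℝ}

lemma kk_nonneg (S : Sph P ξ n γ) (b : ℝ) (z : X × X) : 0 ≤ kk ξ b z :=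
  Real.rpow_nonneg (by linarith [(abs_le.mp (tk_abs_le S.h1 z)).2]) _

lemma kk_meas (S : Sph P ξ n γ) (b : ℝ) : Measurable (kk ξ b) := by
  have : Measurable (tk ξ ξ) := (tk_BM S.hξ S.hξ).meas
  unfold kk; fun_prop

lemma kk_swap (b : ℝ) (z : X × X) : kk ξ b z.swap = kk ξ b z := by
  simp [kk, tk, mul_comm]

lemma kk_int (S : Sph P ξ n γ) (hb : 0 < b) (h2b : 2 * b < n) : Integrable (kk ξ b) (P.prod P) := by
  rw [integrable_prod_iff (S.kk_meas b).aestronglyMeasurable]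
  refine ⟨Filter.Eventually.of_forall fun x => (S.hγ b hb h2b x).1, ?_⟩
  have : (fun x => ∫ y, ‖kk ξ b (x, y)‖ ∂P) = fun x => γ b := by
    funext x
    rw [← (S.hγ b hb h2b x).2]
    exact integral_congr_ae (Filter.Eventually.of_forall fun y => Real.norm_of_nonneg (S.kk_nonneg b _))
  rw [this]; exact integrable_const _

lemma int_fst (S : Sph P ξ n γ) (hb : 0 < b) (h2b : 2 * b < n) (hf : BM f) :
    ∫ z, f z.1 * kk ξ b z ∂(P.prod P) = γ b * ∫ x, f x ∂P := by
  rw [integral_prod _ (hf.fst.mul_integrable (S.kk_int hb h2b))]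
  simp only [integral_const_mul, (S.hγ b hb h2b _).2]
  rw [integral_mul_const, mul_comm]

lemma int_snd (S : Sph P ξ n γ) (hb : 0 < b) (h2b : 2 * b < n) (hf : BM f) :
    ∫ z, f z.2 * kk ξ b z ∂(P.prod P) = γ b * ∫ x, f x ∂P := by
  rw [← S.int_fst hb h2b hf, ← integral_prod_swap]
  simp [kk_swap]

lemma int_fst' (S : Sph P ξ n γ) (hb : 0 < b) (h2b : 2 * b < n) (hf : BM f) :
    ∫ z, f z.1 * (tk ξ ξ z * kk ξ b z) ∂(P.prod P) = b / (n - b) * γ b * ∫ x, f x ∂P := by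
  rw [integral_prod _ (hf.fst.mul_integrable ((tk_BM S.hξ S.hξ).mul_integrable (S.kk_int hb h2b)))]
  simp only [integral_const_mul, (S.hγt b hb h2b _)]
  rw [integral_mul_const, mul_comm]

lemma int_snd' (S : Sph P ξ n γ) (hb : 0 < b) (h2b : 2 * b < n) (hf : BM f) :
    ∫ z, f z.2 * (tk ξ ξ z * kk ξ b z) ∂(P.prod P) = b / (n - b) * γ b * ∫ x, f x ∂P := by
  rw [← S.int_fst' hb h2b hf, ← integral_prod_swap]
  simp [kk_swap, tk, mul_comm]

lemma γ_pos (S : Sph P ξ n γ) (hb : 0 < b) (h2b : 2 * b < n) : 0 < γ b := by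
  have hk := S.kk_int hb h2b
  have h1 := S.int_fst hb h2b (BM.const 1)
  simp only [one_mul, integral_const, probReal_univ, smul_eq_mul, mul_one] at h1
  rw [← h1]
  have : ∫ z : X × X, (2:ℝ)^(-b) ∂(P.prod P) ≤ ∫ z, kk ξ b z ∂(P.prod P) := by
    refine integral_mono_ae (integrable_const _) hk ?_
    filter_upwards [S.hlt] with z hz
    have := abs_le.mp (tk_abs_le S.h1 z)
    exact Real.rpow_le_rpow_of_nonpos (by linarith) (by linarith) (by linarith)
  simp only [integral_const, probReal_univ, smul_eq_mul, one_mul] at this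
  have h2 : (0:ℝ) < 2^(-b) := by positivity
  linarith

lemma Q_const (S : Sph P ξ n γ) (hb : 0 < b) (h2b : 2 * b < n) :
    Qf P (kk ξ b) (fun _ => 1) = γ b := by
  have h1 := S.int_fst hb h2b (BM.const 1)
  simpa [Qf] using h1

/-- crude HLS -/
lemma crude (S : Sph P ξ n γ) (hb : 0 < b) (h2b : 2 * b < n) (hp : n / (n - b) < p) (hp2 : p < 2)
    (hh : BM h) (h0 : ∀ x, 0 ≤ h x) :
    Qf P (kk ξ b) h ≤ 2 * (1 - 1/p) * γ (b * (p / (2 * (p-1)))) * (∫ x, h x ^ p ∂P) +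
      (2/p - 1) * (∫ x, h x ^ p ∂P)^2 := by
  have hnb : 0 < n - b := by linarith
  have hp1 : 1 < p := lt_of_le_of_lt (by rw [le_div_iff₀ hnb]; linarith) hp
  have hp0 : 0 < p := by linarith
  set s := p / (2 * (p-1)) with hs
  have hs0 : 0 < s := by have : 0 < p - 1 := by linarith
                         positivity
  have hbs : 0 < b * s := by positivity
  have hbs2 : 2 * (b * s) < n := by
    rw [div_lt_iff₀ hnb] at hp
    have : 2 * (b * s) = b * p / (p-1) := by rw [hs]; field_simp
    rw [this, div_lt_iff₀ (by linarith)]; nlinarith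
  set α := 1 - 1/p with hα
  set β := 2/p - 1 with hβ
  have hα0 : 0 ≤ α := by rw [hα, sub_nonneg, div_le_one hp0]; linarith
  have hβ0 : 0 ≤ β := by rw [hβ, sub_nonneg, le_div_iff₀ hp0]; linarith
  have hsα : s * (α + α) = 1 := by
    rw [hs, hα]; field_simp [show p - 1 ≠ 0 by linarith]; ring
  have hpαβ : p * (α + β) = 1 := by rw [hα, hβ]; field_simp; ring
  have hhp := hh.rpow h0 hp0.le
  have hkbs := S.kk_int hbs hbs2
  have ptw : ∀ z : X × X, h z.1 * h z.2 * kk ξ b z ≤ α * (h z.1 ^ p * kk ξ (b*s) z) +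
      α * (h z.2 ^ p * kk ξ (b*s) z) + β * (h z.1 ^ p * h z.2 ^p) := by
    intro z
    have h1 := h0 z.1
    have h2 := h0 z.2
    have hk := S.kk_nonneg b z
    have e : kk ξ (b*s) z = (kk ξ b z)^s := by
      rw [kk, kk, ← Real.rpow_mul (by linarith [(abs_le.mp (tk_abs_le S.h1 z)).2])]; ring_nf
    have := Real.geom_mean_le_arith_mean3_weighted (w₁ := α) (w₂ := α) (w₃ := β)
      (p₁ := h z.1 ^ p * kk ξ (b*s) z) (p₂ := h z.2 ^ p * kk ξ (b*s) z) (p₃ := h z.1 ^ p * h z.2 ^p)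
      hα0 hα0 hβ0 (mul_nonneg (Real.rpow_nonneg h1 _) (S.kk_nonneg _ _))
      (mul_nonneg (Real.rpow_nonneg h2 _) (S.kk_nonneg _ _))
      (mul_nonneg (Real.rpow_nonneg h1 _) (Real.rpow_nonneg h2 _)) (by rw [hα, hβ]; ring)
    refine le_trans (le_of_eq ?_) this
    rw [e]
    rw [Real.mul_rpow (by positivity) (by positivity), Real.mul_rpow (by positivity) (by positivity),
      Real.mul_rpow (by positivity) (by positivity), ← Real.rpow_mul h1, ← Real.rpow_mul h2,
      ← Real.rpow_mul h1, ← Real.rpow_mul h2, ← Real.rpow_mul hk]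
    have hp' : 0 < p := hp0
    have f1 : ∀ x : ℝ, 0 ≤ x → x = x^(p*α) * x^(p*β) := by
      intro x hx
      rw [← Real.rpow_add_of_nonneg hx (by positivity) (by positivity), ← mul_add, hpαβ, Real.rpow_one]
    have f2 : kk ξ b z = (kk ξ b z)^(s*α) * (kk ξ b z)^(s*α) := by
      rw [← Real.rpow_add_of_nonneg hk (by positivity) (by positivity), ← mul_add, hsα, Real.rpow_one]
    conv_lhs => rw [f1 _ h1, f1 _ h2, f2]
    ring
  have i1 : Integrable (fun z : X × X => α * (h z.1 ^ p * kk ξ (b*s) z)) (P.prod P) :=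
    (hhp.fst.mul_integrable hkbs).const_mul _
  have i2 : Integrable (fun z : X × X => α * (h z.2 ^ p * kk ξ (b*s) z)) (P.prod P) :=
    (hhp.snd.mul_integrable hkbs).const_mul _
  have i3 : Integrable (fun z : X × X => β * (h z.1 ^ p * h z.2 ^p)) (P.prod P) :=
    ((hhp.fst.mul hhp.snd).integrable _).const_mul _
  have := integral_mono ((hh.fst.mul hh.snd).mul_integrable (S.kk_int hb h2b)) ((i1.add i2).add i3) ptw
  have e1 := integral_add (i1.add i2) i3
  have e2 := integral_add i1 i2
  simp only [Pi.add_apply] at this e1 e2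
  rw [e1, e2, integral_const_mul, integral_const_mul, integral_const_mul,
    S.int_fst hbs hbs2 hhp, S.int_snd hbs hbs2 hhp, integral_prod_mul (fun x => h x ^ p) (fun x => h x ^ p)] at this
  rw [Qf]
  refine this.trans (le_of_eq ?_)
  ring

/-- the value set -/
def vals (P : Measure X) (ξ : ι → X → ℝ) (b p : ℝ) : Set ℝ :=
  {q | ∃ h : X → ℝ, BM h ∧ (∀ x, 0 ≤ h x) ∧ ∫ x, h x ^ p ∂P = 1 ∧ q = Qf P (kk ξ b) h}

lemma Q_smul (c : ℝ) (κ : X × X → ℝ) (h : X → ℝ) :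
    Qf P κ (fun x => c * h x) = c^2 * Qf P κ h := by
  rw [Qf, Qf, ← integral_const_mul]
  congr 1; funext z; ring

lemma exists_Λ (S : Sph P ξ n γ) (hb : 0 < b) (h2b : 2 * b < n) (hp : n / (n - b) < p) (hp2 : p < 2) :
    ∃ Λ : ℝ, γ b ≤ Λ ∧
      (∀ h : X → ℝ, BM h → (∀ x, 0 ≤ h x) → Qf P (kk ξ b) h ≤ Λ * (∫ x, h x ^ p ∂P)^(2/p)) ∧
      (∀ η : ℝ, 0 < η → ∃ h : X → ℝ, BM h ∧ (∀ x, 0 ≤ h x) ∧ ∫ x, h x ^ p ∂P = 1 ∧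
        Λ - η ≤ Qf P (kk ξ b) h) := by
  have hnb : 0 < n - b := by linarith
  have hp1 : 1 < p := lt_of_le_of_lt (by rw [le_div_iff₀ hnb]; linarith) hp
  have hp0 : 0 < p := by linarith
  have hmem : γ b ∈ vals P ξ b p := ⟨fun _ => 1, BM.const 1, by simp, by simp, (S.Q_const hb h2b).symm⟩
  have hbdd : BddAbove (vals P ξ b p) := by
    refine ⟨2 * (1 - 1/p) * γ (b * (p / (2 * (p-1)))) + (2/p - 1), ?_⟩
    rintro q ⟨h, hh, h0, hi, rfl⟩
    have := S.crude hb h2b hp hp2 hh h0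
    rw [hi] at this
    linarith
  refine ⟨sSup (vals P ξ b p), le_csSup hbdd hmem, ?_, ?_⟩
  · intro h hh h0
    set I := ∫ x, h x ^ p ∂P with hI
    have hI0 : 0 ≤ I := integral_nonneg fun x => Real.rpow_nonneg (h0 x) _
    rcases hI0.eq_or_lt with h' | h'
    · have := S.crude hb h2b hp hp2 hh h0
      rw [← hI, ← h'] at this
      rw [← h', Real.zero_rpow (by positivity)]
      linarith
    · set c := (I^(1/p))⁻¹ with hc
      have hc0 : 0 < c := by positivity
      have hcp : c^p = I⁻¹ := by
        rw [hc, Real.inv_rpow (by positivity), ← Real.rpow_mul hI0]; field_simp; simp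
      have hm : Qf P (kk ξ b) (fun x => c * h x) ∈ vals P ξ b p := by
        refine ⟨_, hh.const_mul c, fun x => mul_nonneg hc0.le (h0 x), ?_, rfl⟩
        simp_rw [fun x => Real.mul_rpow hc0.le (h0 x) (z := p)]
        rw [integral_const_mul, hcp, ← hI]; field_simp
      have := le_csSup hbdd hm
      rw [Q_smul] at this
      have hc2 : c^2 * I^(2/p) = 1 := by
        rw [hc, inv_pow, ← Real.rpow_natCast, ← Real.rpow_mul hI0]
        rw [show 1/p * ((2:ℕ):ℝ) = 2/p by push_cast; ring]
        exact inv_mul_cancel₀ (by positivity)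
      calc Qf P (kk ξ b) h = (c^2 * Qf P (kk ξ b) h) * I^(2/p) := by
            rw [mul_right_comm, hc2, one_mul]
        _ ≤ _ := by gcongr
  · intro η hη
    obtain ⟨q, ⟨h, hh, h0, hi, rfl⟩, hq⟩ := exists_lt_of_lt_csSup ⟨_, hmem⟩ (show sSup (vals P ξ b p) - η < sSup (vals P ξ b p) by linarith)
    exact ⟨h, hh, h0, hi, hq.le⟩

end Sph

lemma rpow_taylor (p : ℝ) : ∃ C r0 : ℝ, 0 < C ∧ 0 < r0 ∧ ∀ x, |x| ≤ r0 → 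
    (1+x)^p ≤ 1 + p * x + p * (p-1) / 2 * x^2 + C * |x|^3 := by
  have h := (Real.one_add_rpow_hasFPowerSeriesAt_zero (a := p)).isBigO_sub_partialSum_pow 3
  obtain ⟨C, hC, h⟩ := h.exists_pos
  have h' := h.bound
  rw [Metric.eventually_nhds_iff_ball] at h'
  obtain ⟨r, hr, h'⟩ := h'
  refine ⟨C, r/2, hC, by linarith, fun x hx => ?_⟩
  have := h' x (by rw [mem_ball_zero_iff, Real.norm_eq_abs]; linarith)
  have e : (binomialSeries ℝ p).partialSum 3 x = 1 + p * x + p * (p-1) / 2 * x^2 := by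
    simp only [FormalMultilinearSeries.partialSum, Finset.sum_range_succ, Finset.sum_range_zero,
      binomialSeries, FormalMultilinearSeries.ofScalars_apply_eq, Ring.choose_zero_right, Ring.choose_one_right]
    have e2 : Ring.choose p 2 = p * (p-1)/2 := by
      have := dc_eq_choose (p-1) 2
      rw [show p - 1 + ((2:ℕ):ℝ) - 1 = p by push_cast; ring] at this
      rw [← this]; simp [dc]; ring
    rw [e2]
    simp only [smul_eq_mul, pow_zero, pow_one]; ring
  rw [e, zero_add, Real.norm_eq_abs, norm_pow, norm_norm, Real.norm_eq_abs] at this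
  have := (abs_le.mp this).2
  linarith

lemma rpow_le_quad {q z : ℝ} (hq1 : 1 ≤ q) (hq2 : q ≤ 2) (hz : 0 ≤ 1 + z) :
    (1+z)^q ≤ 1 + q * z + (q-1) * z^2 := by
  have h := _root_.rpow_one_add_le_one_add_mul_self (s := z) (by linarith) (p := q-1) (by linarith) (by linarith)
  have e : (1+z)^q = (1+z) * (1+z)^(q-1) := by
    rcases hz.eq_or_lt with h0 | h0
    · rw [← h0, Real.zero_rpow (by linarith), zero_mul]
    · rw [Real.rpow_sub_one h0.ne']; field_simp
  rw [e]
  calc _ ≤ (1+z) * (1 + (q-1)*z) := by gcongr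
    _ = _ := by ring

namespace Sph
variable {X : Type*} [MeasurableSpace X] {P : Measure X} [IsProbabilityMeasure P]
  {ι : Type*} [Fintype ι] {ξ : ι → X → ℝ} {n : ℝ} {γ : ℝ → ℝ} {g h f : X → ℝ} {b p : ℝ}

lemma moment (S : Sph P ξ n γ) (hb : 0 < b) (h2b : 2 * b < n) (hp : n / (n - b) < p) (hp2 : p < 2)
    (hδ : (n - b) * p - n ≤ 1) {Λ : ℝ} (hΛ : 0 < Λ)
    (H : ∀ h : X → ℝ, BM h → (∀ x, 0 ≤ h x) → Qf P (kk ξ b) h ≤ Λ * (∫ x, h x ^ p ∂P)^(2/p))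
    {τ : ℝ} (hτ : 0 < τ) (hτ1 : τ ≤ 1/2) (hτΛ : τ^3 ≤ Λ) (hh : BM h) (h0 : ∀ x, 0 ≤ h x)
    (hi : ∫ x, h x ^ p ∂P = 1) (hQ : Λ - τ^3 ≤ Qf P (kk ξ b) h) (a : ι) :
    |∫ x, h x ^ p * ξ a x ∂P| ≤ (2 + 1 / (((n - b) * p - n) * Λ)) * τ := by
  have hnb : 0 < n - b := by linarith
  have hp1 : 1 < p := lt_of_le_of_lt (by rw [le_div_iff₀ hnb]; linarith) hp
  have hp0 : 0 < p := by linarith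
  set δ := (n - b) * p - n with hδd
  have hδ0 : 0 < δ := by rw [div_lt_iff₀ hnb] at hp; rw [hδd]; linarith
  set m := ∫ x, h x ^ p * ξ a x ∂P with hm
  have hhp := hh.rpow h0 hp0.le
  have key : ∀ v : ℝ, |v| = τ → - (τ^3/Λ) ≤ δ * (v * m + 2 * v^2) := by
    intro v hv
    obtain ⟨h', hB, h'0, hQ', hi'⟩ := S.conf b hb h2b p hp hδ a v (by rw [hv]; exact hτ1) h hh h0
    have e : ∫ x, h x ^ p * (1 + δ * (v * ξ a x + 2 * v^2)) ∂P = 1 + δ * (v * m + 2 * v^2) := by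
      have : ∀ x, h x ^ p * (1 + δ * (v * ξ a x + 2 * v^2)) =
        (1 + δ * (2 * v^2)) * h x ^ p + (δ * v) * (h x ^ p * ξ a x) := fun x => by ring
      simp_rw [this]
      rw [integral_add ((hhp.integrable _).const_mul _) (((hhp.mul (S.hξ a)).integrable _).const_mul _),
        integral_const_mul, integral_const_mul, hi]
      ring
    rw [← hδd, e] at hi'
    have hI0 : 0 ≤ ∫ x, h' x ^ p ∂P := integral_nonneg fun x => Real.rpow_nonneg (h'0 x) _
    have h3 := H h' hB h'0
    rw [hQ'] at h3
    have h4 : Λ - τ^3 ≤ Λ * (∫ x, h' x ^ p ∂P)^(2/p) := hQ.trans h3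
    have h5 : 1 - τ^3/Λ ≤ (∫ x, h' x ^ p ∂P)^(2/p) := by
      have : 1 - τ^3/Λ = (Λ - τ^3) / Λ := by field_simp
      rw [this, div_le_iff₀ hΛ]; linarith
    have h6 : 0 ≤ 1 - τ^3/Λ := by rw [sub_nonneg, div_le_one hΛ]; exact hτΛ
    have h7 : 1 - τ^3/Λ ≤ (1 - τ^3/Λ)^(p/2) := by
      apply Real.self_le_rpow_of_le_one h6
      · have : 0 ≤ τ^3/Λ := by positivity
        linarith
      · linarith
    have h8 : (1 - τ^3/Λ)^(p/2) ≤ ∫ x, h' x ^ p ∂P := by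
      have := Real.rpow_le_rpow h6 h5 (by positivity : 0 ≤ p/2)
      rwa [← Real.rpow_mul hI0, show 2/p*(p/2) = 1 by field_simp, Real.rpow_one] at this
    linarith
  have k1 := key τ (abs_of_pos hτ)
  have k2 := key (-τ) (by rw [abs_neg, abs_of_pos hτ])
  have k3 : τ * |m| * δ ≤ τ * ((2 + 1/(δ*Λ)) * τ) * δ := by
    have e : τ * ((2 + 1/(δ*Λ)) * τ) * δ = 2 * τ^2 * δ + τ^2/Λ := by field_simp
    have : τ^3/Λ ≤ τ^2/Λ := by
      have : τ^3 ≤ τ^2 := pow_le_pow_of_le_one hτ.le (by linarith) (by norm_num)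
      gcongr
    rw [e]
    rcases abs_cases m with ⟨h, _⟩ | ⟨h, _⟩ <;> rw [h] <;> nlinarith
  exact le_of_mul_le_mul_left (le_of_mul_le_mul_right k3 hδ0) hτ

set_option maxHeartbeats 1000000 in
lemma second_var (S : Sph P ξ n γ) (hb : 0 < b) (h2b : 2 * b < n) (hp : n / (n - b) < p) (hp2 : p < 2)
    (hδ : (n - b) * p - n ≤ 1) {Λ : ℝ} (hΛ : 0 < Λ)
    (H : ∀ h : X → ℝ, BM h → (∀ x, 0 ≤ h x) → Qf P (kk ξ b) h ≤ Λ * (∫ x, h x ^ p ∂P)^(2/p)) :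
    ∃ C τ0 : ℝ, 0 < τ0 ∧ ∀ τ : ℝ, 0 < τ → τ ≤ τ0 → ∀ h : X → ℝ, BM h → (∀ x, 0 ≤ h x) →
      ∫ x, h x ^ p ∂P = 1 → Λ - τ^3 ≤ Qf P (kk ξ b) h →
      Qf P (fun z => tk ξ ξ z * kk ξ b z) h ≤ Λ * (p - 1) + C * τ := by
  have hnb : 0 < n - b := by linarith
  have hp1 : 1 < p := lt_of_le_of_lt (by rw [le_div_iff₀ hnb]; linarith) hp
  have hp0 : 0 < p := by linarith
  have hδ0 : 0 < (n-b)*p - n := by rw [div_lt_iff₀ hnb] at hp; linarith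
  obtain ⟨C3, r0, hC3, hr0, hT⟩ := rpow_taylor p
  set Cm := 2 + 1 / (((n - b) * p - n) * Λ) with hCm
  have hCm0 : 0 ≤ Cm := by positivity
  set D := 2 * Cm + 1 + C3 with hD
  set C1 := 1 + Λ * (2 * C3 + D^2) with hC1
  have hk := S.kk_int hb h2b
  refine ⟨Fintype.card ι * C1, min (min (1/2) r0) (min 1 Λ), by positivity, ?_⟩
  intro τ hτ hτ' h hh h0 hi hQ
  have t1 : τ ≤ 1/2 := hτ'.trans ((min_le_left _ _).trans (min_le_left _ _))
  have t2 : τ ≤ r0 := hτ'.trans ((min_le_left _ _).trans (min_le_right _ _))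
  have t3 : τ ≤ Λ := hτ'.trans ((min_le_right _ _).trans (min_le_right _ _))
  have t4 : τ^3 ≤ Λ := by
    have : τ^3 ≤ τ := by nlinarith [sq_nonneg τ]
    linarith
  have hhp := hh.rpow h0 hp0.le
  have main : ∀ a, Qf P (kk ξ b) (fun x => h x * ξ a x) ≤ Λ * (p-1) * (∫ x, h x ^ p * ξ a x ^ 2 ∂P) + C1 * τ := by
    intro a
    have hξ1 := abs_le_one_of S.h1 a
    have hm := S.moment hb h2b hp hp2 hδ hΛ H hτ t1 t4 hh h0 hi hQ a
    rw [← hCm] at hm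
    set m := ∫ x, h x ^ p * ξ a x ∂P with hmd
    set s := ∫ x, h x ^ p * ξ a x ^ 2 ∂P with hsd
    have hs0 : 0 ≤ s := integral_nonneg fun x => mul_nonneg (Real.rpow_nonneg (h0 x) _) (sq_nonneg _)
    have hs1 : s ≤ 1 := by
      rw [← hi]
      refine integral_mono ((hhp.mul ((S.hξ a).pow 2)).integrable _) (hhp.integrable _) fun x => ?_
      exact mul_le_of_le_one_right (Real.rpow_nonneg (h0 x) _) ((sq_le_one_iff_abs_le_one _).mpr (hξ1 x))
    have side : ∀ σ : ℝ, |σ| = 1 → Qf P (kk ξ b) (fun x => h x * (1 + σ * τ * ξ a x)) ≤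
        Λ * (1 + (2/p) * (p * (σ * τ) * m + p * (p-1)/2 * τ^2 * s + C3 * τ^3) + D^2 * τ^4) := by
      intro σ hσ
      have hσ2 : σ^2 = 1 := by rw [← sq_abs, hσ]; norm_num
      have hx : ∀ x, |σ * τ * ξ a x| ≤ τ := by
        intro x
        rw [abs_mul, abs_mul, hσ, one_mul, abs_of_pos hτ]
        exact mul_le_of_le_one_right hτ.le (hξ1 x)
      have hpos : ∀ x, 0 ≤ 1 + σ * τ * ξ a x := fun x => by linarith [(abs_le.mp (hx x)).1]
      have hB : BM fun x => h x * (1 + σ * τ * ξ a x) :=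
        hh.mul ((BM.const 1).add ((S.hξ a).const_mul _))
      have hB0 : ∀ x, 0 ≤ h x * (1 + σ * τ * ξ a x) := fun x => mul_nonneg (h0 x) (hpos x)
      have hH := H _ hB hB0
      set J := ∫ x, (h x * (1 + σ * τ * ξ a x))^p ∂P with hJ
      have hJ0 : 0 ≤ J := integral_nonneg fun x => Real.rpow_nonneg (hB0 x) _
      set z := p * (σ * τ) * m + p * (p-1)/2 * τ^2 * s + C3 * τ^3 with hz
      have hJz : J ≤ 1 + z := by
        have i1 : Integrable (fun x => (1 + C3 * τ^3) * h x ^ p) P := (hhp.integrable _).const_mul _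
        have i2 : Integrable (fun x => (p * (σ * τ)) * (h x ^ p * ξ a x)) P :=
          ((hhp.mul (S.hξ a)).integrable _).const_mul _
        have i3 : Integrable (fun x => (p * (p-1)/2 * τ^2) * (h x ^ p * ξ a x^2)) P :=
          ((hhp.mul ((S.hξ a).pow 2)).integrable _).const_mul _
        have hle := integral_mono ((hB.rpow hB0 hp0.le).integrable P) ((i1.add i2).add i3) (fun x => by
          show (h x * (1 + σ * τ * ξ a x))^p ≤ (1 + C3 * τ^3) * h x ^ p + (p * (σ * τ)) * (h x ^ p * ξ a x) +
            (p * (p-1)/2 * τ^2) * (h x ^ p * ξ a x^2)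
          rw [Real.mul_rpow (h0 x) (hpos x)]
          have := hT (σ * τ * ξ a x) ((hx x).trans t2)
          have h3 : |σ * τ * ξ a x|^3 ≤ τ^3 := pow_le_pow_left₀ (abs_nonneg _) (hx x) 3
          have h4 : (1 + σ * τ * ξ a x)^p ≤ 1 + p * (σ * τ * ξ a x) + p * (p-1)/2 * (τ^2 * ξ a x^2) + C3 * τ^3 := by
            refine this.trans ?_
            rw [mul_pow, mul_pow, hσ2, one_mul]
            gcongr
          calc _ ≤ h x ^ p * (1 + p * (σ * τ * ξ a x) + p * (p-1)/2 * (τ^2 * ξ a x^2) + C3 * τ^3) := by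
                have := Real.rpow_nonneg (h0 x) p
                gcongr
            _ = _ := by ring)
        have e1 := integral_add (i1.add i2) i3
        have e2 := integral_add i1 i2
        simp only [Pi.add_apply] at hle e1 e2
        rw [e1, e2, integral_const_mul, integral_const_mul, integral_const_mul, hi] at hle
        refine hle.trans (le_of_eq ?_)
        rw [hz]; ring
      have hzabs : |z| ≤ D * τ^2 := by
        have a1 : |p * (σ * τ) * m| ≤ 2 * Cm * τ^2 := by
          rw [abs_mul, abs_mul, abs_mul, hσ, one_mul, abs_of_pos hτ, abs_of_pos hp0]
          calc _ ≤ 2 * τ * (Cm * τ) := by gcongr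
            _ = _ := by ring
        have a2 : |p * (p-1)/2 * τ^2 * s| ≤ τ^2 := by
          have : p * (p-1)/2 ≤ 1 := by nlinarith
          have h' : 0 ≤ p * (p-1)/2 := by have : 0 < p - 1 := by linarith
                                          positivity
          rw [abs_of_nonneg (by positivity)]
          calc _ ≤ 1 * τ^2 * 1 := by gcongr
            _ = _ := by ring
        have a3 : |C3 * τ^3| ≤ C3 * τ^2 := by
          rw [abs_of_nonneg (by positivity)]
          have : τ^3 ≤ τ^2 := pow_le_pow_of_le_one hτ.le (by linarith) (by norm_num)
          gcongr
        rw [hD]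
        calc |z| ≤ |p * (σ * τ) * m| + |p * (p-1)/2 * τ^2 * s| + |C3 * τ^3| := abs_add_three _ _ _
          _ ≤ _ := by linarith
      have hz2 : z^2 ≤ D^2 * τ^4 := by
        rw [← sq_abs]
        calc |z|^2 ≤ (D * τ^2)^2 := by gcongr
          _ = _ := by ring
      have hq1 : 1 ≤ 2/p := by rw [le_div_iff₀ hp0]; linarith
      have hq2 : 2/p ≤ 2 := by rw [div_le_iff₀ hp0]; linarith
      calc _ ≤ Λ * J^(2/p) := hH
        _ ≤ Λ * (1+z)^(2/p) := by gcongr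
        _ ≤ Λ * (1 + (2/p) * z + (2/p - 1) * z^2) := by
            gcongr; exact rpow_le_quad hq1 hq2 (hJ0.trans hJz)
        _ ≤ _ := by
            have : (2/p-1) * z^2 ≤ 1 * z^2 := mul_le_mul_of_nonneg_right (by linarith) (sq_nonneg _)
            refine mul_le_mul_of_nonneg_left ?_ hΛ.le
            linarith
    have sp := side 1 (by norm_num)
    have sm := side (-1) (by norm_num)
    have i1 : ∀ σ : ℝ, Integrable (fun z : X × X => h z.1 * (1 + σ * τ * ξ a z.1) * (h z.2 * (1 + σ * τ * ξ a z.2)) * kk ξ b z) (P.prod P) := by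
      intro σ
      have hB : BM fun x => h x * (1 + σ * τ * ξ a x) :=
        hh.mul ((BM.const 1).add ((S.hξ a).const_mul _))
      exact (hB.fst.mul hB.snd).mul_integrable hk
    have eQ : Qf P (kk ξ b) (fun x => h x * (1 + 1 * τ * ξ a x)) + Qf P (kk ξ b) (fun x => h x * (1 + (-1) * τ * ξ a x))
       = 2 * Qf P (kk ξ b) h + 2 * τ^2 * Qf P (kk ξ b) (fun x => h x * ξ a x) := by
      have hBξ := hh.mul (S.hξ a)
      simp only [Qf]
      rw [← integral_add (i1 1) (i1 (-1)), ← integral_const_mul, ← integral_const_mul,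
        ← integral_add (((hh.fst.mul hh.snd).mul_integrable hk).const_mul _) (((hBξ.fst.mul hBξ.snd).mul_integrable hk).const_mul _)]
      congr 1; funext z; ring
    set q := Qf P (kk ξ b) (fun x => h x * ξ a x)
    have hsum : 2 * (Λ - τ^3) + 2 * τ^2 * q ≤ Λ * (2 + (2/p) * (p * (p-1) * τ^2 * s + 2 * C3 * τ^3) + 2 * D^2 * τ^4) := by
      have : 2 * (Λ - τ^3) + 2 * τ^2 * q ≤ _ := (by linarith : 2 * (Λ - τ^3) + 2 * τ^2 * q ≤ _) |>.trans (eQ.symm.le.trans (add_le_add sp sm))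
      refine this.trans (le_of_eq ?_)
      ring
    have e5 : (2/p) * (p * (p-1) * τ^2 * s + 2 * C3 * τ^3) = 2 * (p-1) * τ^2 * s + (2/p) * (2 * C3 * τ^3) := by
      field_simp
    have e6 : (2/p) * (2 * C3 * τ^3) ≤ 2 * (2 * C3 * τ^3) := by
      gcongr; rw [div_le_iff₀ hp0]; linarith
    rw [e5] at hsum
    have hfin : τ^2 * q ≤ τ^2 * (Λ * (p-1) * s + C1 * τ) := by
      have e7 : Λ * ((2/p) * (2 * C3 * τ^3)) ≤ Λ * (2 * (2 * C3 * τ^3)) := by gcongr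
      have e8 : Λ * D^2 * τ^4 ≤ Λ * D^2 * τ^3 := by
        have : τ^4 ≤ τ^3 := pow_le_pow_of_le_one hτ.le (by linarith) (by norm_num)
        gcongr
      have e9 : τ^2 * (Λ * (p-1) * s + C1 * τ) = Λ * (p-1) * s * τ^2 + τ^3 + Λ * (2 * C3 * τ^3) + Λ * D^2 * τ^3 := by
        rw [hC1]; ring
      have e10 : Λ * (2 + (2 * (p - 1) * τ ^ 2 * s + (2/p) * (2 * C3 * τ^3)) + 2 * D ^ 2 * τ ^ 4) =
        2 * Λ + 2 * (Λ * (p-1) * s * τ^2) + Λ * ((2/p) * (2 * C3 * τ^3)) + 2 * (Λ * D^2 * τ^4) := by ring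
      rw [e10] at hsum
      rw [e9]
      linarith
    exact le_of_mul_le_mul_left hfin (by positivity)
  have eS : Qf P (fun z => tk ξ ξ z * kk ξ b z) h = ∑ a, Qf P (kk ξ b) (fun x => h x * ξ a x) := by
    simp only [Qf]
    rw [← integral_finsetSum]
    · congr 1; funext z
      simp only [tk]
      rw [Finset.sum_mul, Finset.mul_sum]
      refine Finset.sum_congr rfl fun a _ => by ring
    · intro a _
      have hBξ := hh.mul (S.hξ a)
      exact (hBξ.fst.mul hBξ.snd).mul_integrable hk
  have eM : ∑ a, ∫ x, h x ^ p * ξ a x ^ 2 ∂P = 1 := by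
    rw [← integral_finsetSum _ fun a _ => (hhp.mul ((S.hξ a).pow 2)).integrable _]
    simp_rw [← Finset.mul_sum, S.h1, mul_one]
    exact hi
  rw [eS]
  calc _ ≤ ∑ a, (Λ * (p-1) * (∫ x, h x ^ p * ξ a x ^ 2 ∂P) + C1 * τ) := Finset.sum_le_sum fun a _ => main a
    _ = _ := by
      rw [Finset.sum_add_distrib, ← Finset.mul_sum, eM]; simp [mul_assoc]

end Sph

namespace Sph
variable {X : Type*} [MeasurableSpace X] {P : Measure X} [IsProbabilityMeasure P]
  {ι : Type*} [Fintype ι] {ξ : ι → X → ℝ} {n : ℝ} {γ : ℝ → ℝ} {g h f : X → ℝ} {b p : ℝ}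

lemma Q_split {κ : X × X → ℝ} (hκ : Integrable κ (P.prod P)) {c : ℝ}
    (h1 : ∀ f : X → ℝ, BM f → ∫ z, f z.1 * κ z ∂(P.prod P) = c * ∫ x, f x ∂P)
    (h2 : ∀ f : X → ℝ, BM f → ∫ z, f z.2 * κ z ∂(P.prod P) = c * ∫ x, f x ∂P) (hh : BM h) :
    Qf P κ (fun x => h x - ∫ y, h y ∂P) = Qf P κ h - c * (∫ y, h y ∂P)^2 := by
  set m := ∫ y, h y ∂P
  have i1 := ((hh.fst.mul hh.snd).mul_integrable hκ)
  have i2 := ((hh.fst).mul_integrable hκ).const_mul m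
  have i3 := ((hh.snd).mul_integrable hκ).const_mul m
  have i4 := hκ.const_mul (m^2)
  have hone := h1 (fun _ => 1) (BM.const 1)
  simp only [one_mul, integral_const, probReal_univ, smul_eq_mul, mul_one] at hone
  have e : ∀ z : X × X, (h z.1 - m) * (h z.2 - m) * κ z = (h z.1 * h z.2 * κ z - m * (h z.1 * κ z)) -
    (m * (h z.2 * κ z) - m^2 * κ z) := fun z => by ring
  simp only [Qf]
  simp_rw [e]
  have a1 := integral_sub (i1.sub i2) (i3.sub i4)
  have a2 := integral_sub i1 i2
  have a3 := integral_sub i3 i4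
  simp only [Pi.sub_apply] at a1 a2 a3
  rw [a1, a2, a3, integral_const_mul, integral_const_mul, integral_const_mul, h1 h hh, h2 h hh, hone]
  ring

lemma mean_le_one (hp : 1 < p) (hh : BM h) (h0 : ∀ x, 0 ≤ h x) (hi : ∫ x, h x ^ p ∂P = 1) :
    ∫ x, h x ∂P ≤ 1 := by
  have hp0 : 0 < p := by linarith
  have hle : ∀ x, h x ≤ 1/p * h x ^ p + (1 - 1/p) := by
    intro x
    have := Real.geom_mean_le_arith_mean2_weighted (w₁ := 1/p) (w₂ := 1 - 1/p) (p₁ := h x ^ p) (p₂ := 1)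
      (by positivity) (by rw [sub_nonneg, div_le_one hp0]; exact hp.le) (Real.rpow_nonneg (h0 x) _) zero_le_one (by ring)
    rw [← Real.rpow_mul (h0 x), show p * (1/p) = 1 by field_simp, Real.rpow_one, Real.one_rpow, mul_one, mul_one] at this
    exact this
  have hhp := (hh.rpow h0 hp0.le).integrable P
  have := integral_mono (hh.integrable P) ((hhp.const_mul (1/p)).add (integrable_const (1-1/p))) hle
  have e := integral_add (hhp.const_mul (1/p)) (integrable_const (μ := P) (1-1/p))
  simp only [Pi.add_apply] at this e
  rw [e, integral_const_mul, hi] at this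
  simpa using this

lemma Λ_bound (S : Sph P ξ n γ) (hb : 0 < b) (h2b : 2 * b < n) : ∃ C : ℝ, 0 < C ∧ 
    ∀ p, n / (n - b) < p → p < 2 → (n - b) * p - n ≤ 1 → ∀ Λ, γ b ≤ Λ → 
      (∀ h : X → ℝ, BM h → (∀ x, 0 ≤ h x) → Qf P (kk ξ b) h ≤ Λ * (∫ x, h x ^ p ∂P)^(2/p)) →
      (∀ η : ℝ, 0 < η → ∃ h : X → ℝ, BM h ∧ (∀ x, 0 ≤ h x) ∧ ∫ x, h x ^ p ∂P = 1 ∧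
        Λ - η ≤ Qf P (kk ξ b) h) →
      Λ ≤ γ b + C * (p - n/(n-b)) * Λ := by
  have hk := S.kk_int hb h2b
  obtain ⟨C, hC, hco⟩ := coercive_Q hb h2b S.hξ S.h1 S.hcard S.hlt hk
  have hnb : 0 < n - b := by linarith
  refine ⟨C, hC, fun p hp hp2 hδ Λ hγΛ H hnear => ?_⟩
  have hp1 : 1 < p := lt_of_le_of_lt (by rw [le_div_iff₀ hnb]; linarith) hp
  have hγ0 := S.γ_pos hb h2b
  have hΛ : 0 < Λ := lt_of_lt_of_le hγ0 hγΛ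
  obtain ⟨D, τ0, hτ0, hsv⟩ := S.second_var hb h2b hp hp2 hδ hΛ H
  have key : ∀ τ : ℝ, 0 < τ → τ ≤ τ0 → Λ ≤ γ b + C * (p - n/(n-b)) * Λ + (τ^3 + C * (D * τ + b/(n-b) * τ^3)) := by
    intro τ hτ hττ
    obtain ⟨h, hh, h0, hi, hQ⟩ := hnear (τ^3) (by positivity)
    have h2 := hsv τ hτ hττ h hh h0 hi hQ
    set m := ∫ y, h y ∂P with hm
    have hm0 : 0 ≤ m := integral_nonneg h0
    have hm1 : m ≤ 1 := mean_le_one hp1 hh h0 hi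
    have hgB : BM fun x => h x - m := hh.sub (BM.const m)
    have hg0 : ∫ x, (h x - m) ∂P = 0 := by
      rw [integral_sub (hh.integrable _) (integrable_const _)]; simp [hm]
    have hc := hco _ hgB hg0
    rw [hm, Q_split hk (fun f hf => S.int_fst hb h2b hf) (fun f hf => S.int_snd hb h2b hf) hh,
      Q_split ((tk_BM S.hξ S.hξ).mul_integrable hk) (fun f hf => S.int_fst' hb h2b hf)
        (fun f hf => S.int_snd' hb h2b hf) hh, ← hm] at hc
    set A := Qf P (kk ξ b) h
    set B := Qf P (fun z => tk ξ ξ z * kk ξ b z) h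
    have e1 : B - b/(n-b) * γ b * m^2 - b/(n-b) * (A - γ b * m^2) = B - b/(n-b)*A := by ring
    rw [e1] at hc
    have hbn : 0 < b/(n-b) := by positivity
    have e2 : B - b/(n-b) * A ≤ (p - n/(n-b)) * Λ + (D * τ + b/(n-b) * τ^3) := by
      have : b/(n-b) = n/(n-b) - 1 := by field_simp; ring
      have h3 : b/(n-b) * (Λ - τ^3) ≤ b/(n-b) * A := by gcongr
      have h4 : b/(n-b) * Λ = (n/(n-b) - 1) * Λ := by rw [this]
      nlinarith
    have e3 := mul_le_mul_of_nonneg_left e2 hC.le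
    have e4 : γ b * m^2 ≤ γ b := mul_le_of_le_one_right hγ0.le (pow_le_one₀ hm0 hm1)
    have : C * ((p - n/(n-b)) * Λ + (D * τ + b/(n-b) * τ^3)) = C * (p - n/(n-b)) * Λ + C * (D * τ + b/(n-b) * τ^3) := by ring
    linarith
  have hlim : Filter.Tendsto (fun τ : ℝ => γ b + C * (p - n/(n-b)) * Λ + (τ^3 + C * (D * τ + b/(n-b) * τ^3)))
      (nhdsWithin 0 (Set.Ioi 0)) (nhds (γ b + C * (p - n/(n-b)) * Λ + (0^3 + C * (D * 0 + b/(n-b) * 0^3)))) :=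
    (Continuous.tendsto (by fun_prop) 0).mono_left nhdsWithin_le_nhds
  have := ge_of_tendsto hlim (b := Λ) (by
    filter_upwards [Ioc_mem_nhdsGT hτ0] with τ hτ
    exact key τ hτ.1 hτ.2)
  simpa using this

/-- sharp HLS inequality -/
theorem sharpHLS (S : Sph P ξ n γ) (hb : 0 < b) (h2b : 2 * b < n) (hh : BM h) (h0 : ∀ x, 0 ≤ h x) :
    Qf P (kk ξ b) h ≤ γ b * (∫ x, h x ^ (n/(n-b)) ∂P)^(2/(n/(n-b))) := by
  obtain ⟨C, hC, hΛ⟩ := S.Λ_bound hb h2b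
  have hnb : 0 < n - b := by linarith
  set pc := n/(n-b) with hpc
  have hpc1 : 1 < pc := by rw [hpc, lt_div_iff₀ hnb]; linarith
  have hpc2 : pc < 2 := by rw [hpc, div_lt_iff₀ hnb]; linarith
  have hnpc : (n-b) * pc = n := by rw [hpc]; field_simp
  obtain ⟨G0, hG0⟩ := hh.bdd
  set G := max G0 1 with hG
  have hG1 : 1 ≤ G := le_max_right _ _
  have hhG : ∀ x, h x ≤ G := fun x => ((le_abs_self _).trans (hG0 x)).trans (le_max_left _ _)
  have hQ0 := Qk_nonneg hb hh S.hξ S.h1 S.hlt (S.kk_int hb h2b)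
  set I := ∫ x, h x ^ pc ∂P with hI
  have hI0 : 0 ≤ I := integral_nonneg fun x => Real.rpow_nonneg (h0 x) _
  have key : ∀ p, pc < p → p < 2 → (n-b)*p - n ≤ 1 → C * (p - pc) < 1 → 
      (1 - C * (p - pc)) * Qf P (kk ξ b) h ≤ γ b * (G^(p-pc) * I)^(2/p) := by
    intro p hp hp2 hδ hCp
    obtain ⟨Λ, h1, h2, h3⟩ := S.exists_Λ hb h2b hp hp2
    have h4 := hΛ p hp hp2 hδ Λ h1 h2 h3
    have h5 := h2 h hh h0
    have h6 : ∫ x, h x ^ p ∂P ≤ G^(p-pc) * I := by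
      rw [hI, ← integral_const_mul]
      refine integral_mono ((hh.rpow h0 (by linarith)).integrable _) (((hh.rpow h0 (by linarith)).integrable _).const_mul _) fun x => ?_
      simp only
      rcases (h0 x).eq_or_lt with hx | hx
      · rw [← hx, Real.zero_rpow (by linarith), Real.zero_rpow (by linarith)]; simp
      · calc h x ^ p = h x ^ (p - pc) * h x ^ pc := by rw [← Real.rpow_add hx]; ring_nf
          _ ≤ _ := by
            have := Real.rpow_le_rpow hx.le (hhG x) (by linarith : 0 ≤ p - pc)
            gcongr
    have hIp : 0 ≤ ∫ x, h x ^ p ∂P := integral_nonneg fun x => Real.rpow_nonneg (h0 x) _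
    have h7 : (∫ x, h x ^ p ∂P)^(2/p) ≤ (G^(p-pc) * I)^(2/p) :=
      Real.rpow_le_rpow hIp h6 (by have : 0 < p := by linarith
                                   positivity)
    have h8 : 0 ≤ (∫ x, h x ^ p ∂P)^(2/p) := Real.rpow_nonneg hIp _
    calc _ ≤ (1 - C * (p - pc)) * (Λ * (∫ x, h x ^ p ∂P)^(2/p)) := mul_le_mul_of_nonneg_left h5 (by linarith)
      _ = ((1 - C * (p - pc)) * Λ) * (∫ x, h x ^ p ∂P)^(2/p) := by ring
      _ ≤ γ b * (∫ x, h x ^ p ∂P)^(2/p) := mul_le_mul_of_nonneg_right (by linarith) h8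
      _ ≤ _ := mul_le_mul_of_nonneg_left h7 (S.γ_pos hb h2b).le
  have hc1 : ContinuousAt (fun p : ℝ => (1 - C * (p - pc)) * Qf P (kk ξ b) h) pc := by fun_prop
  have hc2 : ContinuousAt (fun p : ℝ => γ b * (G^(p-pc) * I)^(2/p)) pc := by
    refine continuousAt_const.mul (ContinuousAt.rpow ?_ ?_ (Or.inr (by positivity)))
    · exact (ContinuousAt.rpow continuousAt_const (by fun_prop) (Or.inl (by linarith))).mul continuousAt_const
    · exact continuousAt_const.div continuousAt_id (by simp; linarith)
  have hl := le_of_tendsto_of_tendsto (hc1.tendsto.mono_left (nhdsWithin_le_nhds (s := Set.Ioi pc)))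
    (hc2.tendsto.mono_left (nhdsWithin_le_nhds (s := Set.Ioi pc))) (by
      have w : pc < min 2 (min (pc + 1/(n-b)) (pc + 1/C)) := by
        have : 0 < 1/(n-b) := by positivity
        have : 0 < 1/C := by positivity
        simp only [lt_min_iff]; refine ⟨hpc2, by linarith, by linarith⟩
      filter_upwards [Ioo_mem_nhdsGT w] with p hp
      have hp' := hp.2
      simp only [lt_min_iff] at hp'
      refine key p hp.1 hp'.1 ?_ ?_
      · have : (n-b) * p ≤ (n-b) * (pc + 1/(n-b)) := mul_le_mul_of_nonneg_left hp'.2.1.le hnb.le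
        rw [mul_add, hnpc, mul_one_div_cancel hnb.ne'] at this
        linarith
      · have : C * (p - pc) < C * (1/C) := by gcongr; linarith [hp'.2.2]
        rwa [mul_one_div_cancel hC.ne'] at this)
  simpa using hl

end Sph

abbrev EE (n : ℕ) := EuclideanSpace ℝ (Fin n)

noncomputable def wt {n : ℕ} (x : EE n) : ℝ := 2 / (1 + ‖x‖ ^ 2)

noncomputable def Mw (n : ℕ) : ℝ := ∫ x : EE n, wt x ^ n

noncomputable def Pw (n : ℕ) : Measure (EE n) :=
  (volume : Measure (EE n)).withDensity (fun x => ENNReal.ofReal (wt x ^ n / Mw n))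

noncomputable def xi {n : ℕ} (a : Option (Fin n)) (x : EE n) : ℝ :=
  match a with
  | none => 1 - wt x
  | some i => wt x * x i

section
variable {n : ℕ}

lemma wt_pos (x : EE n) : 0 < wt x := by unfold wt; positivity
lemma wt_le (x : EE n) : wt x ≤ 2 := by
  unfold wt; rw [div_le_iff₀ (by positivity)]; nlinarith [sq_nonneg ‖x‖]
lemma wt_cont : Continuous (wt : EE n → ℝ) := by
  unfold wt
  exact continuous_const.div (by fun_prop) (fun x => by positivity)
lemma wt_BM : BM (wt : EE n → ℝ) :=
  ⟨wt_cont.measurable, 2, fun x => by rw [abs_of_pos (wt_pos x)]; exact wt_le x⟩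

lemma wt_rel (x : EE n) : wt x * (1 + ‖x‖^2) = 2 := by
  unfold wt; field_simp

lemma sum_sq (x : EE n) : ∑ i, x i ^ 2 = ‖x‖^2 := by
  rw [EuclideanSpace.real_norm_sq_eq]

lemma xi_h1 (x : EE n) : ∑ a, xi a x ^ 2 = 1 := by
  rw [Fintype.sum_option]
  simp only [xi, mul_pow]
  rw [← Finset.mul_sum, sum_sq]
  have := wt_rel x
  linear_combination wt x * this

lemma xi_BM (a : Option (Fin n)) : BM (xi a : EE n → ℝ) := by
  refine ⟨?_, 1, fun x => abs_le_one_of xi_h1 a x⟩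
  cases a with
  | none => exact measurable_const.sub wt_cont.measurable
  | some i => exact wt_cont.measurable.mul (f := wt) (g := fun x : EE n => x i) (by fun_prop)

lemma one_sub_tk (x y : EE n) : 1 - tk xi xi (x, y) = wt x * wt y * ‖x - y‖^2 / 2 := by
  have h1 := wt_rel x
  have h2 := wt_rel y
  have : tk xi xi (x, y) = (1 - wt x) * (1 - wt y) + wt x * wt y * ∑ i, x i * y i := by
    simp only [tk, Fintype.sum_option, xi]
    rw [Finset.mul_sum]; congr 1
    exact Finset.sum_congr rfl fun i _ => by ring
  have h3 : ‖x - y‖^2 = ‖x‖^2 + ‖y‖^2 - 2 * ∑ i, x i * y i := by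
    rw [← sum_sq, ← sum_sq, ← sum_sq, Finset.mul_sum, ← Finset.sum_add_distrib, ← Finset.sum_sub_distrib]
    exact Finset.sum_congr rfl fun i _ => by simp; ring
  rw [this, h3]
  linear_combination (- wt y / 2) * h1 - (wt x / 2) * h2

lemma int_wtn [hn : Fact (3 ≤ n)] : Integrable (fun x : EE n => wt x ^ n) := by
  have h := integrable_rpow_neg_one_add_norm_sq (E := EE n) (μ := volume) (r := 2 * n) (by
    have : (3:ℝ) ≤ n := by exact_mod_cast hn.out
    simp; linarith)
  have h2 := h.const_mul (2^n)
  refine h2.congr (Filter.Eventually.of_forall fun x => ?_)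
  simp only [wt]
  rw [div_pow, show (-(2 * (n:ℝ)) / 2) = -n by ring, Real.rpow_neg (by positivity), Real.rpow_natCast]
  rfl

lemma Mw_pos [hn : Fact (3 ≤ n)] : 0 < Mw n := by
  unfold Mw
  rw [integral_pos_iff_support_of_nonneg (fun x => (pow_pos (wt_pos x) n).le) int_wtn]
  have : (Function.support fun x : EE n => wt x ^ n) = Set.univ := by
    ext x; simp [(wt_pos x).ne']
  rw [this, Measure.measure_univ_pos]
  exact NeZero.ne _

lemma dens_meas : Measurable (fun x : EE n => ENNReal.ofReal (wt x ^ n / Mw n)) := by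
  have := wt_cont (n := n).measurable
  fun_prop

lemma Pw_integral [hn : Fact (3 ≤ n)] (f : EE n → ℝ) : ∫ x, f x ∂(Pw n) = (Mw n)⁻¹ * ∫ x, wt x ^ n * f x := by
  unfold Pw
  rw [integral_withDensity_eq_integral_toReal_smul dens_meas (by simp), ← integral_const_mul]
  refine integral_congr_ae (Filter.Eventually.of_forall fun x => ?_)
  simp only [smul_eq_mul]
  rw [ENNReal.toReal_ofReal (div_nonneg (pow_pos (wt_pos x) n).le Mw_pos.le)]; ring

lemma Pw_integrable [hn : Fact (3 ≤ n)] (f : EE n → ℝ) :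
    Integrable f (Pw n) ↔ Integrable (fun x => wt x ^ n * f x) := by
  unfold Pw
  rw [integrable_withDensity_iff_integrable_smul' dens_meas (by simp)]
  have : (fun x : EE n => (ENNReal.ofReal (wt x ^ n / Mw n)).toReal • f x) =
    fun x => (Mw n)⁻¹ * (wt x ^ n * f x) := by
    funext x
    rw [ENNReal.toReal_ofReal (div_nonneg (pow_pos (wt_pos x) n).le Mw_pos.le)]; simp only [smul_eq_mul]; ring
  rw [this, integrable_const_mul_iff (by simp [Mw_pos.ne'])]

instance [hn : Fact (3 ≤ n)] : IsProbabilityMeasure (Pw n) := by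
  refine ⟨?_⟩
  unfold Pw
  rw [withDensity_apply _ MeasurableSet.univ, Measure.restrict_univ,
    ← ofReal_integral_eq_lintegral_ofReal (int_wtn.div_const _)
      (Filter.Eventually.of_forall fun x => (div_nonneg (pow_pos (wt_pos x) n).le Mw_pos.le)), integral_div]
  change ENNReal.ofReal (Mw n / Mw n) = 1
  rw [div_self Mw_pos.ne']; simp

lemma nontriv [hn : Fact (3 ≤ n)] : Nontrivial (EE n) := by
  have h : Nontrivial (EE n) ↔ 0 < Module.finrank ℝ (EE n) := Module.finrank_pos_iff.symm
  rw [h]; simp; exact lt_of_lt_of_le (by norm_num) hn.out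

instance [hn : Fact (3 ≤ n)] : NullSingletonClass (Pw n) := by
  haveI := nontriv (n := n)
  unfold Pw
  refine ⟨fun x => ?_⟩
  exact withDensity_absolutelyContinuous _ _ (measure_singleton x)

lemma xi_hlt [hn : Fact (3 ≤ n)] : ∀ᵐ z ∂((Pw n).prod (Pw n)), tk xi xi z < 1 := by
  have hm : MeasurableSet {z : EE n × EE n | ¬ tk xi xi z < 1} := 
    (measurableSet_lt (tk_BM xi_BM xi_BM).meas measurable_const).compl
  rw [ae_iff, Measure.measure_prod_null hm]
  refine Filter.Eventually.of_forall fun x => ?_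
  refine measure_mono_null (t := {x}) (fun y hy => ?_) (measure_singleton x)
  simp only [Set.mem_preimage, Set.mem_setOf_eq, not_lt] at hy
  by_contra hne
  have h := one_sub_tk x y
  have h2 : 0 < ‖x - y‖ := norm_pos_iff.mpr (sub_ne_zero.mpr fun h => hne (by simp [h]))
  have := wt_pos x
  have := wt_pos y
  have : 0 < wt x * wt y * ‖x - y‖^2 / 2 := by positivity
  linarith

lemma kk_eq (b : ℝ) (x y : EE n) : kk xi b (x, y) = (wt x * wt y * ‖x - y‖^2 / 2) ^ (-b) := by
  rw [kk, one_sub_tk]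

lemma kk_meas' (b : ℝ) : Measurable (kk (xi (n := n)) b) := by
  have : Measurable (tk (xi (n := n)) xi) := (tk_BM xi_BM xi_BM).meas
  unfold kk; fun_prop

end

section
variable {n : ℕ}

noncomputable def invT (a : EE n) : EE n → EE n := EuclideanGeometry.inversion a (Real.sqrt (1 + ‖a‖^2))

lemma invT_def (a y : EE n) : invT a y = (Real.sqrt (1 + ‖a‖^2) / ‖y - a‖)^2 • (y - a) + a := by
  simp [invT, EuclideanGeometry.inversion, dist_eq_norm]

lemma invT_meas (a : EE n) : Measurable (invT a) := by
  have : invT a = fun y => (Real.sqrt (1 + ‖a‖^2) / ‖y - a‖)^2 • (y - a) + a := funext (invT_def a)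
  rw [this]; fun_prop

lemma sq_R (a : EE n) : Real.sqrt (1 + ‖a‖^2) ^ 2 = 1 + ‖a‖^2 := Real.sq_sqrt (by positivity)

lemma invT_norm (a y : EE n) (h : y ≠ a) :
    1 + ‖invT a y‖^2 = (1 + ‖a‖^2) / ‖y - a‖^2 * (1 + ‖y‖^2) := by
  have hd : 0 < ‖y - a‖ := norm_pos_iff.mpr (sub_ne_zero.mpr h)
  rw [invT_def, div_pow, sq_R]
  obtain ⟨e, rfl⟩ : ∃ e, y = e + a := ⟨y - a, by simp⟩
  simp only [add_sub_cancel_right] at *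
  rw [norm_add_sq_real, norm_add_sq_real, norm_smul, inner_smul_left, mul_pow]
  rw [Real.norm_of_nonneg (by positivity)]
  simp only [conj_trivial]
  field_simp
  ring

lemma invT_wt (a y : EE n) (h : y ≠ a) :
    wt (invT a y) * (1 + ‖a‖^2) = wt y * ‖y - a‖^2 := by
  have hd : 0 < ‖y - a‖ := norm_pos_iff.mpr (sub_ne_zero.mpr h)
  unfold wt
  rw [invT_norm a y h]; field_simp

lemma invT_dist (a x y : EE n) (hx : x ≠ a) (hy : y ≠ a) :
    ‖invT a x - invT a y‖ = (1 + ‖a‖^2) / (‖x - a‖ * ‖y - a‖) * ‖x - y‖ := by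
  rw [← dist_eq_norm, invT, EuclideanGeometry.dist_inversion_inversion hx hy, sq_R]
  simp [dist_eq_norm]

lemma invT_tk (a x y : EE n) (hx : x ≠ a) (hy : y ≠ a) :
    tk xi xi (invT a x, invT a y) = tk xi xi (x, y) := by
  have h1 := one_sub_tk (invT a x) (invT a y)
  have h2 := one_sub_tk x y
  rw [invT_dist a x y hx hy] at h1
  have h3 := invT_wt a x hx
  have h4 := invT_wt a y hy
  have hd1 : 0 < ‖y - a‖ := norm_pos_iff.mpr (sub_ne_zero.mpr hy)
  have hd2 : 0 < ‖x - a‖ := norm_pos_iff.mpr (sub_ne_zero.mpr hx)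
  have hR : 0 < 1 + ‖a‖^2 := by positivity
  rw [← eq_div_iff hR.ne'] at h3 h4
  rw [h3, h4] at h1
  have : wt x * ‖x - a‖ ^ 2 / (1 + ‖a‖ ^ 2) * (wt y * ‖y - a‖ ^ 2 / (1 + ‖a‖ ^ 2)) *
      ((1 + ‖a‖ ^ 2) / (‖x - a‖ * ‖y - a‖) * ‖x - y‖) ^ 2 / 2 = wt x * wt y * ‖x - y‖^2 / 2 := by
    field_simp
  rw [this] at h1
  linarith

lemma invT_invT (a y : EE n) : invT a (invT a y) = y :=
  EuclideanGeometry.inversion_inversion _ (by positivity) _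

lemma invT_ne (a y : EE n) (h : y ≠ a) : invT a y ≠ a := by
  intro h2
  apply h
  rw [← invT_invT a y, h2, invT, EuclideanGeometry.inversion_self]

lemma invT_det (a y : EE n) (h : y ≠ a) : ∃ D : EE n →L[ℝ] EE n, HasFDerivAt (invT a) D y ∧
    |D.det| = ((1 + ‖a‖^2) / ‖y - a‖^2)^n := by
  refine ⟨_, EuclideanGeometry.hasFDerivAt_inversion h, ?_⟩
  rw [dist_eq_norm, div_pow, sq_R, ContinuousLinearMap.det, ContinuousLinearMap.toLinearMap_smul, LinearMap.det_smul, abs_mul]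
  have : |LinearMap.det (((ℝ ∙ (y - a))ᗮ.reflection : EE n →L[ℝ] EE n) : EE n →ₗ[ℝ] EE n)| = 1 := by
    have := Submodule.det_reflection (ℝ ∙ (y - a))ᗮ
    erw [this]; simp
  erw [this]
  rw [abs_of_nonneg (by positivity)]; simp

lemma invT_mp [hn : Fact (3 ≤ n)] (a : EE n) : MeasurePreserving (invT a) (Pw n) (Pw n) := by
  refine ⟨invT_meas a, ?_⟩
  ext S hS
  rw [Measure.map_apply (invT_meas a) hS]
  have hA : MeasurableSet (invT a ⁻¹' S \ {a}) := ((invT_meas a) hS).diff (measurableSet_singleton a)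
  rw [← measure_diff_null (measure_singleton a), ← measure_diff_null (s := S) (measure_singleton a)]
  have him : S \ {a} = invT a '' (invT a ⁻¹' S \ {a}) := by
    ext z; constructor
    · rintro ⟨hz, hza⟩
      exact ⟨invT a z, ⟨by simpa [invT_invT] using hz, by simpa using invT_ne a z hza⟩, invT_invT a z⟩
    · rintro ⟨y, ⟨hy, hya⟩, rfl⟩
      exact ⟨hy, invT_ne a y hya⟩
  have hD : ∀ y, ∃ D : EE n →L[ℝ] EE n, y ≠ a → HasFDerivAt (invT a) D y ∧
    |D.det| = ((1 + ‖a‖^2) / ‖y - a‖^2)^n := by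
    intro y
    by_cases h : y = a
    · exact ⟨0, fun h' => absurd h h'⟩
    · obtain ⟨D, hD⟩ := invT_det a y h
      exact ⟨D, fun _ => hD⟩
  choose D hD using hD
  unfold Pw
  rw [him, withDensity_apply _ hA, withDensity_apply _ (by rw [← him]; exact hS.diff (measurableSet_singleton a)),
    lintegral_image_eq_lintegral_abs_det_fderiv_mul volume hA (f' := D)
      (fun y hy => (hD y hy.2).1.hasFDerivWithinAt)
      (fun y _ z _ h => by rw [← invT_invT a y, h, invT_invT])]
  refine setLIntegral_congr_fun hA fun y hy => ?_
  have hya : y ≠ a := hy.2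
  rw [(hD y hya).2, ← ENNReal.ofReal_mul (by positivity)]
  congr 1
  have h4 := invT_wt a y hya
  have hd : 0 < ‖y - a‖ := norm_pos_iff.mpr (sub_ne_zero.mpr hya)
  have : (1 + ‖a‖^2) / ‖y - a‖^2 * wt (invT a y) = wt y := by
    field_simp; linarith
  rw [← this, mul_pow]; ring

lemma const_x [hn : Fact (3 ≤ n)] (Φ : ℝ → ℝ) (hΦ : Measurable Φ) (x : EE n) :
    (Integrable (fun y => Φ (tk xi xi (x, y))) (Pw n) ↔ Integrable (fun y => Φ (tk xi xi (0, y))) (Pw n)) ∧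
    ∫ y, Φ (tk xi xi (x, y)) ∂(Pw n) = ∫ y, Φ (tk xi xi ((0 : EE n), y)) ∂(Pw n) := by
  by_cases hx : x = 0
  · subst hx; exact ⟨Iff.rfl, rfl⟩
  have hx0 : 0 < ‖x‖ := norm_pos_iff.mpr hx
  set a : EE n := -(‖x‖^2)⁻¹ • x with ha
  have hna : ‖a‖ = ‖x‖⁻¹ := by
    rw [ha, norm_smul, norm_neg, norm_inv, norm_pow, norm_norm]; field_simp
  have ha0 : (0 : EE n) ≠ a := by
    intro h
    rw [← h, norm_zero] at hna
    have : 0 < ‖x‖⁻¹ := by positivity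
    linarith
  have hT0 : invT a 0 = x := by
    rw [invT_def, div_pow, sq_R, zero_sub, norm_neg, hna, ha, smul_neg, smul_smul, ← neg_smul, ← add_smul]
    conv_rhs => rw [← one_smul ℝ x]
    congr 1
    field_simp; ring
  have hm : Measurable (fun y => Φ (tk xi xi (x, y))) :=
    hΦ.comp ((tk_BM xi_BM xi_BM).meas.comp (by fun_prop))
  have hae : (fun y => Φ (tk xi xi (x, y))) ∘ invT a =ᵐ[Pw n] fun y => Φ (tk xi xi (0, y)) := by
    have : ∀ᵐ y ∂(Pw n), y ≠ a := by
      rw [ae_iff]; simp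
    filter_upwards [this] with y hy
    simp only [Function.comp]
    rw [← hT0, invT_tk a 0 y ha0 hy]
  constructor
  · rw [← (invT_mp a).integrable_comp hm.aestronglyMeasurable]
    exact integrable_congr hae
  · conv_lhs => rw [← (invT_mp a).map_eq]
    rw [integral_map (invT_meas a).aemeasurable hm.aestronglyMeasurable]
    exact integral_congr_ae hae
end

noncomputable def JJ (α β : ℝ) : ℝ := ∫ r in Set.Ioi (0:ℝ), r ^ α * (1 + r^2) ^ β

lemma JJ_meas (α β : ℝ) : Measurable (fun r : ℝ => r ^ α * (1 + r^2) ^ β) := by fun_prop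

lemma JJ_int {α β : ℝ} (h1 : -1 < α) (h2 : α + 2 * β < -1) :
    IntegrableOn (fun r : ℝ => r ^ α * (1 + r^2) ^ β) (Set.Ioi 0) := by
  have hβ : β < 0 := by linarith
  rw [← Set.Ioc_union_Ioi_eq_Ioi (zero_le_one' ℝ)]
  refine IntegrableOn.union ?_ ?_
  · have hi : IntegrableOn (fun r : ℝ => r ^ α) (Set.Ioc 0 1) := by
      have := intervalIntegral.intervalIntegrable_rpow' (a := 0) (b := 1) h1
      exact (intervalIntegrable_iff_integrableOn_Ioc_of_le zero_le_one).mp this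
    refine hi.mono' (JJ_meas α β).aestronglyMeasurable ?_
    refine (ae_restrict_mem measurableSet_Ioc).mono fun r hr => ?_
    have h0 : 0 ≤ r ^ α := Real.rpow_nonneg hr.1.le _
    rw [Real.norm_of_nonneg (by positivity)]
    exact mul_le_of_le_one_right h0 (Real.rpow_le_one_of_one_le_of_nonpos (by nlinarith) hβ.le)
  · have hi := integrableOn_Ioi_rpow_of_lt h2 one_pos
    refine hi.mono' (JJ_meas α β).aestronglyMeasurable ?_
    refine (ae_restrict_mem measurableSet_Ioi).mono fun r hr => ?_
    have hr' : (1:ℝ) < r := hr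
    have hr0 : 0 < r := by linarith
    have h0 : 0 ≤ r ^ α := Real.rpow_nonneg hr0.le _
    rw [Real.norm_of_nonneg (by positivity), Real.rpow_add hr0, Real.rpow_mul hr0.le]
    refine mul_le_mul_of_nonneg_left ?_ h0
    rw [Real.rpow_two]
    exact Real.rpow_le_rpow_of_nonpos (by positivity) (by linarith) hβ.le

lemma JJ_pos {α β : ℝ} (h1 : -1 < α) (h2 : α + 2 * β < -1) : 0 < JJ α β := by
  unfold JJ
  rw [setIntegral_pos_iff_support_of_nonneg_ae]
  · have : (Function.support fun r : ℝ => r ^ α * (1 + r^2) ^ β) ∩ Set.Ioi 0 = Set.Ioi 0 := by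
      ext r
      simp only [Set.mem_inter_iff, Function.mem_support, Set.mem_Ioi, and_iff_right_iff_imp]
      intro hr; have := Real.rpow_pos_of_pos hr α; positivity
    rw [this]; simp
  · refine (ae_restrict_mem measurableSet_Ioi).mono fun r hr => ?_
    have := Real.rpow_pos_of_pos hr α; simp only [Pi.zero_apply]; positivity
  · exact JJ_int h1 h2

lemma GG_deriv (σ β r : ℝ) (hr : 0 < r) : HasDerivAt (fun r : ℝ => r ^ σ * (1 + r^2)^β)
    (σ * (r ^ (σ - 1) * (1 + r^2)^β) + 2 * β * (r ^ (σ+1) * (1 + r^2)^(β-1))) r := by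
  have h1 : HasDerivAt (fun r : ℝ => r ^ σ) (σ * r ^ (σ - 1)) r := Real.hasDerivAt_rpow_const (Or.inl hr.ne')
  have h2 : HasDerivAt (fun r : ℝ => (1 + r^2)) (2 * r) r := by
    simpa using (hasDerivAt_pow 2 r).const_add 1
  have h3 := h2.rpow_const (p := β) (Or.inl (by positivity))
  refine (h1.mul h3).congr_deriv ?_
  rw [Real.rpow_add_one hr.ne']
  ring

lemma GG_cont (σ β : ℝ) (hσ : 0 < σ) : ContinuousWithinAt (fun r : ℝ => r ^ σ * (1 + r^2)^β) (Set.Ici 0) 0 := by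
  apply Continuous.continuousWithinAt
  refine (Real.continuous_rpow_const hσ.le).mul ?_
  exact (by fun_prop : Continuous fun r : ℝ => 1 + r^2).rpow_const (fun r => Or.inl (by positivity))

lemma tend_ratio (β : ℝ) : Filter.Tendsto (fun r : ℝ => r ^ (-2 * β) * (1 + r^2)^β) Filter.atTop (nhds 1) := by
  have h : Filter.Tendsto (fun r : ℝ => ((r^2)⁻¹ + 1) ^ β) Filter.atTop (nhds ((0 + 1)^β)) := by
    refine Filter.Tendsto.rpow_const ?_ (Or.inl (by norm_num))
    refine Filter.Tendsto.add ?_ tendsto_const_nhds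
    exact (Filter.tendsto_pow_atTop (by norm_num)).inv_tendsto_atTop
  simp only [zero_add, Real.one_rpow] at h
  refine h.congr' ?_
  filter_upwards [Filter.eventually_gt_atTop 0] with r hr
  rw [show (-2 * β) = 2 * (-β) by ring, Real.rpow_mul hr.le, Real.rpow_two, Real.rpow_neg (by positivity),
    ← Real.inv_rpow (by positivity), ← Real.mul_rpow (by positivity) (by positivity)]
  congr 1; field_simp

lemma GG_tend (σ β : ℝ) (h : σ + 2 * β < 0) :
    Filter.Tendsto (fun r : ℝ => r ^ σ * (1 + r^2)^β) Filter.atTop (nhds 0) := by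
  have h1 := (tendsto_rpow_neg_atTop (y := -(σ + 2 * β)) (by linarith)).mul (tend_ratio β)
  simp only [zero_mul] at h1
  refine h1.congr' ?_
  filter_upwards [Filter.eventually_gt_atTop 0] with r hr
  rw [← mul_assoc, ← Real.rpow_add hr]; congr 2; ring

lemma JJ_ftc {σ β : ℝ} (hσ : 0 < σ) (h : σ + 2 * β < 0) :
    σ * JJ (σ - 1) β = -2 * β * JJ (σ + 1) (β - 1) := by
  have i1 := (JJ_int (α := σ - 1) (β := β) (by linarith) (by linarith)).const_mul σ
  have i2 := (JJ_int (α := σ + 1) (β := β - 1) (by linarith) (by linarith)).const_mul (2 * β)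
  have e := integral_Ioi_of_hasDerivAt_of_tendsto (GG_cont σ β hσ) (fun r hr => GG_deriv σ β r hr)
    (i1.add i2) (GG_tend σ β h)
  have e2 := integral_add i1 i2
  rw [e2, integral_const_mul, integral_const_mul] at e
  rw [Real.zero_rpow hσ.ne'] at e
  unfold JJ
  linarith

lemma JJ_one (s : ℝ) (hs : 0 < s) : JJ 1 (-s - 1) = 1 / (2 * s) := by
  have i2 := (JJ_int (α := 1) (β := -s - 1) (by norm_num) (by linarith)).const_mul (2 * (-s))
  have hd : ∀ r ∈ Set.Ioi (0:ℝ), HasDerivAt (fun r : ℝ => r ^ (0:ℝ) * (1 + r^2)^(-s))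
      (2 * (-s) * (r ^ (1:ℝ) * (1 + r^2)^(-s-1))) r := by
    intro r hr
    have := GG_deriv 0 (-s) r hr
    simpa using this
  have hc : ContinuousWithinAt (fun r : ℝ => r ^ (0:ℝ) * (1 + r^2)^(-s)) (Set.Ici 0) 0 := by
    simp only [Real.rpow_zero, one_mul]
    exact ((by fun_prop : Continuous fun r : ℝ => 1 + r^2).rpow_const 
      (fun r => Or.inl (by positivity))).continuousWithinAt
  have e := integral_Ioi_of_hasDerivAt_of_tendsto hc hd i2 (GG_tend 0 (-s) (by linarith))
  rw [integral_const_mul] at e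
  simp at e
  unfold JJ
  simp only [Real.rpow_one]
  field_simp; linarith

lemma JJ_big (s : ℝ) (hs : 0 < s) : JJ (2 * s - 1) (-s - 1) = 1 / (2 * s) := by
  have i2 := (JJ_int (α := 2 * s - 1) (β := -s - 1) (by linarith) (by linarith)).const_mul (2 * s)
  have hd : ∀ r ∈ Set.Ioi (0:ℝ), HasDerivAt (fun r : ℝ => r ^ (2 * s) * (1 + r^2)^(-s))
      (2 * s * (r ^ (2 * s - 1) * (1 + r^2)^(-s-1))) r := by
    intro r hr
    have h0 : 0 < r := hr
    have := GG_deriv (2 * s) (-s) r hr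
    convert this using 1
    have h1 : (1 + r^2) ^ (-s) = (1 + r^2)^(-s - 1) * (1 + r^2) := by
      rw [← Real.rpow_add_one (by positivity)]; congr 1; ring
    have h2 : r ^ (2 * s + 1) = r ^ (2 * s - 1) * r^2 := by
      rw [← Real.rpow_natCast, ← Real.rpow_add h0]; congr 1; push_cast; ring
    rw [h1, h2]; ring
  have ht := tend_ratio (-s)
  rw [show -2 * -s = 2 * s by ring] at ht
  have e := integral_Ioi_of_hasDerivAt_of_tendsto (GG_cont (2 * s) (-s) (by linarith)) hd i2 ht
  rw [integral_const_mul, Real.zero_rpow (by linarith)] at e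
  unfold JJ
  field_simp; linarith

noncomputable def cS (n : ℕ) : ℝ := n * (volume : Measure (EE n)).real (Metric.ball 0 1)

section
variable {n : ℕ}

lemma cS_pos [hn : Fact (3 ≤ n)] : 0 < cS n := by
  have : (0:ℝ) < n := by exact_mod_cast (show 0 < n by have := hn.out; omega)
  have h2 : 0 < (volume : Measure (EE n)).real (Metric.ball 0 1) := 
    ENNReal.toReal_pos (Metric.measure_ball_pos _ _ one_pos).ne' measure_ball_lt_top.ne
  unfold cS; positivity

lemma rad [hn : Fact (3 ≤ n)] (f : ℝ → ℝ) (A α β : ℝ) (h1 : -1 < α) (h2 : α + 2 * β < -1)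
    (h : ∀ r, 0 < r → r ^ (n - 1) * f r = A * (r ^ α * (1 + r^2)^β)) :
    Integrable (fun x : EE n => f ‖x‖) ∧ ∫ x : EE n, f ‖x‖ = cS n * (A * JJ α β) := by
  haveI := nontriv (n := n)
  constructor
  · rw [integrable_fun_norm_addHaar volume]
    refine ((JJ_int h1 h2).const_mul A).congr ?_
    refine (ae_restrict_mem measurableSet_Ioi).mono fun r hr => ?_
    simp [← h r hr]
  · rw [integral_fun_norm_addHaar volume]
    simp only [finrank_euclideanSpace, Fintype.card_fin, smul_eq_mul, nsmul_eq_mul, cS]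
    unfold JJ
    rw [setIntegral_congr_fun measurableSet_Ioi (fun r hr => h r hr), integral_const_mul]; ring

end

noncomputable def gam (n : ℕ) (b : ℝ) : ℝ :=
  (Mw n)⁻¹ * (cS n * ((2:ℝ)^((n:ℝ)-b) * JJ (n - 1 - 2 * b) (b - n)))

section
variable {n : ℕ}

lemma one_sub_tk0 (y : EE n) : 1 - tk xi xi (0, y) = 2 * ‖y‖^2 / (1 + ‖y‖^2) := by
  rw [one_sub_tk]; simp only [wt]; simp; field_simp

lemma rpow_id (n : ℕ) (hn : 3 ≤ n) (b r : ℝ) (hr : 0 < r) : r ^ (n - 1) * ((2 / (1 + r^2)) ^ n * (2 * r^2 / (1 + r^2)) ^ (-b)) =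
    (2:ℝ)^((n:ℝ)-b) * (r ^ ((n:ℝ) - 1 - 2 * b) * (1 + r^2)^(b - n)) := by
  have h1 : r ^ (n - 1) = r ^ ((n:ℝ) - 1) := by
    rw [← Real.rpow_natCast]; congr 1; push_cast [Nat.cast_sub (show 1 ≤ n by omega)]; ring
  have hp : 0 < 1 + r^2 := by positivity
  rw [h1, Real.rpow_sub hr _ (2 * b), Real.rpow_sub two_pos, Real.rpow_sub hp, div_pow,
    Real.div_rpow (by positivity) (by positivity), Real.mul_rpow (by positivity) (by positivity),
    Real.rpow_neg (by positivity), Real.rpow_neg (by positivity), Real.rpow_neg (by positivity), Real.rpow_mul hr.le,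
    Real.rpow_natCast, Real.rpow_natCast, Real.rpow_two]
  have := Real.rpow_pos_of_pos two_pos b
  have := Real.rpow_pos_of_pos hp b
  field_simp

lemma rad0 [hn : Fact (3 ≤ n)] (b : ℝ) (h2b : 2 * b < n) (hb' : b < n) (hb0 : -(n:ℝ) < 0) :
    Integrable (fun y : EE n => (1 - tk xi xi (0, y)) ^ (-b)) (Pw n) ∧
      ∫ y : EE n, (1 - tk xi xi (0, y)) ^ (-b) ∂(Pw n) = gam n b := by
  have := rad (n := n) (fun r => (2 / (1 + r^2)) ^ n * (2 * r^2 / (1 + r^2)) ^ (-b)) ((2:ℝ)^((n:ℝ)-b))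
    (n - 1 - 2 * b) (b - n) (by linarith) (by linarith) (fun r hr => rpow_id n hn.out b r hr)
  rw [Pw_integrable, Pw_integral, gam]
  simp only [one_sub_tk0, wt]
  exact ⟨this.1, by rw [this.2]⟩

lemma gam_rec [hn : Fact (3 ≤ n)] (b : ℝ) (h2b : 2 * b < n) (hb' : b < n) :
    (n - 2 * b) * gam n b = (n - b) * gam n (b - 1) := by
  have hn0 : (3:ℝ) ≤ n := by exact_mod_cast hn.out
  have := JJ_ftc (σ := n - 2 * b) (β := b - n) (by linarith) (by linarith)
  unfold gam
  rw [show (n:ℝ) - 1 - 2 * b = n - 2 * b - 1 by ring, show (n:ℝ) - 1 - 2 * (b - 1) = n - 2 * b + 1 by ring,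
    show b - 1 - (n:ℝ) = b - n - 1 by ring, show (n:ℝ) - (b - 1) = n - b + 1 by ring,
    Real.rpow_add_one two_ne_zero]
  linear_combination (Mw n)⁻¹ * cS n * 2^((n:ℝ)-b) * this

lemma kk_gam [hn : Fact (3 ≤ n)] (b : ℝ) (hb : 0 < b) (h2b : 2 * b < n) (x : EE n) :
    Integrable (fun y => kk xi b (x, y)) (Pw n) ∧ ∫ y, kk xi b (x, y) ∂(Pw n) = gam n b := by
  have h := const_x (fun t => (1 - t)^(-b)) (by fun_prop) x
  have h0 := rad0 (n := n) b h2b (by linarith) (by linarith)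
  exact ⟨h.1.mpr h0.1, h.2.trans h0.2⟩

lemma kk_gamt [hn : Fact (3 ≤ n)] (b : ℝ) (hb : 0 < b) (h2b : 2 * b < n) (x : EE n) :
    ∫ y, tk xi xi (x, y) * kk xi b (x, y) ∂(Pw n) = b / (n - b) * gam n b := by
  have h := const_x (fun t => t * (1 - t)^(-b)) (by fun_prop) x
  have h0 := rad0 (n := n) b h2b (by linarith) (by linarith)
  have h1 := rad0 (n := n) (b-1) (by linarith) (by linarith) (by linarith)
  have e := integral_sub h0.1 h1.1
  have e2 : ∫ y, tk xi xi ((0 : EE n), y) * (1 - tk xi xi ((0 : EE n), y))^(-b) ∂(Pw n) = 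
      ∫ y, ((1 - tk xi xi ((0 : EE n), y))^(-b) - (1 - tk xi xi ((0 : EE n), y))^(-(b-1))) ∂(Pw n) := by
    haveI : NullSingletonClass (Pw n) := inferInstance
    have : ∀ᵐ y ∂(Pw n), y ≠ 0 := by rw [ae_iff]; simp
    refine integral_congr_ae (this.mono fun y hy => ?_)
    have hp : 0 < 1 - tk xi xi ((0 : EE n), y) := by
      rw [one_sub_tk0]; have := norm_pos_iff.mpr hy; positivity
    simp only
    rw [show -(b-1) = -b + 1 by ring, Real.rpow_add_one hp.ne']; ring
  have h' := h.2
  simp only [kk]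
  rw [h', e2, e, h0.2, h1.2]
  have := gam_rec b h2b (by linarith : b < n)
  have h3 : (n:ℝ) - b ≠ 0 := by linarith
  field_simp
  linear_combination this
end

section
variable {n : ℕ}

noncomputable def Dd (m : ℝ) (f : EE n → ℝ) : ℝ := ∫ x, ∫ y, f x * f y / ‖x - y‖ ^ m

lemma int_aff (g : EE n → ℝ) {l : ℝ} (hl : 0 < l) (c : EE n) :
    ∫ x, g (l • x + c) = (l ^ n)⁻¹ * ∫ x, g x := by
  have h := Measure.integral_comp_smul (volume : Measure (EE n)) (fun x => g (x + c)) l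
  rw [h, integral_add_right_eq_self (μ := volume) g c]
  simp only [finrank_euclideanSpace, Fintype.card_fin, smul_eq_mul]
  rw [abs_of_pos (by positivity)]

lemma Dd_aff (m : ℝ) (f : EE n → ℝ) {l : ℝ} (hl : 0 < l) (c : EE n) :
    Dd m (fun x => f (l • x + c)) = l ^ m * ((l ^ n)⁻¹ * (l^n)⁻¹) * Dd m f := by
  unfold Dd
  have h1 : ∀ x y : EE n, f (l • x + c) * f (l • y + c) / ‖x - y‖ ^ m =
      l ^ m * (f (l • x + c) * f (l • y + c) / ‖(l • x + c) - (l • y + c)‖ ^ m) := by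
    intro x y
    rw [add_sub_add_right_eq_sub, ← smul_sub, norm_smul, Real.norm_of_nonneg hl.le,
      Real.mul_rpow hl.le (norm_nonneg _)]
    have := Real.rpow_pos_of_pos hl m
    field_simp
  simp only [h1]
  simp only [integral_const_mul]
  have h2 : ∀ x : EE n, ∫ y, f (l • x + c) * f (l • y + c) / ‖(l • x + c) - (l • y + c)‖ ^ m =
      (l ^ n)⁻¹ * ∫ y, f (l • x + c) * f y / ‖(l • x + c) - y‖ ^ m :=
    fun x => int_aff (fun y => f (l • x + c) * f y / ‖(l • x + c) - y‖ ^ m) hl c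
  simp only [h2]
  simp only [integral_const_mul]
  rw [int_aff (fun x => ∫ y, f x * f y / ‖x - y‖ ^ m) hl c]
  ring

lemma Dd_smul (m c : ℝ) (f : EE n → ℝ) : Dd m (fun x => c * f x) = c^2 * Dd m f := by
  unfold Dd
  rw [← integral_const_mul]
  congr 1; funext x
  rw [← integral_const_mul]
  congr 1; funext y; ring

lemma kk_intP [hn : Fact (3 ≤ n)] {b : ℝ} (hb : 0 < b) (h2b : 2 * b < n) :
    Integrable (kk (xi (n := n)) b) ((Pw n).prod (Pw n)) := by
  rw [integrable_prod_iff (kk_meas' b).aestronglyMeasurable]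
  refine ⟨Filter.Eventually.of_forall fun x => (kk_gam b hb h2b x).1, ?_⟩
  have : (fun x => ∫ y, ‖kk (xi (n := n)) b (x, y)‖ ∂(Pw n)) = fun x => gam n b := by
    funext x
    rw [← (kk_gam b hb h2b x).2]
    refine integral_congr_ae (Filter.Eventually.of_forall fun y => Real.norm_of_nonneg ?_)
    exact Real.rpow_nonneg (by linarith [(abs_le.mp (tk_abs_le xi_h1 (x, y))).2]) _
  rw [this]; exact integrable_const _

lemma kk_eq2 (b : ℝ) (x y : EE n) : kk xi b (x, y) = 2^b * wt x ^ (-b) * wt y ^ (-b) / ‖x - y‖ ^ (2 * b) := by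
  have h1 := wt_pos x
  have h2 := wt_pos y
  rw [kk_eq, Real.div_rpow (by positivity) (by norm_num), Real.mul_rpow (by positivity) (by positivity),
    Real.mul_rpow h1.le h2.le, Real.rpow_neg two_pos.le, Real.rpow_neg (sq_nonneg ‖x - y‖),
    Real.rpow_mul (norm_nonneg _), Real.rpow_two]
  have := Real.rpow_pos_of_pos two_pos b
  field_simp

lemma Q_eq_D [hn : Fact (3 ≤ n)] {b : ℝ} (hb : 0 < b) (h2b : 2 * b < n) {h : EE n → ℝ} (hh : BM h) :
    Qf (Pw n) (kk xi b) h = 2^b / Mw n ^ 2 * Dd (2 * b) (fun x => h x * wt x ^ ((n:ℝ) - b)) := by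
  unfold Qf Dd
  rw [integral_prod _ ((hh.fst.mul hh.snd).mul_integrable (kk_intP hb h2b))]
  rw [Pw_integral]
  simp only [Pw_integral]
  rw [← integral_const_mul, ← integral_const_mul]
  congr 1; funext x
  rw [← integral_const_mul, ← integral_const_mul, ← integral_const_mul, ← integral_const_mul]
  congr 1; funext y
  rw [kk_eq2, Real.rpow_sub (wt_pos x), Real.rpow_sub (wt_pos y), Real.rpow_natCast, Real.rpow_natCast,
    Real.rpow_neg (wt_pos x).le, Real.rpow_neg (wt_pos y).le]
  have := (Mw_pos (n := n))
  field_simp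

lemma conf_gen [hn : Fact (3 ≤ n)] {b : ℝ} (hb : 0 < b) (h2b : 2 * b < n) {p : ℝ} (hp : n / (n - b) < p)
    (hd : (n - b) * p - n ≤ 1) {l : ℝ} (hl : 0 < l) (c : EE n) {z : EE n → ℝ} (hz : BM z)
    (hr : ∀ x, l * wt (l • x + c) / wt x ≤ 1 + z (l • x + c)) {h : EE n → ℝ} (hh : BM h) (h0 : ∀ x, 0 ≤ h x) :
    ∃ h' : EE n → ℝ, BM h' ∧ (∀ x, 0 ≤ h' x) ∧ Qf (Pw n) (kk xi b) h' = Qf (Pw n) (kk xi b) h ∧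
      ∫ x, h' x ^ p ∂(Pw n) ≤ ∫ x, h x ^ p * (1 + ((n - b) * p - n) * z x) ∂(Pw n) := by
  have hn0 : (3:ℝ) ≤ n := by exact_mod_cast hn.out
  have hnb : 0 < (n:ℝ) - b := by linarith
  have hδ : 0 < (n - b) * p - n := by
    rw [div_lt_iff₀ hnb] at hp; linarith
  have hp0 : 0 < p := lt_trans (by positivity) hp
  set δ : ℝ := (n - b) * p - n with hδd
  let ρ : EE n → ℝ := fun x => l * wt (l • x + c) / wt x
  have hρ0 : ∀ x, 0 < ρ x := fun x => div_pos (mul_pos hl (wt_pos _)) (wt_pos _)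
  let σ : EE n → ℝ := fun y => l * wt y / wt (l⁻¹ • (y - c))
  have hσ0 : ∀ x, 0 < σ x := fun x => div_pos (mul_pos hl (wt_pos _)) (wt_pos _)
  have hσρ : ∀ x, σ (l • x + c) = ρ x := fun x => by
    simp only [σ, ρ, add_sub_cancel_right, smul_smul, inv_mul_cancel₀ hl.ne', one_smul]
  have hσz : ∀ y, σ y ≤ 1 + z y := fun y => by
    have := hr (l⁻¹ • (y - c))
    simpa [smul_smul, mul_inv_cancel₀ hl.ne'] using this
  obtain ⟨Z, hZ⟩ := hz.bdd
  have hwm := wt_cont (n := n).measurable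
  have hσB : BM σ := by
    refine ⟨?_, 1 + Z, fun y => ?_⟩
    · have : Measurable (fun y : EE n => l⁻¹ • (y - c)) := by fun_prop
      exact (hwm.const_mul l).div (hwm.comp this)
    · rw [abs_of_pos (hσ0 y)]
      linarith [hσz y, (abs_le.mp (hZ y)).2]
  have hma : Measurable (fun x : EE n => l • x + c) := by fun_prop
  have hρB : BM ρ := by
    have := hσB.comp hma
    convert this using 2 with x
    exact (hσρ x).symm
  have hB' : BM (fun x => h (l • x + c) * ρ x ^ ((n:ℝ) - b)) :=
    (hh.comp hma).mul (hρB.rpow (fun x => (hρ0 x).le) hnb.le)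
  refine ⟨_, hB', fun x => mul_nonneg (h0 _) (Real.rpow_nonneg (hρ0 x).le _), ?_, ?_⟩
  · rw [Q_eq_D hb h2b hB', Q_eq_D hb h2b hh]
    congr 1
    have : (fun x => h (l • x + c) * ρ x ^ ((n:ℝ) - b) * wt x ^ ((n:ℝ) - b)) =
        fun x => l ^ ((n:ℝ) - b) * (fun y => h y * wt y ^ ((n:ℝ) - b)) (l • x + c) := by
      funext x
      rw [mul_assoc, ← Real.mul_rpow (hρ0 x).le (wt_pos x).le]
      simp only [ρ]
      rw [div_mul_cancel₀ _ (wt_pos x).ne', Real.mul_rpow hl.le (wt_pos _).le]; ring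
    rw [this, Dd_smul, Dd_aff (2 * b) (fun y => h y * wt y ^ ((n:ℝ) - b)) hl c, ← mul_assoc]
    have e : (l ^ ((n:ℝ) - b))^2 * (l ^ (2 * b) * ((l ^ n)⁻¹ * (l^n)⁻¹)) = 1 := by
      rw [Real.rpow_sub hl, Real.rpow_natCast, show 2 * b = b + b by ring, Real.rpow_add hl]
      have := Real.rpow_pos_of_pos hl b
      field_simp
    rw [e, one_mul]
  · have e1 : ∫ x, (h (l • x + c) * ρ x ^ ((n:ℝ) - b)) ^ p ∂(Pw n) = ∫ y, h y ^ p * σ y ^ δ ∂(Pw n) := by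
      rw [Pw_integral, Pw_integral]
      congr 1
      have h2 := int_aff (fun y => wt y ^ n * (h y ^ p * σ y ^ δ)) hl c
      have h3 : ∫ y, wt y ^ n * (h y ^ p * σ y ^ δ) = 
          l ^ n * ∫ x, wt (l • x + c) ^ n * (h (l • x + c) ^ p * σ (l • x + c) ^ δ) := by
        rw [h2]; field_simp
      rw [h3, ← integral_const_mul]
      congr 1; funext x
      rw [hσρ, Real.mul_rpow (h0 _) (Real.rpow_nonneg (hρ0 x).le _), ← Real.rpow_mul (hρ0 x).le,
        show ((n:ℝ) - b) * p = n + δ by rw [hδd]; ring, Real.rpow_add (hρ0 x), Real.rpow_natCast]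
      have : wt x ^ n * ρ x ^ n = l ^ n * wt (l • x + c) ^ n := by
        rw [← mul_pow, ← mul_pow]; congr 1
        simp only [ρ]; field_simp [(wt_pos x).ne']
      linear_combination (h (l • x + c) ^ p * ρ x ^ δ) * this
    rw [e1]
    have b1 := hh.rpow h0 hp0.le
    refine integral_mono ((b1.mul (hσB.rpow (fun x => (hσ0 x).le) hδ.le)).integrable _)
      ((b1.mul ((BM.const 1).add (hz.const_mul δ))).integrable _) fun y => ?_
    refine mul_le_mul_of_nonneg_left ?_ (Real.rpow_nonneg (h0 y) _)
    calc σ y ^ δ ≤ (1 + z y) ^ δ := Real.rpow_le_rpow (hσ0 y).le (hσz y) hδ.le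
      _ ≤ 1 + δ * z y := _root_.rpow_one_add_le_one_add_mul_self (by linarith [hσz y, hσ0 y]) hδ.le hd

lemma conf_all [hn : Fact (3 ≤ n)] (b : ℝ) (hb : 0 < b) (h2b : 2 * b < n) (p : ℝ) (hp : n / (n - b) < p)
    (hd : (n - b) * p - n ≤ 1) (a : Option (Fin n)) (v : ℝ) (h : EE n → ℝ) (hh : BM h) (h0 : ∀ x, 0 ≤ h x) :
    ∃ h' : EE n → ℝ, BM h' ∧ (∀ x, 0 ≤ h' x) ∧ Qf (Pw n) (kk xi b) h' = Qf (Pw n) (kk xi b) h ∧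
      ∫ x, h' x ^ p ∂(Pw n) ≤ ∫ x, h x ^ p * (1 + ((n - b) * p - n) * (v * xi a x + 2 * v^2)) ∂(Pw n) := by
  have hzB : BM (fun x : EE n => v * xi a x + 2 * v^2) := ((xi_BM a).const_mul v).add (BM.const _)
  cases a with
  | none =>
    set s := Real.sqrt (1 + v^2) with hs
    have hs2 : s^2 = 1 + v^2 := Real.sq_sqrt (by positivity)
    have hs0 : 0 < s := Real.sqrt_pos.mpr (by positivity)
    have hsv : |v| < s := by
      rw [hs]; apply Real.lt_sqrt_of_sq_lt; rw [sq_abs]; linarith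
    have hl : 0 < s - v := by linarith [le_abs_self v]
    refine conf_gen hb h2b hp hd hl 0 hzB (fun x => ?_) hh h0
    have hs3 : s ≤ 1 + 2 * v^2 := by nlinarith [sq_nonneg v]
    suffices (s - v) * wt ((s - v) • x + 0) / wt x = s + v * xi none ((s - v) • x + 0) by rw [this]; linarith
    simp only [add_zero, xi, wt, norm_smul, Real.norm_of_nonneg hl.le, mul_pow]
    have hx : 0 < 1 + (s - v)^2 * ‖x‖^2 := by positivity
    field_simp
    linear_combination (-‖x‖^2 * (s - v)) * hs2
  | some i =>
    refine conf_gen hb h2b hp hd one_pos (-(EuclideanSpace.single i v)) hzB (fun x => ?_) hh h0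
    set y := (1:ℝ) • x + -(EuclideanSpace.single i v) with hy
    have hx : x = y + EuclideanSpace.single i v := by rw [hy]; simp
    have hnx : ‖x‖^2 = ‖y‖^2 + 2 * v * y i + v^2 := by
      rw [hx, norm_add_sq_real, EuclideanSpace.inner_single_right]; simp; ring
    have h2 := wt_le y
    have e : 1 * wt y / wt x = 1 + (v * (wt y * y i) + v^2 * wt y / 2) := by
      simp only [wt, hnx]
      have : 0 < 1 + (‖y‖^2 + 2 * v * y i + v^2) := by rw [← hnx]; positivity
      field_simp; ring
    rw [e]
    simp only [xi]
    nlinarith [sq_nonneg v]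

lemma sphW [hn : Fact (3 ≤ n)] : Sph (Pw n) xi n (gam n) where
  hξ := xi_BM
  h1 := xi_h1
  hcard := by simp
  hlt := xi_hlt
  hγ := kk_gam
  hγt := kk_gamt
  conf := fun b hb h2b p hp hd a v _ h hh h0 => conf_all b hb h2b p hp hd a v h hh h0

end

section
variable {n : ℕ}

structure CC (u : EE n → ℝ) : Prop where
  s : ContDiff ℝ (⊤ : ℕ∞) u
  c : HasCompactSupport u

noncomputable def pd (i : Fin n) (u : EE n → ℝ) (x : EE n) : ℝ := fderiv ℝ u x (EuclideanSpace.single i 1)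

noncomputable def lap (u : EE n → ℝ) (x : EE n) : ℝ := ∑ i, pd i (pd i u) x

lemma pd_smooth {u : EE n → ℝ} (hu : ContDiff ℝ (⊤ : ℕ∞) u) (i : Fin n) : ContDiff ℝ (⊤ : ℕ∞) (pd i u) :=
  (hu.fderiv_right (by simp)).clm_apply contDiff_const

namespace CC
variable {u g : EE n → ℝ}
lemma pd (hu : CC u) (i : Fin n) : CC (pd i u) :=
  ⟨pd_smooth hu.s i, hu.c.fderiv_apply ℝ _⟩
lemma cont (hu : CC u) : Continuous u := hu.s.continuous
lemma mul_int (hu : CC u) (hg : Continuous g) : Integrable (fun x => g x * u x) :=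
  (hg.mul hu.cont).integrable_of_hasCompactSupport (hu.c.mul_left)
lemma lap_cont (hu : CC u) : Continuous (lap u) := 
  continuous_finset_sum _ fun i _ => ((hu.pd i).pd i).cont
lemma lap_c (hu : CC u) : HasCompactSupport (lap u) := by
  have : lap u = ∑ i, _root_.pd i (_root_.pd i u) := by funext x; simp [lap]
  rw [this]
  exact Finset.sum_induction (f := fun i => _root_.pd i (_root_.pd i u)) (p := fun f : EE n → ℝ => HasCompactSupport f) (s := Finset.univ)
    (fun _ _ h1 h2 => h1.add h2) HasCompactSupport.zero (fun i _ => ((hu.pd i).pd i).c)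
end CC

lemma ibp {G u : EE n → ℝ} (hG : ContDiff ℝ (⊤ : ℕ∞) G) (hu : CC u) (i : Fin n) :
    ∫ x, G x * pd i u x = - ∫ x, pd i G x * u x :=
  integral_mul_fderiv_eq_neg_fderiv_mul_of_integrable (hu.mul_int (pd_smooth hG i).continuous)
    ((hu.pd i).mul_int hG.continuous) (hu.mul_int hG.continuous)
    (fun x _ => (hG.differentiable (by simp)) x) (fun x _ => (hu.s.differentiable (by simp)) x)

lemma green {G u : EE n → ℝ} (hG : ContDiff ℝ (⊤ : ℕ∞) G) (hu : CC u) :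
    ∫ x, G x * lap u x = ∫ x, lap G x * u x := by
  simp only [lap, Finset.mul_sum, Finset.sum_mul]
  rw [integral_finsetSum _ (fun i _ => ((hu.pd i).pd i).mul_int hG.continuous),
    integral_finsetSum _ (fun i _ => hu.mul_int (pd_smooth (pd_smooth hG i) i).continuous)]
  refine Finset.sum_congr rfl fun i _ => ?_
  rw [ibp hG (hu.pd i), ibp (pd_smooth hG i) hu, neg_neg]

lemma norm_fderiv_sq (L : EE n →L[ℝ] ℝ) : ‖L‖^2 = ∑ i, (L (EuclideanSpace.single i 1))^2 := by
  set g := (InnerProductSpace.toDual ℝ (EE n)).symm L with hg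
  have h1 : ‖L‖ = ‖g‖ := by rw [hg, LinearIsometryEquiv.norm_map]
  rw [h1, ← sum_sq]
  refine Finset.sum_congr rfl fun i _ => ?_
  have := InnerProductSpace.toDual_symm_apply (𝕜 := ℝ) (x := EuclideanSpace.single i (1:ℝ)) (y := L)
  rw [← this, ← hg, EuclideanSpace.inner_single_right]; simp

lemma dirichlet {u : EE n → ℝ} (hu : CC u) : ∫ x, ‖fderiv ℝ u x‖^2 = ∫ x, u x * (- lap u x) := by
  have h1 : ∀ i, ∫ x, pd i u x ^ 2 = ∫ x, u x * - pd i (pd i u) x := by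
    intro i
    have := ibp hu.s (hu.pd i) i
    simp only [mul_neg, integral_neg, this, neg_neg, sq]
  simp only [norm_fderiv_sq, lap, ← Finset.sum_neg_distrib, Finset.mul_sum]
  rw [integral_finsetSum, integral_finsetSum]
  · exact Finset.sum_congr rfl fun i _ => h1 i
  · intro i _
    have := ((hu.pd i).pd i).mul_int hu.cont
    simpa using this.neg
  · intro i _
    have := (hu.pd i).mul_int (hu.pd i).cont
    simp only [sq]; exact this

noncomputable def Gd (δ s : ℝ) (y : EE n) : ℝ := (δ^2 + ‖y‖^2)^(-s)

lemma Gd_smooth {δ : ℝ} (hδ : 0 < δ) (s : ℝ) : ContDiff ℝ (⊤ : ℕ∞) (Gd δ s : EE n → ℝ) := by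
  unfold Gd
  exact ContDiff.rpow_const_of_ne (contDiff_const.add (contDiff_norm_sq ℝ)) (fun x => by positivity)

lemma Gd_fderiv {δ : ℝ} (hδ : 0 < δ) (s : ℝ) (y : EE n) :
    HasFDerivAt (Gd δ s : EE n → ℝ) ((-2 * s * Gd δ (s+1) y) • innerSL ℝ y) y := by
  have h1 : HasFDerivAt (fun y : EE n => δ^2 + ‖y‖^2) (2 • innerSL ℝ y) y :=
    (hasStrictFDerivAt_norm_sq y).hasFDerivAt.const_add (δ^2)
  have h2 := h1.rpow_const (p := -s) (Or.inl (by positivity))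
  refine h2.congr_fderiv ?_
  ext v
  simp only [ContinuousLinearMap.smul_apply, innerSL_apply_apply, smul_eq_mul, nsmul_eq_mul, Gd]
  rw [show -(s+1) = -s - 1 by ring]; push_cast; ring

lemma Gd_pd {δ : ℝ} (hδ : 0 < δ) (s : ℝ) (i : Fin n) (y : EE n) :
    pd i (Gd δ s) y = -2 * s * Gd δ (s+1) y * y i := by
  rw [pd, (Gd_fderiv hδ s y).fderiv]
  simp [EuclideanSpace.inner_single_right]

lemma Gd_pd2 {δ : ℝ} (hδ : 0 < δ) (s : ℝ) (i : Fin n) (y : EE n) :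
    pd i (pd i (Gd δ s)) y = -2 * s * Gd δ (s+1) y + 4 * s * (s+1) * Gd δ (s+2) y * y i ^ 2 := by
  have h1 : pd i (Gd δ s) = fun y : EE n => (-2 * s) * (Gd δ (s+1) y * y i) := by
    funext y; rw [Gd_pd hδ]; ring
  have h2 : HasFDerivAt (fun y : EE n => y i) (EuclideanSpace.proj i : EE n →L[ℝ] ℝ) y :=
    (EuclideanSpace.proj i : EE n →L[ℝ] ℝ).hasFDerivAt
  have h3 : HasFDerivAt (fun y : EE n => (-2 * s) * (Gd δ (s+1) y * y i)) _ y :=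
    ((Gd_fderiv hδ (s+1) y).mul h2).const_mul (-2 * s)
  rw [h1, pd, h3.fderiv]
  simp [EuclideanSpace.inner_single_right]
  rw [show s + 1 + 1 = s + 2 by ring]
  ring

lemma Gd_lap {δ : ℝ} (hδ : 0 < δ) (y : EE n) :
    lap (Gd δ (((n:ℝ) - 2)/2)) y = - (n * (n - 2) * δ^2 * Gd δ (((n:ℝ) + 2)/2) y) := by
  simp only [lap, Gd_pd2 hδ, Finset.sum_add_distrib, Finset.sum_const, ← Finset.mul_sum, sum_sq]
  have h1 : Gd δ (((n:ℝ) - 2)/2 + 1) y = Gd δ (((n:ℝ) + 2)/2) y * (δ^2 + ‖y‖^2) := by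
    unfold Gd
    rw [← Real.rpow_add_one (by positivity)]; congr 1; ring
  rw [h1, show ((n:ℝ) - 2)/2 + 2 = ((n:ℝ)+2)/2 by ring]
  simp
  ring

end

section
variable {n : ℕ}

lemma Gd1_int [hn : Fact (3 ≤ n)] : Integrable (Gd 1 (((n:ℝ) + 2)/2) : EE n → ℝ) ∧
    ∫ y : EE n, Gd 1 (((n:ℝ) + 2)/2) y = cS n / n := by
  have hn0 : (3:ℝ) ≤ n := by exact_mod_cast hn.out
  have h := rad (n := n) (fun r => (1^2 + r^2)^(-(((n:ℝ) + 2)/2))) 1 (n - 1) (-(((n:ℝ) + 2)/2)) (by linarith) (by linarith)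
    (fun r hr => by
      have h1 : r ^ (n - 1) = r ^ ((n:ℝ) - 1) := by
        rw [← Real.rpow_natCast]; congr 1; push_cast [Nat.cast_sub (show 1 ≤ n by have := hn.out; omega)]; ring
      rw [h1]; simp)
  refine ⟨h.1, h.2.trans ?_⟩
  have h2 := JJ_big ((n:ℝ)/2) (by positivity)
  rw [show 2 * ((n:ℝ)/2) - 1 = n - 1 by ring, show -((n:ℝ)/2) - 1 = -(((n:ℝ) + 2)/2) by ring] at h2
  rw [h2]; field_simp

lemma sing_int [hn : Fact (3 ≤ n)] : Integrable (fun y : EE n => (‖y‖^2)^(-(((n:ℝ) - 2)/2)) * (1 + ‖y‖^2)^(-(n:ℝ))) := by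
  have hn0 : (3:ℝ) ≤ n := by exact_mod_cast hn.out
  have h := rad (n := n) (fun r => (r^2)^(-(((n:ℝ) - 2)/2)) * (1 + r^2)^(-(n:ℝ))) 1 1 (-(n:ℝ)) (by linarith) (by linarith)
    (fun r hr => by
      have h1 : r ^ (n - 1) = r ^ ((n:ℝ) - 1) := by
        rw [← Real.rpow_natCast]; congr 1; push_cast [Nat.cast_sub (show 1 ≤ n by have := hn.out; omega)]; ring
      rw [h1, ← Real.rpow_two, ← Real.rpow_mul hr.le, one_mul, ← mul_assoc, ← Real.rpow_add hr]
      congr 2; ring)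
  exact h.1

lemma bdd_decay {g : EE n → ℝ} (hg : Continuous g) (hc : HasCompactSupport g) (s : ℝ) :
    ∃ C, ∀ y, |g y| ≤ C * (1 + ‖y‖^2)^(-s) := by
  have hcont : Continuous (fun y : EE n => (1 + ‖y‖^2)^s * g y) := by
    refine Continuous.mul ?_ hg
    exact (by fun_prop : Continuous fun y : EE n => 1 + ‖y‖^2).rpow_const (fun y => Or.inl (by positivity))
  have hcs : HasCompactSupport ((fun y : EE n => (1 + ‖y‖^2)^s) * g) := hc.mul_left
  obtain ⟨C, hC⟩ := hcs.exists_bound_of_continuous hcont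
  refine ⟨C, fun y => ?_⟩
  have h1 : 0 < (1 + ‖y‖^2)^s := by positivity
  have := hC y
  rw [Pi.mul_apply, norm_mul, Real.norm_of_nonneg h1.le, Real.norm_eq_abs] at this
  rw [Real.rpow_neg (by positivity), ← div_eq_mul_inv, le_div_iff₀ h1]
  linarith

lemma Gd_scale {δ : ℝ} (hδ : 0 < δ) (z : EE n) :
    δ^2 * δ^n * Gd δ (((n:ℝ) + 2)/2) (δ • z) = Gd 1 (((n:ℝ) + 2)/2) z := by
  unfold Gd
  rw [norm_smul, Real.norm_of_nonneg hδ.le, mul_pow, show δ^2 + δ^2 * ‖z‖^2 = δ^2 * (1^2 + ‖z‖^2) by ring,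
    Real.mul_rpow (by positivity) (by positivity), ← mul_assoc]
  have : δ^2 * δ^n * (δ^2)^(-(((n:ℝ) + 2)/2)) = 1 := by
    rw [← Real.rpow_two, ← Real.rpow_mul hδ.le, ← Real.rpow_natCast δ n, ← Real.rpow_add hδ, ← Real.rpow_add hδ]
    rw [← Real.rpow_zero δ]; congr 1; ring
  rw [this, one_mul]

lemma pot_reg [hn : Fact (3 ≤ n)] {u : EE n → ℝ} (hu : CC u) {δ : ℝ} (hδ : 0 < δ) :
    ∫ y, Gd δ (((n:ℝ) - 2)/2) y * lap u y = -(n * (n-2)) * ∫ z, Gd 1 (((n:ℝ) + 2)/2) z * u (δ • z) := by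
  rw [green (Gd_smooth hδ _) hu]
  simp only [Gd_lap hδ]
  have h := int_aff (fun y => -(n * (n - 2) * δ^2 * Gd δ (((n:ℝ) + 2)/2) y) * u y) hδ 0
  have h2 : ∫ y, -(n * (n - 2) * δ^2 * Gd δ (((n:ℝ) + 2)/2) y) * u y =
    δ^n * ∫ y, -(n * (n - 2) * δ^2 * Gd δ (((n:ℝ) + 2)/2) (δ • y + 0)) * u (δ • y + 0) := by
    rw [h]; field_simp
  rw [h2, ← integral_const_mul, ← integral_const_mul]
  congr 1; funext z
  simp only [add_zero]
  rw [← Gd_scale hδ z]; ring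

lemma pot0 [hn : Fact (3 ≤ n)] {u : EE n → ℝ} (hu : CC u) :
    ∫ y, lap u y / ‖y‖^((n:ℝ) - 2) = -((n-2) * cS n) * u 0 := by
  have hn0 : (3:ℝ) ≤ n := by exact_mod_cast hn.out
  have L1 : Filter.Tendsto (fun δ : ℝ => ∫ y, Gd δ (((n:ℝ) - 2)/2) y * lap u y) (nhdsWithin 0 (Set.Ioi 0))
      (nhds (∫ y, lap u y / ‖y‖^((n:ℝ) - 2))) := by
    obtain ⟨C, hC⟩ := bdd_decay hu.lap_cont hu.lap_c n
    refine tendsto_integral_filter_of_dominated_convergence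
      (fun y => C * ((‖y‖^2)^(-(((n:ℝ) - 2)/2)) * (1 + ‖y‖^2)^(-(n:ℝ)))) ?_ ?_ (sing_int.const_mul C) ?_
    · filter_upwards [self_mem_nhdsWithin] with δ hδ
      exact ((Gd_smooth hδ _).continuous.mul hu.lap_cont).aestronglyMeasurable
    · filter_upwards [self_mem_nhdsWithin] with δ hδ
      haveI := nontriv (n := n)
      have : ∀ᵐ y : EE n, y ≠ 0 := by rw [ae_iff]; simp
      filter_upwards [this] with y hy
      have hy0 : 0 < ‖y‖ := norm_pos_iff.mpr hy
      rw [norm_mul, Real.norm_eq_abs, Real.norm_eq_abs]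
      have h1 : |Gd δ (((n:ℝ) - 2)/2) y| ≤ (‖y‖^2)^(-(((n:ℝ) - 2)/2)) := by
        unfold Gd
        rw [abs_of_nonneg (by positivity)]
        exact Real.rpow_le_rpow_of_nonpos (by positivity) (by nlinarith) (by linarith)
      calc _ ≤ (‖y‖^2)^(-(((n:ℝ) - 2)/2)) * (C * (1 + ‖y‖^2)^(-(n:ℝ))) :=
            mul_le_mul h1 (hC y) (abs_nonneg _) (by positivity)
        _ = _ := by ring
    · haveI := nontriv (n := n)
      have : ∀ᵐ y : EE n, y ≠ 0 := by rw [ae_iff]; simp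
      filter_upwards [this] with y hy
      have hy0 : 0 < ‖y‖ := norm_pos_iff.mpr hy
      have h2 : lap u y / ‖y‖^((n:ℝ) - 2) = (0^2 + ‖y‖^2)^(-(((n:ℝ) - 2)/2)) * lap u y := by
        rw [← Real.rpow_two, ← Real.rpow_two, Real.zero_rpow two_ne_zero, zero_add, ← Real.rpow_mul hy0.le,
          show 2 * -(((n:ℝ) - 2)/2) = -(n - 2) by ring, Real.rpow_neg hy0.le]; ring
      rw [h2]
      refine Filter.Tendsto.mul_const _ ?_
      unfold Gd
      refine Filter.Tendsto.rpow_const ?_ (Or.inl (by positivity))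
      refine Filter.Tendsto.add_const _ ?_
      exact ((continuous_pow 2).tendsto (0:ℝ)).mono_left nhdsWithin_le_nhds
  have L2 : Filter.Tendsto (fun δ : ℝ => -(n * ((n:ℝ)-2)) * ∫ z, Gd 1 (((n:ℝ) + 2)/2) z * u (δ • z)) (nhdsWithin 0 (Set.Ioi 0))
      (nhds (-(n * ((n:ℝ)-2)) * ∫ z : EE n, Gd 1 (((n:ℝ) + 2)/2) z * u 0)) := by
    refine Filter.Tendsto.const_mul _ ?_
    obtain ⟨C, hC⟩ := hu.c.exists_bound_of_continuous hu.cont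
    refine tendsto_integral_filter_of_dominated_convergence
      (fun y => Gd 1 (((n:ℝ) + 2)/2) y * C) ?_ ?_ (Gd1_int.1.mul_const C) ?_
    · refine Filter.Eventually.of_forall fun δ => ?_
      have := hu.cont
      exact ((Gd_smooth one_pos _).continuous.mul (by fun_prop)).aestronglyMeasurable
    · refine Filter.Eventually.of_forall fun δ => Filter.Eventually.of_forall fun z => ?_
      have : 0 ≤ Gd 1 (((n:ℝ) + 2)/2) z := by unfold Gd; positivity
      rw [norm_mul, Real.norm_of_nonneg this]
      exact mul_le_mul_of_nonneg_left (hC _) this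
    · refine Filter.Eventually.of_forall fun z => Filter.Tendsto.const_mul _ ?_
      have hc : Continuous (fun δ : ℝ => u (δ • z)) := by have := hu.cont; fun_prop
      have := hc.tendsto 0
      simp only [zero_smul] at this
      exact this.mono_left nhdsWithin_le_nhds
  have e : ∀ᶠ δ : ℝ in nhdsWithin 0 (Set.Ioi 0), ∫ y, Gd δ (((n:ℝ) - 2)/2) y * lap u y = 
      -(n * (n-2)) * ∫ z, Gd 1 (((n:ℝ) + 2)/2) z * u (δ • z) := by
    filter_upwards [self_mem_nhdsWithin] with δ hδ
    exact pot_reg hu hδ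
  have := tendsto_nhds_unique (L1.congr' e) L2
  rw [this, integral_mul_const, Gd1_int.2]
  field_simp

lemma CC.shift {u : EE n → ℝ} (hu : CC u) (a : EE n) : CC (fun y => u (y + a)) :=
  ⟨hu.s.comp (contDiff_id.add contDiff_const), hu.c.comp_homeomorph (Homeomorph.addRight a)⟩

lemma pd_shift (u : EE n → ℝ) (a : EE n) (i : Fin n) : pd i (fun y => u (y + a)) = fun y => pd i u (y + a) := by
  funext y; simp only [pd]; rw [fderiv_comp_add_right]

lemma pot [hn : Fact (3 ≤ n)] {u : EE n → ℝ} (hu : CC u) (x : EE n) :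
    ∫ y, - lap u y / ‖x - y‖^((n:ℝ) - 2) = (n-2) * cS n * u x := by
  have h := pot0 (hu.shift x)
  have e : lap (fun y => u (y + x)) = fun y => lap u (y + x) := by
    funext y; simp only [lap, pd_shift]
  rw [e] at h
  have h2 := integral_add_right_eq_self (μ := (volume : Measure (EE n))) (fun y => lap u y / ‖x - y‖^((n:ℝ) - 2)) x
  simp only [neg_div, integral_neg]
  rw [← h2]
  have : ∀ y, ‖x - (y + x)‖ = ‖y‖ := fun y => by rw [← norm_neg]; congr 1; abel
  simp only [this]
  rw [h]; simp
end

namespace Sph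
variable {X : Type*} [MeasurableSpace X] {P : Measure X} [IsProbabilityMeasure P]
  {ι : Type*} [Fintype ι] {ξ : ι → X → ℝ} {n : ℝ} {γ : ℝ → ℝ} {g h f : X → ℝ} {b p : ℝ}

lemma cauchy (S : Sph P ξ n γ) (hb : 0 < b) (h2b : 2 * b < n) (hf : BM f) (hg : BM g) :
    (∫ z, f z.1 * g z.2 * kk ξ b z ∂(P.prod P))^2 ≤ Qf P (kk ξ b) f * Qf P (kk ξ b) g := by
  have hk := S.kk_int hb h2b
  set B := ∫ z, f z.1 * g z.2 * kk ξ b z ∂(P.prod P) with hB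
  have hB' : ∫ z, g z.1 * f z.2 * kk ξ b z ∂(P.prod P) = B := by
    rw [hB, ← integral_prod_swap]
    refine integral_congr_ae (Filter.Eventually.of_forall fun z => ?_)
    simp only [kk_swap, Prod.fst_swap, Prod.snd_swap]; ring
  have key : ∀ t : ℝ, 0 ≤ Qf P (kk ξ b) g * (t * t) + 2 * B * t + Qf P (kk ξ b) f := by
    intro t
    have h0 := Qk_nonneg (P := P) hb (hf.add (hg.const_mul t)) S.hξ S.h1 S.hlt hk
    have e : Qf P (kk ξ b) (fun x => f x + t * g x) = Qf P (kk ξ b) f + t * B + t * B + t * t * Qf P (kk ξ b) g := by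
      conv_rhs => rw [← hB']
      rw [hB']; nth_rewrite 2 [← hB']
      rw [hB]
      unfold Qf
      rw [← integral_const_mul, ← integral_const_mul, ← integral_const_mul]
      have i1 := (hf.fst.mul hf.snd).mul_integrable hk
      have i2 := ((hf.fst.mul hg.snd).mul_integrable hk).const_mul t
      have i3 := ((hg.fst.mul hf.snd).mul_integrable hk).const_mul t
      have i4 := ((hg.fst.mul hg.snd).mul_integrable hk).const_mul (t * t)
      have i12 : Integrable (fun z : X × X => f z.1 * f z.2 * kk ξ b z + t * (f z.1 * g z.2 * kk ξ b z)) (P.prod P) := i1.add i2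
      have i123 : Integrable (fun z : X × X => f z.1 * f z.2 * kk ξ b z + t * (f z.1 * g z.2 * kk ξ b z) +
        t * (g z.1 * f z.2 * kk ξ b z)) (P.prod P) := i12.add i3
      rw [← integral_add i1 i2, ← integral_add i12 i3, ← integral_add i123 i4]
      refine integral_congr_ae (Filter.Eventually.of_forall fun z => ?_)
      simp only []; ring
    rw [e] at h0
    linarith
  have := discrim_le_zero key
  unfold discrim at this
  nlinarith

lemma Q_le_abs (S : Sph P ξ n γ) (hb : 0 < b) (h2b : 2 * b < n) (hf : BM f) (hf' : BM (fun x => |f x|)) :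
    Qf P (kk ξ b) f ≤ Qf P (kk ξ b) (fun x => |f x|) := by
  have hk := S.kk_int hb h2b
  unfold Qf
  refine integral_mono ((hf.fst.mul hf.snd).mul_integrable hk) ((hf'.fst.mul hf'.snd).mul_integrable hk) fun z => ?_
  refine mul_le_mul_of_nonneg_right ?_ (S.kk_nonneg b z)
  rw [← abs_mul]; exact le_abs_self _

end Sph

section
variable {n : ℕ}

lemma BM.abs' {X : Type*} [MeasurableSpace X] {f : X → ℝ} (hf : BM f) : BM (fun x => |f x|) := by
  obtain ⟨F, hF⟩ := hf.bdd
  exact ⟨hf.meas.norm, F, fun x => by rw [abs_abs]; exact hF x⟩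

lemma BM_cc {g : EE n → ℝ} (hg : Continuous g) (hc : HasCompactSupport g) (s : ℝ) :
    BM (fun x => g x * wt x ^ s) := by
  have hcont : Continuous (fun x : EE n => g x * wt x ^ s) :=
    hg.mul (wt_cont.rpow_const fun x => Or.inl (wt_pos x).ne')
  have hcs : HasCompactSupport (g * fun x : EE n => wt x ^ s) := hc.mul_right
  obtain ⟨C, hC⟩ := hcs.exists_bound_of_continuous hcont
  exact ⟨hcont.measurable, C, fun x => by simpa using hC x⟩

lemma B_eq_D [hn : Fact (3 ≤ n)] {b : ℝ} (hb : 0 < b) (h2b : 2 * b < n) {h g : EE n → ℝ} (hh : BM h) (hg : BM g) :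
    ∫ z, h z.1 * g z.2 * kk xi b z ∂((Pw n).prod (Pw n)) = 2^b / Mw n ^ 2 * 
      ∫ x, ∫ y, (h x * wt x ^ ((n:ℝ) - b)) * (g y * wt y ^ ((n:ℝ) - b)) / ‖x - y‖ ^ (2 * b) := by
  rw [integral_prod _ ((hh.fst.mul hg.snd).mul_integrable (kk_intP hb h2b))]
  rw [Pw_integral]
  simp only [Pw_integral]
  rw [← integral_const_mul, ← integral_const_mul]
  congr 1; funext x
  rw [← integral_const_mul, ← integral_const_mul, ← integral_const_mul, ← integral_const_mul]
  congr 1; funext y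
  rw [kk_eq2, Real.rpow_sub (wt_pos x), Real.rpow_sub (wt_pos y), Real.rpow_natCast, Real.rpow_natCast,
    Real.rpow_neg (wt_pos x).le, Real.rpow_neg (wt_pos y).le]
  have := (Mw_pos (n := n))
  field_simp

lemma wt_cancel (s c : ℝ) (x : EE n) : c * wt x ^ (-s) * wt x ^ s = c := by
  rw [mul_assoc, ← Real.rpow_add (wt_pos x)]; simp

lemma hls [hn : Fact (3 ≤ n)] {b : ℝ} (hb : 0 < b) (h2b : 2 * b < n) {g : EE n → ℝ} (hg : Continuous g)
    (hc : HasCompactSupport g) (h0 : ∀ x, 0 ≤ g x) :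
    Qf (Pw n) (kk xi b) (fun x => g x * wt x ^ (-((n:ℝ) - b))) ≤
      gam n b * ((Mw n)⁻¹ * ∫ x, g x ^ (n / ((n:ℝ) - b)))^(2 / (n / ((n:ℝ) - b))) := by
  have hn0 : (3:ℝ) ≤ n := by exact_mod_cast hn.out
  have hnb : 0 < (n:ℝ) - b := by linarith
  have := sphW.sharpHLS hb h2b (BM_cc hg hc (-((n:ℝ) - b))) 
    (fun x => mul_nonneg (h0 x) (Real.rpow_nonneg (wt_pos x).le _))
  refine this.trans_eq ?_
  congr 2
  rw [Pw_integral]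
  congr 2
  funext x
  have h1 := wt_pos x
  rw [Real.mul_rpow (h0 x) (Real.rpow_nonneg h1.le _), ← Real.rpow_mul h1.le,
    show -((n:ℝ) - b) * (n / (n - b)) = -n by field_simp, Real.rpow_neg h1.le, Real.rpow_natCast]
  field_simp

lemma gam_b0 [hn : Fact (3 ≤ n)] : gam n (((n:ℝ) - 2)/2) = (Mw n)⁻¹ * (cS n * (2^(((n:ℝ)+2)/2) / n)) := by
  have hn0 : (3:ℝ) ≤ n := by exact_mod_cast hn.out
  have h := JJ_one ((n:ℝ)/2) (by positivity)
  unfold gam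
  rw [show (n:ℝ) - 1 - 2 * ((n - 2)/2) = 1 by ring, show ((n:ℝ) - 2)/2 - n = -((n:ℝ)/2) - 1 by ring,
    h, show (n:ℝ) - (n - 2)/2 = (n+2)/2 by ring]
  field_simp

lemma abs_rpow_mul_sq {T : ℝ} (hT : 2 < T) (a : ℝ) : |a|^(T-2) * a * a = |a|^T := by
  rcases eq_or_ne a 0 with rfl | h
  · simp [Real.zero_rpow (by linarith : T ≠ 0)]
  · have : |a|^T = |a|^(T-2) * |a|^(2:ℝ) := by rw [← Real.rpow_add (abs_pos.mpr h)]; congr 1; ring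
    rw [this, Real.rpow_two, sq_abs]; ring

lemma abs_abs_rpow_mul {T : ℝ} (hT : 2 < T) (a : ℝ) : |(|a|^(T-2) * a)| = |a|^(T-1) := by
  rcases eq_or_ne a 0 with rfl | h
  · simp [Real.zero_rpow (by linarith : T - 1 ≠ 0)]
  · rw [abs_mul, abs_of_nonneg (by positivity), ← Real.rpow_add_one (abs_pos.mpr h).ne']; congr 1; ring

set_option maxHeartbeats 1000000 in
lemma sob [hn : Fact (3 ≤ n)] {u : EE n → ℝ} (hu : CC u) :
    n * ((n:ℝ)-2) / 4 * Mw n * ((Mw n)⁻¹ * ∫ x, |u x| ^ (2 * n / ((n:ℝ)-2)))^(((n:ℝ)-2)/n) ≤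
      ∫ x, ‖fderiv ℝ u x‖^2 := by
  have hn0 : (3:ℝ) ≤ n := by exact_mod_cast hn.out
  have hM := Mw_pos (n := n)
  have hcS := cS_pos (n := n)
  have hb : 0 < ((n:ℝ)-2)/2 := by linarith
  have h2b : 2 * (((n:ℝ)-2)/2) < n := by linarith
  set b : ℝ := ((n:ℝ)-2)/2 with hbd
  have h2b' : 2 * b = n - 2 := by rw [hbd]; ring
  set T : ℝ := 2 * n / ((n:ℝ)-2) with hT
  have hn2 : (0:ℝ) < n - 2 := by linarith
  have hT2 : 2 < T := by rw [hT, lt_div_iff₀ hn2]; linarith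
  set s : ℝ := (n:ℝ) - b with hs
  have hsv : s = (n+2)/2 := by rw [hs, hbd]; ring
  have hTs : (T - 1) * (n / s) = T := by rw [hT, hsv]; field_simp; ring
  set f : EE n → ℝ := fun x => |u x|^(T-2) * u x with hf
  have hfc : Continuous f := (hu.cont.abs.rpow_const fun x => Or.inr (by linarith)).mul hu.cont
  have hfs : HasCompactSupport f := hu.c.mul_left
  set φ : EE n → ℝ := fun x => - lap u x with hφ
  have hφc : Continuous φ := hu.lap_cont.neg
  have hφs : HasCompactSupport φ := hu.lap_c.neg
  have B1 := BM_cc hfc hfs (-s)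
  have B2 := BM_cc hφc hφs (-s)
  have cs := sphW.cauchy hb h2b B1 B2
  rw [B_eq_D hb h2b B1 B2] at cs
  have e2 : Qf (Pw n) (kk xi b) (fun x => φ x * wt x ^ (-s)) = 2^b / Mw n ^ 2 * 
      ∫ x, ∫ y, (φ x * wt x ^ (-s) * wt x ^ s) * (φ y * wt y ^ (-s) * wt y ^ s) / ‖x - y‖ ^ (2 * b) :=
    B_eq_D hb h2b B2 B2
  rw [e2] at cs
  simp only [← hs, wt_cancel, h2b', mul_div_assoc (f _), mul_div_assoc (φ _), integral_const_mul] at cs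
  have hpot : ∀ x, ∫ y, φ y / ‖x - y‖^((n:ℝ)-2) = (n-2) * cS n * u x := fun x => pot hu x
  simp only [hpot] at cs
  set N := ∫ x, |u x|^T with hN
  set E := ∫ x, ‖fderiv ℝ u x‖^2 with hE
  have i1 : ∫ x, f x * ((n-2) * cS n * u x) = (n-2) * cS n * N := by
    rw [hN, ← integral_const_mul]; congr 1; funext x
    rw [← abs_rpow_mul_sq hT2 (u x)]; simp only [hf]; ring
  have i2 : ∫ x, φ x * ((n-2) * cS n * u x) = (n-2) * cS n * E := by
    rw [hE, dirichlet hu, ← integral_const_mul]; congr 1; funext x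
    simp only [hφ]; ring
  rw [i1, i2] at cs
  have hq1 := sphW.Q_le_abs hb h2b B1 B1.abs'
  have e3 : (fun x => |f x * wt x ^ (-s)|) = fun x => |u x|^(T-1) * wt x ^ (-s) := by
    funext x
    rw [abs_mul, abs_of_nonneg (Real.rpow_nonneg (wt_pos x).le _)]
    simp only [hf]
    rw [abs_abs_rpow_mul hT2]
  have hgc : Continuous (fun x => |u x|^(T-1)) := hu.cont.abs.rpow_const fun x => Or.inr (by linarith)
  have hgs : HasCompactSupport (fun x => |u x|^(T-1)) := by
    refine hu.c.comp_left (g := fun a : ℝ => |a|^(T-1)) ?_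
    simp [Real.zero_rpow (by linarith : T - 1 ≠ 0)]
  have hl := hls hb h2b hgc hgs (fun x => by positivity)
  rw [e3] at hq1
  have hq2 := hq1.trans hl
  have e4 : ∫ x, (|u x|^(T-1))^(n / ((n:ℝ) - b)) = N := by
    rw [hN]; congr 1; funext x
    rw [← Real.rpow_mul (abs_nonneg _), ← hs, hTs]
  rw [e4, gam_b0, ← hs] at hq2
  have hN0 : 0 ≤ N := integral_nonneg fun x => by positivity
  have hE0 : 0 ≤ E := integral_nonneg fun x => by positivity
  set Y := (Mw n)⁻¹ * N with hY
  have hNY : N = Mw n * Y := by rw [hY]; field_simp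
  rcases hN0.eq_or_lt with h0 | h0
  · have : Y = 0 := by rw [hY, ← h0]; simp
    rw [this, Real.zero_rpow (by positivity)]; simpa using hE0
  have hYp : 0 < Y := by positivity
  have hexp : 2 / ((n:ℝ) / s) = 2 - (n-2)/n := by rw [hsv]; field_simp; ring
  have h22 : (2:ℝ)^(((n:ℝ)+2)/2) = 2^b * 4 := by
    rw [show ((n:ℝ)+2)/2 = b + 2 by rw [hbd]; ring, Real.rpow_add two_pos]; norm_num
  rw [hexp, Real.rpow_sub hYp, h22, Real.rpow_two] at hq2
  have hZ : 0 < Y ^ (((n:ℝ)-2)/n) := Real.rpow_pos_of_pos hYp _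
  set Z := Y ^ (((n:ℝ)-2)/n) with hZd
  have h2p : (0:ℝ) < 2^b := Real.rpow_pos_of_pos two_pos b
  set K := (2:ℝ)^b with hK
  have c2 := cs.trans (mul_le_mul_of_nonneg_right hq2 (by positivity))
  rw [hNY] at c2
  -- algebra
  have c3 : (K / Mw n ^ 2 * ((n - 2) * cS n * (Mw n * Y)))^2 = (K * cS n * (n-2) / Mw n)^2 * Y^2 := by
    field_simp
  have c4 : (Mw n)⁻¹ * (cS n * (K * 4 / n)) * (Y^2 / Z) * (K / Mw n ^ 2 * ((n - 2) * cS n * E)) =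
     (K * cS n * (n-2) / Mw n)^2 * Y^2 * (4 * E / (n * (n - 2) * Mw n * Z)) := by
    field_simp
  rw [c3, c4] at c2
  have c5 : 1 ≤ 4 * E / (n * (n - 2) * Mw n * Z) := by
    by_contra hlt
    push Not at hlt
    have : 0 < (K * cS n * (n-2) / Mw n)^2 * Y^2 := by positivity
    nlinarith
  rw [le_div_iff₀ (by positivity)] at c5
  linarith
end

section
variable {n : ℕ}

lemma pow_pred (hn : 3 ≤ n) {r : ℝ} : r ^ (n - 1) = r ^ ((n:ℝ) - 1) := by
  rw [← Real.rpow_natCast]; congr 1; push_cast [Nat.cast_sub (show 1 ≤ n by omega)]; ring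

lemma JJ_nn [hn : Fact (3 ≤ n)] : n * JJ (n - 1) (-n) = (n - 2) * JJ (n + 1) (-n) := by
  have hn0 : (3:ℝ) ≤ n := by exact_mod_cast hn.out
  have h := JJ_ftc (σ := n) (β := 1 - n) (by linarith) (by linarith)
  rw [show (1:ℝ) - n - 1 = -n by ring] at h
  have e : JJ (n - 1) (1 - n) = JJ (n - 1) (-n) + JJ (n + 1) (-n) := by
    unfold JJ
    rw [← integral_add (JJ_int (by linarith) (by linarith)) (JJ_int (by linarith) (by linarith))]
    refine setIntegral_congr_fun measurableSet_Ioi fun r hr => ?_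
    have hr0 : (0:ℝ) < r := hr
    rw [show (1:ℝ) - n = -n + 1 by ring, Real.rpow_add_one (by positivity),
      show (n:ℝ) + 1 = (n - 1) + 2 by ring, Real.rpow_add hr0, Real.rpow_two]
    ring
  rw [e] at h
  linarith

lemma Mw_eq [hn : Fact (3 ≤ n)] : Mw n = cS n * (2^n * JJ (n - 1) (-n)) := by
  have hn0 : (3:ℝ) ≤ n := by exact_mod_cast hn.out
  refine (rad (n := n) (fun r => (2 / (1 + r^2))^n) (2^n) (n-1) (-n) (by linarith) (by linarith) (fun r hr => ?_)).2
  rw [pow_pred hn.out, div_pow, Real.rpow_neg (by positivity), Real.rpow_natCast]; ring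

lemma FF_int [hn : Fact (3 ≤ n)] : Integrable (fun y : EE n => ‖y‖^2 * (1 + ‖y‖^2)^(-(n:ℝ))) ∧
    ∫ y : EE n, ‖y‖^2 * (1 + ‖y‖^2)^(-(n:ℝ)) = n / ((n:ℝ) - 2) * Mw n / 2^n := by
  have hn0 : (3:ℝ) ≤ n := by exact_mod_cast hn.out
  have h := rad (n := n) (fun r => r^2 * (1 + r^2)^(-(n:ℝ))) 1 (n+1) (-n) (by linarith) (by linarith) (fun r hr => by
    rw [pow_pred hn.out, show (n:ℝ) + 1 = (n - 1) + 2 by ring, Real.rpow_add hr, Real.rpow_two]; ring)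
  refine ⟨h.1, h.2.trans ?_⟩
  rw [Mw_eq]
  have h1 := JJ_nn (n := n)
  have : (n:ℝ) - 2 ≠ 0 := by linarith
  field_simp
  linear_combination (-cS n) * h1

lemma Gd_grad_sq {ε : ℝ} (hε : 0 < ε) (y : EE n) :
    ‖fderiv ℝ (Gd ε (((n:ℝ)-2)/2)) y‖^2 = ((n:ℝ)-2)^2 * (ε^2 + ‖y‖^2)^(-(n:ℝ)) * ‖y‖^2 := by
  rw [(Gd_fderiv hε _ y).fderiv, norm_smul, mul_pow, innerSL_apply_norm, Real.norm_eq_abs, sq_abs, mul_pow, Gd,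
    ← Real.rpow_natCast ((ε^2 + ‖y‖^2)^(-(((n:ℝ)-2)/2 + 1))) 2, ← Real.rpow_mul (by positivity)]
  rw [show -(((n:ℝ)-2)/2 + 1) * ((2:ℕ):ℝ) = -n by push_cast; ring]
  ring

lemma Gd_grad_scale {ε : ℝ} (hε : 0 < ε) (y : EE n) :
    ‖fderiv ℝ (Gd ε (((n:ℝ)-2)/2)) y‖^2 = ((n:ℝ)-2)^2 * (ε^2 * (ε^(2*n))⁻¹) *
      (‖ε⁻¹ • y + 0‖^2 * (1 + ‖ε⁻¹ • y + 0‖^2)^(-(n:ℝ))) := by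
  rw [Gd_grad_sq hε, add_zero, norm_smul, norm_inv, Real.norm_of_nonneg hε.le]
  have : ε^2 + ‖y‖^2 = ε^2 * (1 + (ε⁻¹ * ‖y‖)^2) := by field_simp
  rw [this, Real.mul_rpow (by positivity) (by positivity), Real.rpow_neg (by positivity) (n:ℝ), Real.rpow_natCast, ← pow_mul]
  field_simp

lemma Gd_energy [hn : Fact (3 ≤ n)] {ε : ℝ} (hε : 0 < ε) :
    Integrable (fun y : EE n => ‖fderiv ℝ (Gd ε (((n:ℝ)-2)/2)) y‖^2) ∧
    ∫ y : EE n, ‖fderiv ℝ (Gd ε (((n:ℝ)-2)/2)) y‖^2 = (ε^(n-2))⁻¹ * (n * ((n:ℝ)-2) * Mw n / 2^n) := by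
  have hn0 : (3:ℝ) ≤ n := by exact_mod_cast hn.out
  have hn2 : (n:ℝ) - 2 ≠ 0 := by linarith
  simp only [Gd_grad_scale hε]
  constructor
  · refine Integrable.const_mul ?_ _
    simp only [add_zero]
    exact (FF_int (n := n)).1.comp_smul (inv_ne_zero hε.ne')
  · rw [integral_const_mul, int_aff (fun y : EE n => ‖y‖^2 * (1 + ‖y‖^2)^(-(n:ℝ))) (inv_pos.mpr hε) 0, FF_int.2]
    obtain ⟨m, rfl⟩ : ∃ m, n = m + 2 := ⟨n - 2, by have := hn.out; omega⟩
    rw [show m + 2 - 2 = m by omega, inv_pow, inv_inv]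
    field_simp
    ring
end

section
variable {n : ℕ}

lemma Q_pos [hn : Fact (3 ≤ n)] {b : ℝ} (hb : 0 < b) (h2b : 2 * b < n) {h : EE n → ℝ} (hh : BM h)
    (h0 : ∀ x, 0 ≤ h x) (hi : 0 < ∫ x, h x ∂(Pw n)) : 0 < Qf (Pw n) (kk xi b) h := by
  have h1 : ∫ z, h z.1 * h z.2 * (2:ℝ)^(-b) ∂((Pw n).prod (Pw n)) ≤ Qf (Pw n) (kk xi b) h := by
    unfold Qf
    refine integral_mono_ae (((hh.fst.mul hh.snd).mul (BM.const _)).integrable _) 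
      ((hh.fst.mul hh.snd).mul_integrable (kk_intP hb h2b)) ?_
    filter_upwards [xi_hlt] with z hz
    refine mul_le_mul_of_nonneg_left ?_ (mul_nonneg (h0 _) (h0 _))
    have h2 := (abs_le.mp (tk_abs_le xi_h1 z)).1
    exact Real.rpow_le_rpow_of_nonpos (by linarith) (by linarith) (by linarith)
  refine lt_of_lt_of_le ?_ h1
  rw [integral_mul_const, integral_prod_mul]
  positivity

lemma gam_pos [hn : Fact (3 ≤ n)] {b : ℝ} (hb : 0 < b) (h2b : 2 * b < n) : 0 < gam n b := by
  have := Mw_pos (n := n)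
  have := cS_pos (n := n)
  have := JJ_pos (α := n - 1 - 2 * b) (β := b - n) (by linarith) (by linarith)
  unfold gam; positivity

noncomputable def SV (n : ℕ) (μ : ℝ) : ℝ :=
  n * ((n:ℝ)-2) / 4 * Mw n / (2^(-(μ/2)) * Mw n ^ 2 * gam n (μ/2))^(((n:ℝ) - 2) / (2 * (n : ℝ) - μ))

lemma quot [hn : Fact (3 ≤ n)] {μ : ℝ} (hμ : 0 < μ) (hμn : μ < n) {u : EE n → ℝ} (hu : CC u) (hu0 : u ≠ 0) :
    SV n μ ≤ (∫ x, ‖fderiv ℝ u x‖ ^ 2) /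
        (∫ x, ∫ y, |u x| ^ ((2 * (n : ℝ) - μ) / ((n : ℝ) - 2)) *
            |u y| ^ ((2 * (n : ℝ) - μ) / ((n : ℝ) - 2)) / ‖x - y‖ ^ μ) ^
          (((n : ℝ) - 2) / (2 * (n : ℝ) - μ)) := by
  have hn0 : (3:ℝ) ≤ n := by exact_mod_cast hn.out
  have hM := Mw_pos (n := n)
  have hn2 : (0:ℝ) < n - 2 := by linarith
  have h2n : (0:ℝ) < 2 * n - μ := by linarith
  have hb : 0 < μ/2 := by linarith
  have h2b : 2 * (μ/2) < n := by linarith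
  set b := μ/2 with hbd
  have hμb : μ = 2 * b := by rw [hbd]; ring
  set p := (2 * (n : ℝ) - μ) / ((n : ℝ) - 2) with hp
  have hp0 : 0 < p := by positivity
  have hnb : 0 < (n:ℝ) - b := by linarith
  set g : EE n → ℝ := fun x => |u x|^p with hg
  have hgc : Continuous g := hu.cont.abs.rpow_const fun x => Or.inr hp0.le
  have hgs : HasCompactSupport g := by
    refine hu.c.comp_left (g := fun a : ℝ => |a|^p) ?_
    simp [Real.zero_rpow hp0.ne']
  have hg0 : ∀ x, 0 ≤ g x := fun x => by positivity
  have hB := BM_cc hgc hgs (-((n:ℝ) - b))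
  change SV n μ ≤ _ / (Dd μ g) ^ _
  set D := Dd μ g with hD
  have eQ := Q_eq_D hb h2b hB
  simp only [wt_cancel] at eQ
  rw [← hμb] at eQ
  change _ = 2^b / Mw n^2 * D at eQ
  have h2p : (0:ℝ) < 2^b := Real.rpow_pos_of_pos two_pos b
  have hDQ : D = 2^(-b) * Mw n^2 * Qf (Pw n) (kk xi b) (fun x => g x * wt x ^ (-((n:ℝ) - b))) := by
    rw [eQ, Real.rpow_neg two_pos.le]; field_simp
  have hQp : 0 < Qf (Pw n) (kk xi b) (fun x => g x * wt x ^ (-((n:ℝ) - b))) := by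
    refine Q_pos hb h2b hB (fun x => mul_nonneg (hg0 x) (Real.rpow_nonneg (wt_pos x).le _)) ?_
    rw [Pw_integral]
    refine mul_pos (by positivity) ?_
    obtain ⟨x0, hx0⟩ : ∃ x, u x ≠ 0 := by
      by_contra hc; push Not at hc; exact hu0 (funext hc)
    refine Continuous.integral_pos_of_hasCompactSupport_nonneg_nonzero (x := x0) ?_ ?_ ?_ ?_
    · exact (wt_cont.pow n).mul (hgc.mul (wt_cont.rpow_const fun x => Or.inl (wt_pos x).ne'))
    · exact HasCompactSupport.mul_left (hgs.mul_right)
    · intro x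
      exact mul_nonneg (pow_nonneg (wt_pos x).le _) (mul_nonneg (hg0 x) (Real.rpow_nonneg (wt_pos x).le _))
    · have h1 := wt_pos x0
      have h2 : 0 < g x0 := Real.rpow_pos_of_pos (abs_pos.mpr hx0) p
      have h3 := Real.rpow_pos_of_pos h1 (-((n:ℝ) - b))
      positivity
  have hDp : 0 < D := by rw [hDQ]; positivity
  have hl := hls hb h2b hgc hgs hg0
  have e4 : ∫ x, g x ^(n / ((n:ℝ) - b)) = ∫ x, |u x| ^ (2 * n / ((n:ℝ)-2)) := by
    congr 1; funext x
    simp only [hg]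
    rw [← Real.rpow_mul (abs_nonneg _)]; congr 1
    have h22 : (2:ℝ) * n - 2 * b ≠ 0 := by linarith
    rw [hp, hμb]; field_simp
  rw [e4] at hl
  set Y := (Mw n)⁻¹ * ∫ x, |u x| ^ (2 * n / ((n:ℝ)-2)) with hY
  have hY0 : 0 ≤ Y := mul_nonneg (by positivity) (integral_nonneg fun x => by positivity)
  have hs := sob hu
  rw [← hY] at hs
  have hγ := gam_pos (n := n) hb h2b
  set Γ := 2^(-b) * Mw n ^ 2 * gam n b with hΓ
  have hΓ0 : 0 < Γ := by rw [hΓ]; positivity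
  have hDΓ : D ≤ Γ * Y^(2 / (n / ((n:ℝ) - b))) := by
    rw [hDQ, hΓ, mul_assoc _ (gam n b)]
    exact mul_le_mul_of_nonneg_left hl (by positivity)
  set e := ((n:ℝ) - 2) / (2 * (n : ℝ) - μ) with he
  have he0 : 0 < e := by positivity
  have hDe : D ^ e ≤ Γ ^ e * Y^(((n:ℝ)-2)/n) := by
    refine (Real.rpow_le_rpow hDp.le hDΓ he0.le).trans_eq ?_
    rw [Real.mul_rpow hΓ0.le (Real.rpow_nonneg hY0 _), ← Real.rpow_mul hY0]
    congr 2
    have h22 : (2:ℝ) * n - 2 * b ≠ 0 := by linarith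
    rw [he, hμb]; field_simp
  have hDe0 : 0 < D ^ e := Real.rpow_pos_of_pos hDp _
  have hΓe : 0 < Γ ^ e := Real.rpow_pos_of_pos hΓ0 _
  rw [le_div_iff₀ hDe0]
  refine le_trans ?_ hs
  unfold SV
  rw [← hbd, ← hΓ, ← he]
  rw [div_mul_eq_mul_div, div_le_iff₀ hΓe, mul_assoc _ _ (Γ^e)]
  refine mul_le_mul_of_nonneg_left ?_ (by positivity)
  linarith

lemma SV_pos [hn : Fact (3 ≤ n)] {μ : ℝ} (hμ : 0 < μ) (hμn : μ < n) : 0 < SV n μ := by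
  have hn0 : (3:ℝ) ≤ n := by exact_mod_cast hn.out
  have hM := Mw_pos (n := n)
  have hn2 : (0:ℝ) < n - 2 := by linarith
  have hγ := gam_pos (n := n) (b := μ/2) (by linarith) (by linarith)
  unfold SV; positivity

end

section
variable {n : ℕ}

lemma Q_bd [hn : Fact (3 ≤ n)] {b : ℝ} (hb : 0 < b) (h2b : 2 * b < n) {h : EE n → ℝ} (hh : BM h)
    (h0 : ∀ x, 0 ≤ h x) (h1 : ∀ x, h x ≤ 1) : Qf (Pw n) (kk xi b) h ≤ gam n b ∧
    gam n b - 2 * gam n b * (∫ x, (1 - h x) ∂(Pw n)) ≤ Qf (Pw n) (kk xi b) h := by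
  have S := sphW (n := n)
  have hk := kk_intP (n := n) hb h2b
  have hhk := (hh.fst.mul hh.snd).mul_integrable hk
  have eQ := S.Q_const hb h2b
  unfold Qf at eQ ⊢
  have h1k : Integrable (fun z : EE n × EE n => 1 * 1 * kk xi b z) ((Pw n).prod (Pw n)) := by
    simpa using hk
  constructor
  · rw [← eQ]
    refine integral_mono hhk h1k fun z => ?_
    refine mul_le_mul_of_nonneg_right ?_ (S.kk_nonneg b z)
    have := mul_le_mul (h1 z.1) (h1 z.2) (h0 _) zero_le_one
    simpa using this
  · have hg : BM (fun x => 1 - h x) := (BM.const 1).sub hh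
    have e1 := S.int_fst hb h2b hg
    have e2 := S.int_snd hb h2b hg
    have i1 := hg.fst.mul_integrable hk
    have i2 := hg.snd.mul_integrable hk
    have : gam n b - 2 * gam n b * (∫ x, (1 - h x) ∂(Pw n)) =
        ∫ z, (1 * 1 * kk xi b z - (((1 - h z.1) * kk xi b z) + ((1 - h z.2) * kk xi b z))) ∂((Pw n).prod (Pw n)) := by
      have hs := integral_sub h1k (i1.add i2)
      have ha := integral_add i1 i2
      simp only [Pi.add_apply] at hs
      rw [hs, ha, e1, e2, eQ]; ring
    rw [this]
    refine integral_mono (h1k.sub (i1.add i2)) hhk fun z => ?_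
    have hz := S.kk_nonneg b z
    have : 0 ≤ (1 - h z.1) * (1 - h z.2) * kk xi b z :=
      mul_nonneg (mul_nonneg (by linarith [h1 z.1]) (by linarith [h1 z.2])) hz
    simp only [Pi.sub_apply, Pi.add_apply]
    linarith

lemma tail_bd [hn : Fact (3 ≤ n)] {r ε p : ℝ} (hr : 0 < r) (hε : 0 < ε) (hp : 0 < p) {ψ : EE n → ℝ} 
    (hψ0 : ∀ x, 0 ≤ ψ x) (hψ1 : ∀ x, ψ x ≤ 1)
    (hψin : ∀ x ∈ Metric.ball (0 : EE n) r, ψ x = 1) :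
    ∫ x, (1 - ψ (ε • x) ^ p) ∂(Pw n) ≤ ((1 + r^2)/r^2)^n * ε^n := by
  have hM := Mw_pos (n := n)
  rw [Pw_integral]
  set g : EE n → ℝ := fun x => wt (ε⁻¹ • x)^n * (1 - ψ x ^ p) with hg
  have e : ∫ x, wt x ^ n * (1 - ψ (ε • x) ^ p) = (ε^n)⁻¹ * ∫ x, g x := by
    rw [← int_aff g hε 0]
    congr 1; funext x
    simp only [hg, add_zero, smul_smul, inv_mul_cancel₀ hε.ne', one_smul]
  rw [e]
  set Cr := (1 + r^2)/r^2 with hCr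
  have hCr0 : 0 < Cr := by positivity
  have hpt : ∀ x, g x ≤ (ε^2 * Cr)^n * wt x ^ n := by
    intro x
    have w0 := wt_pos x
    by_cases hx : x ∈ Metric.ball (0 : EE n) r
    · simp only [hg, hψin x hx, Real.one_rpow, sub_self, mul_zero]; positivity
    · have hx' : r ≤ ‖x‖ := by simpa using hx
      have hx2 : r^2 ≤ ‖x‖^2 := pow_le_pow_left₀ hr.le hx' 2
      have h1 : wt (ε⁻¹ • x) ≤ ε^2 * Cr * wt x := by
        unfold wt
        rw [norm_smul, norm_inv, Real.norm_of_nonneg hε.le]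
        have e1 : 2 / (1 + (ε⁻¹ * ‖x‖)^2) = 2 * ε^2 / (ε^2 + ‖x‖^2) := by field_simp
        rw [e1, hCr]
        have e2 : ε^2 * ((1 + r^2)/r^2) * (2 / (1 + ‖x‖^2)) = 2 * ε^2 * (1 + r^2) / (r^2 * (1 + ‖x‖^2)) := by
          field_simp
        rw [e2, div_le_div_iff₀ (by positivity) (by positivity)]
        have : r^2 * (1 + ‖x‖^2) ≤ (1 + r^2) * (ε^2 + ‖x‖^2) := by nlinarith [sq_nonneg ε, sq_nonneg (r*ε)]
        have h2 : 0 ≤ 2 * ε^2 := by positivity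
        nlinarith [mul_le_mul_of_nonneg_left this h2]
      have h2 : wt (ε⁻¹ • x)^n ≤ (ε^2 * Cr * wt x)^n := pow_le_pow_left₀ (wt_pos _).le h1 n
      rw [← mul_pow]
      refine le_trans ?_ h2
      refine mul_le_of_le_one_right (pow_nonneg (wt_pos _).le _) ?_
      have := Real.rpow_nonneg (hψ0 x) p
      linarith
  have hI : ∫ x, g x ≤ ∫ x : EE n, (ε^2 * Cr)^n * wt x ^ n := by
    refine integral_mono_of_nonneg (Filter.Eventually.of_forall fun x => ?_) (int_wtn.const_mul _) (Filter.Eventually.of_forall hpt)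
    refine mul_nonneg (pow_nonneg (wt_pos _).le _) ?_
    have := Real.rpow_le_one (hψ0 x) (hψ1 x) hp.le
    linarith
  rw [integral_const_mul] at hI
  change _ ≤ _ * Mw n at hI
  calc (Mw n)⁻¹ * ((ε^n)⁻¹ * ∫ x, g x) ≤ (Mw n)⁻¹ * ((ε^n)⁻¹ * ((ε^2 * Cr)^n * Mw n)) := by gcongr
    _ = Cr^n * ε^n := by
      rw [mul_pow, ← pow_mul, mul_comm 2 n, pow_mul]; field_simp

lemma D_bub [hn : Fact (3 ≤ n)] {μ c ε : ℝ} (hμ : 0 < μ) (hμn : μ < n) (hc : 0 < c) (hε : 0 < ε)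
    {ψ : EE n → ℝ} (hψs : Continuous ψ) (hψ0 : ∀ x, 0 ≤ ψ x) (hψ1 : ∀ x, ψ x ≤ 1) :
    BM (fun x : EE n => ψ (ε • x) ^ ((2 * (n : ℝ) - μ) / ((n : ℝ) - 2))) ∧
    Dd μ (fun x => |ψ x * (c * (ε / (ε ^ 2 + ‖x‖ ^ 2)) ^ (((n : ℝ) - 2) / 2))| ^
                ((2 * (n : ℝ) - μ) / ((n : ℝ) - 2))) = 
      c ^ (2 * ((2 * (n : ℝ) - μ) / ((n : ℝ) - 2))) * 2 ^ (-(2 * (n:ℝ) - μ)) * (2^(-(μ/2)) * Mw n ^ 2 *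
        Qf (Pw n) (kk xi (μ/2)) (fun x => ψ (ε • x) ^ ((2 * (n : ℝ) - μ) / ((n : ℝ) - 2)))) := by
  have hn0 : (3:ℝ) ≤ n := by exact_mod_cast hn.out
  have hM := Mw_pos (n := n)
  have hn2 : (0:ℝ) < n - 2 := by linarith
  have h2n : (0:ℝ) < 2 * n - μ := by linarith
  have hb : 0 < μ/2 := by linarith
  have h2b : 2 * (μ/2) < n := by linarith
  set p := (2 * (n : ℝ) - μ) / ((n : ℝ) - 2) with hp
  have hp0 : 0 < p := by positivity
  have hB : BM (fun x : EE n => ψ (ε • x) ^ p) := by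
    refine ⟨?_, 1, fun x => ?_⟩
    · exact ((hψs.comp (continuous_const_smul ε)).rpow_const fun x => Or.inr hp0.le).measurable
    · rw [abs_of_nonneg (Real.rpow_nonneg (hψ0 _) _)]
      exact Real.rpow_le_one (hψ0 _) (hψ1 _) hp0.le
  refine ⟨hB, ?_⟩
  set f : EE n → ℝ := fun x => |ψ x * (c * (ε / (ε ^ 2 + ‖x‖ ^ 2)) ^ (((n : ℝ) - 2) / 2))| ^ p with hf
  have hs := Dd_aff μ f hε 0
  have e1 : (fun x => f (ε • x + 0)) = fun x => (c^p * (2 * ε)^(-((n:ℝ) - μ/2))) * (ψ (ε • x) ^ p * wt x ^ ((n:ℝ) - μ/2)) := by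
    funext x
    simp only [hf, add_zero]
    have w0 := wt_pos x
    have e2 : ε / (ε^2 + ‖ε • x‖^2) = (2*ε)⁻¹ * wt x := by
      rw [norm_smul, Real.norm_of_nonneg hε.le, wt]; field_simp
    rw [e2, abs_of_nonneg (mul_nonneg (hψ0 _) (by positivity)), Real.mul_rpow (hψ0 _) (by positivity),
      Real.mul_rpow hc.le (by positivity), ← Real.rpow_mul (by positivity)]
    have e3 : ((n:ℝ) - 2)/2 * p = n - μ/2 := by rw [hp]; field_simp
    rw [e3, Real.mul_rpow (by positivity) w0.le, Real.inv_rpow (by positivity), Real.rpow_neg (by positivity)]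
    ring
  rw [e1, Dd_smul] at hs
  have eQ := Q_eq_D hb h2b hB
  rw [show 2 * (μ/2) = μ by ring] at eQ
  set D0 := Dd μ fun x => ψ (ε • x) ^ p * wt x ^ ((n:ℝ) - μ/2) with hD0
  rw [eQ]
  have hεm := Real.rpow_pos_of_pos hε μ
  have e4 : Dd μ f = ε^(-μ) * (ε^n * ε^n) * ((c^p * (2 * ε)^(-((n:ℝ) - μ/2)))^2 * D0) := by
    rw [hs, Real.rpow_neg hε.le]; field_simp
  have e5 : (((2:ℝ) * ε)^(-((n:ℝ) - μ/2))) ^ 2 = 2^(-(2 * (n:ℝ) - μ)) * (ε^μ * (ε^n * ε^n)⁻¹) := by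
    rw [← Real.rpow_natCast, ← Real.rpow_mul (by positivity), Real.mul_rpow two_pos.le hε.le]
    rw [show -((n:ℝ) - μ/2) * ((2:ℕ):ℝ) = -(2 * (n:ℝ) - μ) by push_cast; ring]
    congr 1
    rw [show -(2 * (n:ℝ) - μ) = μ + -((n:ℝ) + n) by ring, Real.rpow_add hε, Real.rpow_neg hε.le (n + n : ℝ), Real.rpow_add hε,
      Real.rpow_natCast]
  have e6 : (c^p)^2 = c^(2*p) := by
    rw [← Real.rpow_natCast, ← Real.rpow_mul hc.le]; congr 1; push_cast; ring
  rw [e4, mul_pow, e5, e6, Real.rpow_neg hε.le, Real.rpow_neg two_pos.le (μ/2)]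
  have h2 := Real.rpow_pos_of_pos (two_pos (α := ℝ)) (μ/2)
  field_simp

end

section
variable {n : ℕ}

lemma grad_bd [hn : Fact (3 ≤ n)] {c r : ℝ} (hr : 0 < r) (hc : 0 < c)
    {ψ : EE n → ℝ} (hψs : ContDiff ℝ (⊤ : ℕ∞) ψ) (hψc : HasCompactSupport ψ)
    (hψ0 : ∀ x, 0 ≤ ψ x) (hψ1 : ∀ x, ψ x ≤ 1)
    (hψin : ∀ x ∈ Metric.ball (0 : EE n) r, ψ x = 1)
    (hψout : ∀ x ∉ Metric.ball (0 : EE n) (2 * r), ψ x = 0) :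
    ∃ K : ℝ, 0 ≤ K ∧ ∀ ε : ℝ, 0 < ε →
      (∫ x, ‖fderiv ℝ (fun z : EE n =>
                ψ z * (c * (ε / (ε ^ 2 + ‖z‖ ^ 2)) ^ (((n : ℝ) - 2) / 2))) x‖ ^ 2) ≤
      c^2 * (n * ((n:ℝ)-2) * Mw n / 2^n) + K * ε ^ ((n:ℝ) - 2) := by
  have hn0 : (3:ℝ) ≤ n := by exact_mod_cast hn.out
  have hn2 : (0:ℝ) < n - 2 := by linarith
  obtain ⟨K0, hK0⟩ : ∃ K0, ∀ x, ‖fderiv ℝ ψ x‖ ≤ K0 :=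
    (hψs.continuous_fderiv (by simp)).bounded_above_of_compact_support (hψc.fderiv ℝ)
  have hK00 : 0 ≤ K0 := (norm_nonneg _).trans (hK0 0)
  set s := ((n:ℝ) - 2)/2 with hs
  have hs0 : 0 < s := by positivity
  set B0 := (r^2)^(-s) with hB0
  have hB00 : 0 ≤ B0 := by positivity
  set B1 := 1 + ((n:ℝ)-2)^2 * (r^2)^(-(n:ℝ)) * (2*r)^2 with hB1
  have hB10 : 0 ≤ B1 := by positivity
  set K1 := 2 * B1 * B0 * K0 + B0^2 * K0^2 with hK1
  have hK10 : 0 ≤ K1 := by positivity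
  set vB := (volume : Measure (EE n)).real (Metric.closedBall 0 (2*r)) with hvB
  have hvB0 : 0 ≤ vB := measureReal_nonneg
  refine ⟨c^2 * (K1 * vB), by positivity, fun ε hε => ?_⟩
  set a := c * ε^s with ha
  have ha0 : 0 ≤ a := by positivity
  have hw : (fun z : EE n => ψ z * (c * (ε / (ε ^ 2 + ‖z‖ ^ 2)) ^ s)) = fun z => ψ z * (a * Gd ε s z) := by
    funext z
    rw [Real.div_rpow hε.le (by positivity), Gd, Real.rpow_neg (by positivity), ha]; ring
  rw [hw]
  have hp : ∀ x, ‖fderiv ℝ (fun z => ψ z * (a * Gd ε s z)) x‖^2 ≤ 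
      a^2 * (‖fderiv ℝ (Gd ε s) x‖^2 + (Metric.closedBall (0:EE n) (2*r)).indicator (fun _ => K1) x) := by
    intro x
    have hG := (Gd_fderiv hε s x)
    have hψd := (hψs.differentiable (by simp) x).hasFDerivAt
    have hd := hψd.mul (hG.const_mul a)
    have hd' : HasFDerivAt (fun z => ψ z * (a * Gd ε s z)) _ x := hd
    rw [hd'.fderiv]
    rw [← hG.fderiv]
    have hGp : 0 ≤ Gd ε s x := by unfold Gd; positivity
    have hle : ‖ψ x • a • fderiv ℝ (Gd ε s) x + (a * Gd ε s x) • fderiv ℝ ψ x‖ ≤ 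
        a * ‖fderiv ℝ (Gd ε s) x‖ + a * Gd ε s x * ‖fderiv ℝ ψ x‖ := by
      refine (norm_add_le _ _).trans ?_
      rw [norm_smul, norm_smul, norm_smul, Real.norm_of_nonneg (hψ0 x), Real.norm_of_nonneg ha0,
        Real.norm_of_nonneg (mul_nonneg ha0 hGp)]
      exact add_le_add (mul_le_of_le_one_left (by positivity) (hψ1 x)) le_rfl
    have hsq := pow_le_pow_left₀ (norm_nonneg _) hle 2
    refine hsq.trans ?_
    have hind : 0 ≤ (Metric.closedBall (0:EE n) (2*r)).indicator (fun _ => K1) x :=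
      Set.indicator_nonneg (fun _ _ => hK10) x
    have hzero : fderiv ℝ ψ x = 0 → (a * ‖fderiv ℝ (Gd ε s) x‖ + a * Gd ε s x * ‖fderiv ℝ ψ x‖)^2 ≤
        a^2 * (‖fderiv ℝ (Gd ε s) x‖^2 + (Metric.closedBall (0:EE n) (2*r)).indicator (fun _ => K1) x) := by
      intro h0
      rw [h0, norm_zero, mul_zero, add_zero, mul_pow]
      gcongr; linarith
    rcases lt_or_ge ‖x‖ r with h1 | h1
    · apply hzero
      have : ψ =ᶠ[nhds x] fun _ => (1:ℝ) := by
        filter_upwards [Metric.isOpen_ball.mem_nhds (show x ∈ Metric.ball (0:EE n) r by simpa using h1)] with y hy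
        exact hψin y hy
      rw [this.fderiv_eq]; simp
    rcases lt_or_ge (2*r) ‖x‖ with h2 | h2
    · apply hzero
      have : ψ =ᶠ[nhds x] fun _ => (0:ℝ) := by
        filter_upwards [Metric.isClosed_closedBall.isOpen_compl.mem_nhds (show x ∈ (Metric.closedBall (0:EE n) (2*r))ᶜ by simpa using h2)] with y hy
        exact hψout y fun hy' => hy (Metric.ball_subset_closedBall hy')
      rw [this.fderiv_eq]; simp
    rw [Set.indicator_of_mem (by simpa using h2)]
    have hx2 : r^2 ≤ ε^2 + ‖x‖^2 := by nlinarith [sq_nonneg ε]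
    have g0 : Gd ε s x ≤ B0 := by
      unfold Gd
      exact Real.rpow_le_rpow_of_nonpos (by positivity) hx2 (by linarith)
    have g1 : ‖fderiv ℝ (Gd ε s) x‖ ≤ B1 := by
      have e := Gd_grad_sq hε x
      rw [← hs] at e
      have : ‖fderiv ℝ (Gd ε s) x‖^2 ≤ B1 - 1 := by
        rw [e, hB1, add_sub_cancel_left]
        have := Real.rpow_le_rpow_of_nonpos (by positivity) hx2 (show -(n:ℝ) ≤ 0 by linarith)
        gcongr
      nlinarith [sq_nonneg (‖fderiv ℝ (Gd ε s) x‖ - 1)]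
    have g2 := hK0 x
    set X := ‖fderiv ℝ (Gd ε s) x‖
    set G := Gd ε s x
    set Z := ‖fderiv ℝ ψ x‖
    have hX : 0 ≤ X := norm_nonneg _
    have hZ : 0 ≤ Z := norm_nonneg _
    have : (a * X + a * G * Z)^2 = a^2 * (X^2 + (2 * X * G * Z + G^2 * Z^2)) := by ring
    rw [this, hK1]
    gcongr
  have hE := Gd_energy (n := n) hε
  rw [← hs] at hE
  have hii : Integrable ((Metric.closedBall (0:EE n) (2*r)).indicator (fun _ => K1)) volume := by
    refine (integrable_indicator_iff Metric.isClosed_closedBall.measurableSet).mpr ?_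
    exact integrableOn_const (isCompact_closedBall _ _).measure_lt_top.ne
  have hmono := integral_mono_of_nonneg (Filter.Eventually.of_forall fun x => by positivity) ((hE.1.add hii).const_mul (a^2))
    (Filter.Eventually.of_forall hp)
  refine hmono.trans_eq ?_
  simp only [Pi.add_apply]
  rw [integral_const_mul, integral_add hE.1 hii, hE.2, integral_indicator Metric.isClosed_closedBall.measurableSet,
    setIntegral_const, smul_eq_mul, ← hvB]
  have e1 : (ε^s)^2 = ε^((n:ℝ) - 2) := by
    rw [← Real.rpow_natCast, ← Real.rpow_mul hε.le, hs]; congr 1; push_cast; ring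
  have e2 : ε^(n-2) = ε^((n:ℝ)-2) := by
    rw [← Real.rpow_natCast]; congr 1; push_cast [Nat.cast_sub (show 2 ≤ n by linarith [hn.out])]; ring
  rw [ha, mul_pow, e1, e2]
  have := Real.rpow_pos_of_pos hε ((n:ℝ)-2)
  field_simp

end

/-- **Talenti bubble estimates for the critical Choquard problem.** For a cutoff
`ψ` (smooth, `0 ≤ ψ ≤ 1`, `ψ ≡ 1` on `B_r(0)`, `ψ ≡ 0` off `B_{2r}(0)`), setting
`V_ε(x) = c_{n,μ} (ε/(ε² + ‖x‖²))^{(n-2)/2}` and `w_ε = ψ V_ε`, one has for all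
small `ε`:
(i) `∫‖∇w_ε‖² ≤ S_{H,L}^{(2n-μ)/(n-μ+2)} + C ε^{n-2}`;
(ii) `∫∫ |w_ε(x)|^{2_μ^*}|w_ε(y)|^{2_μ^*}/‖x-y‖^μ ≤ S_{H,L}^{(2n-μ)/(n-μ+2)} + C ε^n`;
(iii) `∫∫ |w_ε(x)|^{2_μ^*}|w_ε(y)|^{2_μ^*}/‖x-y‖^μ ≥ S_{H,L}^{(2n-μ)/(n-μ+2)} - C ε^n`. -/
theorem talenti_bubble_estimates (n : ℕ) (hn : 3 ≤ n) (μ r : ℝ)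
    (hμ0 : 0 < μ) (hμn : μ < n) (hr : 0 < r)
    (ψ : EuclideanSpace ℝ (Fin n) → ℝ) (hψs : ContDiff ℝ (⊤ : ℕ∞) ψ)
    (hψc : HasCompactSupport ψ)
    (hψ0 : ∀ x, 0 ≤ ψ x) (hψ1 : ∀ x, ψ x ≤ 1)
    (hψin : ∀ x ∈ Metric.ball (0 : EuclideanSpace ℝ (Fin n)) r, ψ x = 1)
    (hψout : ∀ x ∉ Metric.ball (0 : EuclideanSpace ℝ (Fin n)) (2 * r), ψ x = 0) :
    ∃ c : ℝ, 0 < c ∧ ∃ C : ℝ, 0 < C ∧ ∃ ε₀ ∈ Set.Ioo (0 : ℝ) 1,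
      ∀ ε ∈ Set.Ioo (0 : ℝ) ε₀,
        (∫ x, ‖fderiv ℝ
              (fun z : EuclideanSpace ℝ (Fin n) =>
                ψ z * (c * (ε / (ε ^ 2 + ‖z‖ ^ 2)) ^ (((n : ℝ) - 2) / 2))) x‖ ^ 2) ≤
          SHL n μ ^ ((2 * (n : ℝ) - μ) / ((n : ℝ) - μ + 2)) + C * ε ^ ((n : ℝ) - 2) ∧
        (∫ x, ∫ y,
            |ψ x * (c * (ε / (ε ^ 2 + ‖x‖ ^ 2)) ^ (((n : ℝ) - 2) / 2))| ^
                ((2 * (n : ℝ) - μ) / ((n : ℝ) - 2)) *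
              |ψ y * (c * (ε / (ε ^ 2 + ‖y‖ ^ 2)) ^ (((n : ℝ) - 2) / 2))| ^
                ((2 * (n : ℝ) - μ) / ((n : ℝ) - 2)) / ‖x - y‖ ^ μ) ≤
          SHL n μ ^ ((2 * (n : ℝ) - μ) / ((n : ℝ) - μ + 2)) + C * ε ^ (n : ℝ) ∧
        SHL n μ ^ ((2 * (n : ℝ) - μ) / ((n : ℝ) - μ + 2)) - C * ε ^ (n : ℝ) ≤
          (∫ x, ∫ y,
            |ψ x * (c * (ε / (ε ^ 2 + ‖x‖ ^ 2)) ^ (((n : ℝ) - 2) / 2))| ^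
                ((2 * (n : ℝ) - μ) / ((n : ℝ) - 2)) *
              |ψ y * (c * (ε / (ε ^ 2 + ‖y‖ ^ 2)) ^ (((n : ℝ) - 2) / 2))| ^
                ((2 * (n : ℝ) - μ) / ((n : ℝ) - 2)) / ‖x - y‖ ^ μ) := by
  haveI : Fact (3 ≤ n) := ⟨hn⟩
  have hn0 : (3:ℝ) ≤ n := by exact_mod_cast hn
  have hM := Mw_pos (n := n)
  have hn2 : (0:ℝ) < n - 2 := by linarith
  have h2n : (0:ℝ) < 2 * n - μ := by linarith
  have hq : (0:ℝ) < n - μ + 2 := by linarith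
  have hb : 0 < μ/2 := by linarith
  have h2b : 2 * (μ/2) < n := by linarith
  have hγ := gam_pos (n := n) hb h2b
  have hSV := SV_pos (n := n) hμ0 hμn
  have hS : SV n μ ≤ SHL n μ := by
    unfold SHL
    refine le_csInf ⟨_, ψ, hψs, hψc, ?_, rfl⟩ ?_
    · intro h
      have := hψin 0 (by simpa using hr)
      rw [h] at this; simp at this
    · rintro t ⟨u, hu1, hu2, hu0, rfl⟩
      exact quot hμ0 hμn ⟨hu1, hu2⟩ hu0
  have hS0 : 0 < SHL n μ := hSV.trans_le hS
  set S := SHL n μ with hSd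
  set q := (2 * (n : ℝ) - μ) / ((n : ℝ) - μ + 2) with hqd
  set p := (2 * (n : ℝ) - μ) / ((n : ℝ) - 2) with hpd
  have hp0 : 0 < p := by positivity
  set Γ := 2^(-(μ/2)) * Mw n ^ 2 * gam n (μ/2) with hΓ
  have hΓ0 : 0 < Γ := by positivity
  have hSq : 0 < S ^ q := Real.rpow_pos_of_pos hS0 _
  set T := S^q * 2^(2 * (n:ℝ) - μ) / Γ with hT
  have hT0 : 0 < T := by positivity
  set c := T^(1/(2*p)) with hcd
  have hc0 : 0 < c := Real.rpow_pos_of_pos hT0 _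
  have hc2p : c^(2*p) = T := by
    rw [hcd, ← Real.rpow_mul hT0.le, one_div_mul_cancel (by positivity), Real.rpow_one]
  have hc2 : c^2 * (n * ((n:ℝ)-2) * Mw n / 2^n) ≤ S^q := by
    have e1 : c^2 = T^(((n:ℝ) - 2) / (2 * (n : ℝ) - μ)) := by
      rw [hcd, ← Real.rpow_natCast, ← Real.rpow_mul hT0.le, hpd]; congr 1; push_cast; field_simp
    have e2 : c^2 = S^(((n:ℝ) - 2)/((n : ℝ) - μ + 2)) * (2^n / 4) / Γ^(((n:ℝ) - 2) / (2 * (n : ℝ) - μ)) := by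
      rw [e1, hT, Real.div_rpow (by positivity) hΓ0.le, Real.mul_rpow hSq.le (by positivity), ← Real.rpow_mul hS0.le,
        ← Real.rpow_mul two_pos.le]
      congr 2
      · congr 1; rw [hqd]; field_simp
      · rw [mul_div_cancel₀ _ h2n.ne', Real.rpow_sub two_pos, Real.rpow_natCast]; norm_num
    have e3 : c^2 * (n * ((n:ℝ)-2) * Mw n / 2^n) = S^(((n:ℝ) - 2)/((n : ℝ) - μ + 2)) * SV n μ := by
      rw [e2, SV, ← hΓ]
      have := Real.rpow_pos_of_pos hΓ0 (((n:ℝ) - 2) / (2 * (n : ℝ) - μ))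
      field_simp
    have e4 : S^q = S^(((n:ℝ) - 2)/((n : ℝ) - μ + 2)) * S := by
      rw [← Real.rpow_add_one hS0.ne']; congr 1; rw [hqd]; field_simp; ring
    rw [e3, e4]
    exact mul_le_mul_of_nonneg_left hS (Real.rpow_nonneg hS0.le _)
  obtain ⟨K, hK, hKg⟩ := grad_bd hr hc0 hψs hψc hψ0 hψ1 hψin hψout
  set Cr := ((1 + r^2)/r^2)^n with hCr
  have hCr0 : 0 < Cr := by positivity
  refine ⟨c, hc0, K + 2 * S^q * Cr, by positivity, 1/2, by norm_num, fun ε hε => ?_⟩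
  have hε0 : 0 < ε := hε.1
  have hεn : 0 < ε^((n:ℝ)-2) := Real.rpow_pos_of_pos hε0 _
  have hεn' : 0 < ε^(n:ℝ) := Real.rpow_pos_of_pos hε0 _
  obtain ⟨hB, hD⟩ := D_bub (n := n) hμ0 hμn hc0 hε0 hψs.continuous hψ0 hψ1
  rw [← hpd] at hB hD
  obtain ⟨hQ1, hQ2⟩ := Q_bd hb h2b hB (fun x => Real.rpow_nonneg (hψ0 _) _)
    (fun x => Real.rpow_le_one (hψ0 _) (hψ1 _) hp0.le)
  have ht := tail_bd (n := n) hr hε0 hp0 hψ0 hψ1 hψin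
  rw [← hCr, ← Real.rpow_natCast ε n] at ht
  unfold Dd at hD
  set Q := Qf (Pw n) (kk xi (μ/2)) (fun x => ψ (ε • x) ^ p) with hQ
  have hD2 : c^(2*p) * 2 ^ (-(2 * (n:ℝ) - μ)) * (2^(-(μ/2)) * Mw n ^ 2 * Q) = S^q * (Q / gam n (μ/2)) := by
    rw [hc2p, hT, hΓ, Real.rpow_neg two_pos.le (2 * (n:ℝ) - μ)]
    have h2 := Real.rpow_pos_of_pos (two_pos (α := ℝ)) (-(μ/2))
    have h3 := Real.rpow_pos_of_pos (two_pos (α := ℝ)) (2 * (n:ℝ) - μ)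
    field_simp
  rw [hD2] at hD
  refine ⟨?_, ?_, ?_⟩
  · refine (hKg ε hε0).trans ?_
    have : 0 ≤ 2 * S^q * Cr * ε^((n:ℝ)-2) := by positivity
    linarith
  · rw [hD]
    have : Q / gam n (μ/2) ≤ 1 := by rw [div_le_one hγ]; exact hQ1
    have h2 : S^q * (Q / gam n (μ/2)) ≤ S^q := mul_le_of_le_one_right hSq.le this
    have h3 : 0 ≤ (K + 2 * S^q * Cr) * ε^(n:ℝ) := by positivity
    linarith
  · rw [hD]
    have : 1 - 2 * (Cr * ε^(n:ℝ)) ≤ Q / gam n (μ/2) := by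
      rw [le_div_iff₀ hγ]
      have := mul_le_mul_of_nonneg_left ht (show 0 ≤ 2 * gam n (μ/2) by positivity)
      linarith
    have h2 := mul_le_mul_of_nonneg_left this hSq.le
    have h3 : 0 ≤ K * ε^(n:ℝ) := by positivity
    linarith
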